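/- Let (a_n)_{n≥1} be a sequence of distinct positive real numbers such that inf_{1≤m≠n≤N} |a_m − a_n| ≥ 1 for all N ∈ ℕ. Then for almost all α ∈ [0,1], the inequality ⌊δ_min^α⌋(N) ≤ 4·log₂ B_N / (H_N · log(N/9) · log₂(N/9)) holds for infinitely many N, where B_N = max_{1≤m≠n≤N} ⌊|a_m − a_n|⌋. -/

import Mathlib

open MeasureTheory Filter

/-- Distance from a real number to the nearest integer. -/
noncomputable def nint (x : ℝ) : ℝ := |x - round x|

/-- `floorDeltaMin a α N = min { ‖α ⌊|a_m − a_n|⌋‖ : 1 ≤ m ≠ n ≤ N }`. -/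
noncomputable def floorDeltaMin (a : ℕ → ℝ) (α : ℝ) (N : ℕ) : ℝ :=
  sInf {d : ℝ | ∃ m n : ℕ, 1 ≤ m ∧ m ≤ N ∧ 1 ≤ n ∧ n ≤ N ∧ m ≠ n ∧
    d = nint (α * (⌊|a m - a n|⌋ : ℝ))}

/-- `Hcard a N` is the number of distinct floored positive differences
`#{ ⌊|a_m − a_n|⌋ : 1 ≤ m ≠ n ≤ N }`. -/
noncomputable def Hcard (a : ℕ → ℝ) (N : ℕ) : ℕ :=
  Set.ncard {k : ℤ | ∃ m n : ℕ, 1 ≤ m ∧ m ≤ N ∧ 1 ≤ n ∧ n ≤ N ∧ m ≠ n ∧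
    k = ⌊|a m - a n|⌋}

/-- `Log x = max (1, log x)`. -/
noncomputable def Log (x : ℝ) : ℝ := max 1 (Real.log x)

/-- Iterated logarithm `log₂ x = Log (Log x)`. -/
noncomputable def Log2 (x : ℝ) : ℝ := Log (Log x)

/-- The decay exponent `|i - j|` in truncated subtraction. -/
def gap (i j : ℕ) : ℕ := (i - j) + (j - i)

lemma gap_comm (i j : ℕ) : gap i j = gap j i := by unfold gap; omega

lemma gap_self (i : ℕ) : gap i i = 0 := by unfold gap; omega

lemma one_le_gap {i j : ℕ} (h : i ≠ j) : 1 ≤ gap i j := by unfold gap; omega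

lemma sum_pow_gap_ne_le {x : ℝ} (hx0 : 0 ≤ x) (hx1 : x < 1) (s : Finset ℕ) (i : ℕ) :
    ∑ j ∈ (s).filter (fun j => j ≠ i), x ^ gap i j ≤ 2 * x / (1 - x) := by
  have hgeo : ∀ s : Finset ℕ, (∀ m ∈ s, 1 ≤ m) → ∑ m ∈ s, x ^ m ≤ x / (1 - x) := by
    intro s hs
    have hsum : Summable (fun m : ℕ => x ^ (m + 1)) := by
      simpa [pow_succ] using (summable_geometric_of_lt_one hx0 hx1).mul_right x
    have h1 : ∑ m ∈ s, x ^ m = ∑ m ∈ s.image (fun m => m - 1), x ^ (m + 1) := by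
      rw [Finset.sum_image]
      · refine Finset.sum_congr rfl fun m hm => ?_
        rw [Nat.sub_add_cancel (hs m hm)]
      · intro a ha b hb hab
        have := hs a ha; have := hs b hb; simp only at hab; omega
    rw [h1]
    refine (hsum.sum_le_tsum _ fun _ _ => by positivity).trans ?_
    simp only [pow_succ]
    rw [tsum_mul_right, tsum_geometric_of_lt_one hx0 hx1]
    apply le_of_eq; ring
  have hsplit : (s).filter (fun j => j ≠ i)
      = (s).filter (fun j => j < i) ∪ (s).filter (fun j => i < j) := by
    ext j; simp only [Finset.mem_filter, Finset.mem_union]; grind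
  have hd : Disjoint ((s).filter (fun j => j < i))
      ((s).filter (fun j => i < j)) := by
    rw [Finset.disjoint_left]; intro j; simp only [Finset.mem_filter]; omega
  rw [hsplit, Finset.sum_union hd]
  have h1 : ∑ j ∈ (s).filter (fun j => j < i), x ^ gap i j ≤ x / (1 - x) := by
    rw [← Finset.sum_image (f := fun m => x ^ m) (g := fun j => gap i j)]
    · apply hgeo; intro m hm
      simp only [Finset.mem_image, Finset.mem_filter] at hm
      obtain ⟨j, hj, rfl⟩ := hm
      exact one_le_gap (by omega)
    · intro a ha b hb hab
      simp only [Finset.coe_filter, Set.mem_ofPred_eq] at ha hb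
      simp only [gap] at hab; omega
  have h2 : ∑ j ∈ (s).filter (fun j => i < j), x ^ gap i j ≤ x / (1 - x) := by
    rw [← Finset.sum_image (f := fun m => x ^ m) (g := fun j => gap i j)]
    · apply hgeo; intro m hm
      simp only [Finset.mem_image, Finset.mem_filter] at hm
      obtain ⟨j, hj, rfl⟩ := hm
      exact one_le_gap (by omega)
    · intro a ha b hb hab
      simp only [Finset.coe_filter, Set.mem_ofPred_eq] at ha hb
      simp only [gap] at hab; omega
  calc _ ≤ x / (1 - x) + x / (1 - x) := add_le_add h1 h2
    _ = _ := by ring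

lemma sum_pow_gap_le {x : ℝ} (hx0 : 0 ≤ x) (hx1 : x < 1) (s : Finset ℕ) (i : ℕ) :
    ∑ j ∈ s, x ^ gap i j ≤ 1 + 2 * x / (1 - x) := by
  have h := sum_pow_gap_ne_le hx0 hx1 s i
  rw [← Finset.sum_filter_add_sum_filter_not (s) (fun j => j ≠ i)]
  have : ∑ j ∈ (s).filter (fun j => ¬ j ≠ i), x ^ gap i j ≤ 1 := by
    calc _ ≤ ∑ j ∈ ({i} : Finset ℕ), x ^ gap i j := by
          apply Finset.sum_le_sum_of_subset_of_nonneg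
          · intro j; simp only [Finset.mem_filter, Finset.mem_singleton]; tauto
          · intros; positivity
      _ = 1 := by simp [gap_self]
  linarith

/-- Schur test for the kernel `x ^ |i - j|`. -/
lemma schur_gap {x : ℝ} (hx0 : 0 ≤ x) (hx1 : x < 1) (s t : Finset ℕ) (A B : ℕ → ℝ) :
    ∑ i ∈ s, ∑ j ∈ t, A i * B j * x ^ gap i j
      ≤ (∑ i ∈ s, A i ^ 2 + ∑ j ∈ t, B j ^ 2) / 2 * (1 + 2 * x / (1 - x)) := by
  have h1 : ∑ i ∈ s, ∑ j ∈ t, A i * B j * x ^ gap i j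
      ≤ ∑ i ∈ s, ∑ j ∈ t, (A i ^ 2 / 2 * x ^ gap i j + B j ^ 2 / 2 * x ^ gap i j) := by
    gcongr with i _ j _
    rw [← add_mul]
    gcongr
    nlinarith [sq_nonneg (A i - B j)]
  refine h1.trans ?_
  simp only [Finset.sum_add_distrib]
  rw [Finset.sum_comm (f := fun i j => B j ^ 2 / 2 * x ^ gap i j)]
  simp only [← Finset.mul_sum]
  have h2 : ∑ i ∈ s, A i ^ 2 / 2 * ∑ j ∈ t, x ^ gap i j
      ≤ ∑ i ∈ s, A i ^ 2 / 2 * (1 + 2 * x / (1 - x)) := by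
    gcongr with i _
    exact sum_pow_gap_le hx0 hx1 t i
  have h3 : ∑ j ∈ t, B j ^ 2 / 2 * ∑ i ∈ s, x ^ gap i j
      ≤ ∑ j ∈ t, B j ^ 2 / 2 * (1 + 2 * x / (1 - x)) := by
    gcongr with j _
    simp only [gap_comm _ j]
    exact sum_pow_gap_le hx0 hx1 s j
  rw [← Finset.sum_mul, ← Finset.sum_div] at h2 h3
  linarith

lemma bilinear_gap_split {x : ℝ} {s : Finset ℕ} {i j : ℕ} (hi : i ∈ s) (hj : j ∈ s)
    (A B : ℕ → ℝ) :
    ∑ k ∈ s, ∑ l ∈ s, A k * B l * x ^ gap k l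
      = A i * B j * x ^ gap i j + A i * ∑ l ∈ s.erase j, B l * x ^ gap i l
        + B j * ∑ k ∈ s.erase i, A k * x ^ gap k j
        + ∑ k ∈ s.erase i, ∑ l ∈ s.erase j, A k * B l * x ^ gap k l := by
  rw [← Finset.add_sum_erase s _ hi, ← Finset.add_sum_erase s _ hj]
  have : ∀ k, ∑ l ∈ s, A k * B l * x ^ gap k l
      = A k * B j * x ^ gap k j + ∑ l ∈ s.erase j, A k * B l * x ^ gap k l := fun k =>
    (Finset.add_sum_erase s _ hj).symm
  simp only [this, Finset.sum_add_distrib, Finset.mul_sum]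
  have e1 : ∀ l, A i * B l * x ^ gap i l = A i * (B l * x ^ gap i l) := fun l => by ring
  have e2 : ∀ k, A k * B j * x ^ gap k j = B j * (A k * x ^ gap k j) := fun l => by ring
  simp only [e1, e2]
  ring

lemma le_of_sum_fourth_pow_le {s : Finset ℕ} {d : ℕ → ℝ} {w : ℝ} (hd : ∀ i, 0 ≤ d i)
    (hw : 0 ≤ w) (hds : ∑ i ∈ s, d i ^ 4 ≤ w ^ 4) {i : ℕ} (hi : i ∈ s) : d i ≤ w := by
  have h4 : d i ^ 4 ≤ w ^ 4 := (Finset.single_le_sum (f := fun i => d i ^ 4)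
    (fun j _ => pow_nonneg (hd j) _) hi).trans hds
  exact le_of_pow_le_pow_left₀ (by norm_num) hw h4

lemma sum_sixth_pow_le {s : Finset ℕ} {d : ℕ → ℝ} {w : ℝ} (hd : ∀ i, 0 ≤ d i)
    (hw : 0 ≤ w) (hds : ∑ i ∈ s, d i ^ 4 ≤ w ^ 4) : ∑ i ∈ s, (d i ^ 3) ^ 2 ≤ w ^ 6 := by
  calc ∑ i ∈ s, (d i ^ 3) ^ 2 ≤ ∑ i ∈ s, w ^ 2 * d i ^ 4 := by
        refine Finset.sum_le_sum fun i hi => ?_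
        have h1 := le_of_sum_fourth_pow_le hd hw hds hi
        have h0 := hd i
        have : (d i ^ 3) ^ 2 = d i ^ 2 * d i ^ 4 := by ring
        rw [this]
        gcongr
    _ ≤ w ^ 2 * w ^ 4 := by rw [← Finset.mul_sum]; gcongr
    _ = w ^ 6 := by ring

/-- The local inequality when one of the two distributions has no dominant atom. -/
lemma local_gap_flat {x : ℝ} (hx0 : 0 ≤ x) (hx1 : x ≤ 1 / 256) (s : Finset ℕ) {c d : ℕ → ℝ}
    (hc : ∀ i, 0 ≤ c i) (hd : ∀ i, 0 ≤ d i) (hcs : ∑ i ∈ s, c i ^ 4 = 1)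
    (hds : ∑ i ∈ s, d i ^ 4 = 1) (hmax : ∀ i ∈ s, c i ^ 4 ≤ 1 - 16 * x) :
    ∑ i ∈ s, ∑ j ∈ s, c i ^ 3 * d j ^ 3 * x ^ gap i j ≤ 1 := by
  have hsch := schur_gap hx0 (by linarith) s s (fun i => c i ^ 3) (fun i => d i ^ 3)
  have hk : 2 * x / (1 - x) ≤ 4 * x := by
    rw [div_le_iff₀ (by linarith)]; nlinarith
  have hA : ∑ i ∈ s, (c i ^ 3) ^ 2 ≤ 1 - 8 * x := by
    calc ∑ i ∈ s, (c i ^ 3) ^ 2 ≤ ∑ i ∈ s, (1 - 8 * x) * c i ^ 4 := by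
          refine Finset.sum_le_sum fun i hi => ?_
          have h1 : c i ^ 2 ≤ 1 - 8 * x := by
            apply abs_le_of_sq_le_sq' _ (by linarith) |>.2
            have := hmax i hi
            nlinarith
          have : (c i ^ 3) ^ 2 = c i ^ 2 * c i ^ 4 := by ring
          rw [this]
          have := hc i
          gcongr
      _ = 1 - 8 * x := by rw [← Finset.mul_sum, hcs, mul_one]
  have hB : ∑ i ∈ s, (d i ^ 3) ^ 2 ≤ 1 := by
    simpa using sum_sixth_pow_le (w := 1) hd zero_le_one (by rw [hds]; norm_num)
  refine hsch.trans ?_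
  have hA0 : 0 ≤ ∑ i ∈ s, (c i ^ 3) ^ 2 := Finset.sum_nonneg fun i _ => by positivity
  have hB0 : 0 ≤ ∑ i ∈ s, (d i ^ 3) ^ 2 := Finset.sum_nonneg fun i _ => by positivity
  have : 0 ≤ 2 * x / (1 - x) := by apply div_nonneg <;> linarith
  calc _ ≤ ((1 - 8 * x) + 1) / 2 * (1 + 4 * x) := by gcongr; linarith
    _ ≤ 1 := by nlinarith

lemma exists_offmass {x c d u w : ℝ} (hx0 : 0 ≤ x) (hx1 : x ≤ 1 / 1048576) (hc0 : 0 ≤ c)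
    (hd0 : 0 ≤ d) (hc3 : c ^ 3 ≤ 1) (hd3 : d ^ 3 ≤ 1) (hu0 : 0 ≤ u) (hw0 : 0 ≤ w)
    (hcu : c ^ 4 + u ^ 4 = 1) (hdw : d ^ 4 + w ^ 4 = 1) (hu16 : u ≤ 1 / 16) (hw16 : w ≤ 1 / 16)
    (hbig : x ^ 3 < u ^ 4 ∨ x ^ 3 < w ^ 4) :
    ∃ m : ℝ, u ≤ m ∧ w ≤ m ∧ m ≤ 1 / 16 ∧ 32 * x ≤ m ∧ c ^ 3 * d ^ 3 ≤ 1 - 3 / 4 * m ^ 4 := by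
  have hq : ∀ z : ℝ, 0 ≤ z → 4 * z ^ 3 ≤ 1 + 3 * z ^ 4 := fun z hz => by
    nlinarith [mul_nonneg (sq_nonneg (z - 1)) (by positivity : 0 ≤ 3 * z ^ 2 + 2 * z + 1)]
  have hlarge : ∀ m : ℝ, 0 ≤ m → x ^ 3 < m ^ 4 → 32 * x ≤ m := fun m hm h => by
    by_contra hlt
    push Not at hlt
    have h1 : m ^ 4 < (32 * x) ^ 4 := pow_lt_pow_left₀ hlt hm (by norm_num)
    have h2 : (32 * x) ^ 4 = x ^ 3 * (1048576 * x) := by ring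
    have h3 : x ^ 3 * (1048576 * x) ≤ x ^ 3 * 1 := by gcongr; linarith
    linarith
  rcases le_total u w with h | h
  · refine ⟨w, h, le_rfl, hw16, hlarge w hw0 ?_, ?_⟩
    · rcases hbig with hb | hb
      · exact hb.trans_le (by gcongr)
      · exact hb
    · have := hq _ hd0
      have : c ^ 3 * d ^ 3 ≤ d ^ 3 := mul_le_of_le_one_left (by positivity) hc3
      linarith
  · refine ⟨u, le_rfl, h, hu16, hlarge u hu0 ?_, ?_⟩
    · rcases hbig with hb | hb
      · exact hb
      · exact hb.trans_le (by gcongr)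
    · have := hq _ hc0
      have : c ^ 3 * d ^ 3 ≤ c ^ 3 := mul_le_of_le_one_right (by positivity) hd3
      linarith

/-- The local inequality when both distributions have dominant atoms, except when both atoms
are at the same place and very heavy. -/
lemma local_gap_peaked {x : ℝ} (hx0 : 0 ≤ x) (hx1 : x ≤ 1 / 2 ^ 20) (s : Finset ℕ)
    {c d : ℕ → ℝ} (hc : ∀ i, 0 ≤ c i) (hd : ∀ i, 0 ≤ d i) (hcs : ∑ i ∈ s, c i ^ 4 = 1)
    (hds : ∑ i ∈ s, d i ^ 4 = 1) {i j : ℕ} (hi : i ∈ s) (hj : j ∈ s)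
    (hci : 1 - 16 * x < c i ^ 4) (hdj : 1 - 16 * x < d j ^ 4)
    (hnot : i = j → ¬ (1 - x ^ 3 ≤ c i ^ 4 ∧ 1 - x ^ 3 ≤ d i ^ 4)) :
    ∑ i ∈ s, ∑ j ∈ s, c i ^ 3 * d j ^ 3 * x ^ gap i j ≤ 1 := by
  have hx1' : x ≤ 1 / 1048576 := by norm_num at hx1 ⊢; exact hx1
  have hk : 2 * x / (1 - x) ≤ 4 * x := by
    rw [div_le_iff₀ (by linarith)]; nlinarith
  have hk0 : 0 ≤ 2 * x / (1 - x) := by apply div_nonneg <;> linarith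
  have hroot : ∀ a : ℝ, 0 ≤ a → ∃ u : ℝ, 0 ≤ u ∧ u ^ 4 = a := fun a ha =>
    ⟨a ^ (1 / 4 : ℝ), by positivity, by
      rw [← Real.rpow_natCast, ← Real.rpow_mul ha]; norm_num⟩
  have hce := Finset.add_sum_erase s (fun i => c i ^ 4) hi
  have hde := Finset.add_sum_erase s (fun i => d i ^ 4) hj
  obtain ⟨u, hu0, hu⟩ := hroot (∑ k ∈ s.erase i, c k ^ 4)
    (Finset.sum_nonneg fun k _ => pow_nonneg (hc k) _)
  obtain ⟨w, hw0, hw⟩ := hroot (∑ k ∈ s.erase j, d k ^ 4)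
    (Finset.sum_nonneg fun k _ => pow_nonneg (hd k) _)
  have hcu : c i ^ 4 + u ^ 4 = 1 := by rw [hu]; linarith
  have hdw : d j ^ 4 + w ^ 4 = 1 := by rw [hw]; linarith
  have hc6 := sum_sixth_pow_le (s := s.erase i) hc hu0 hu.ge
  have hd6 := sum_sixth_pow_le (s := s.erase j) hd hw0 hw.ge
  have hu16 : u ≤ 1 / 16 := le_of_pow_le_pow_left₀ (n := 4) (by norm_num) (by norm_num)
    (by norm_num; linarith)
  have hw16 : w ≤ 1 / 16 := le_of_pow_le_pow_left₀ (n := 4) (by norm_num) (by norm_num)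
    (by norm_num; linarith)
  have hci1 : c i ≤ 1 := le_of_pow_le_pow_left₀ (n := 4) (by norm_num) (by norm_num)
    (by have : 0 ≤ u ^ 4 := by positivity
        linarith)
  have hdj1 : d j ≤ 1 := le_of_pow_le_pow_left₀ (n := 4) (by norm_num) (by norm_num)
    (by have : 0 ≤ w ^ 4 := by positivity
        linarith)
  have hci0 := hc i
  have hdj0 := hd j
  have hci3 : c i ^ 3 ≤ 1 := pow_le_one₀ hci0 hci1
  have hdj3 : d j ^ 3 ≤ 1 := pow_le_one₀ hdj0 hdj1
  have hsch := schur_gap hx0 (by linarith) (s.erase i) (s.erase j)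
    (fun i => c i ^ 3) (fun i => d i ^ 3)
  have hoff : ∑ k ∈ s.erase i, ∑ l ∈ s.erase j, c k ^ 3 * d l ^ 3 * x ^ gap k l
      ≤ (u ^ 6 + w ^ 6) / 2 * (1 + 4 * x) := hsch.trans (by gcongr)
  have hrow : ∑ l ∈ s.erase j, d l ^ 3 * x ^ gap i l
      ≤ w ^ 3 * ∑ l ∈ s.erase j, x ^ gap i l := by
    rw [Finset.mul_sum]
    gcongr with l hl
    · exact hd l
    · exact le_of_sum_fourth_pow_le hd hw0 hw.ge hl
  have hcol : ∑ k ∈ s.erase i, c k ^ 3 * x ^ gap k j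
      ≤ u ^ 3 * ∑ k ∈ s.erase i, x ^ gap j k := by
    rw [Finset.mul_sum]
    simp only [gap_comm _ j]
    gcongr with l hl
    · exact hc l
    · exact le_of_sum_fourth_pow_le hc hu0 hu.ge hl
  have hrow0 : 0 ≤ ∑ l ∈ s.erase j, d l ^ 3 * x ^ gap i l :=
    Finset.sum_nonneg fun l _ => by have := hd l; positivity
  have hcol0 : 0 ≤ ∑ k ∈ s.erase i, c k ^ 3 * x ^ gap k j :=
    Finset.sum_nonneg fun l _ => by have := hc l; positivity
  rw [bilinear_gap_split hi hj (fun i => c i ^ 3) (fun i => d i ^ 3)]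
  have hrow' : c i ^ 3 * ∑ l ∈ s.erase j, d l ^ 3 * x ^ gap i l
      ≤ w ^ 3 * ∑ l ∈ s.erase j, x ^ gap i l := by
    refine le_trans ?_ hrow
    exact mul_le_of_le_one_left hrow0 hci3
  have hcol' : d j ^ 3 * ∑ k ∈ s.erase i, c k ^ 3 * x ^ gap k j
      ≤ u ^ 3 * ∑ k ∈ s.erase i, x ^ gap j k := by
    refine le_trans ?_ hcol
    exact mul_le_of_le_one_left hcol0 hdj3
  by_cases hij : i = j
  · subst hij
    have hg : ∑ l ∈ s.erase i, x ^ gap i l ≤ 4 * x := by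
      refine le_trans ?_ hk
      rw [← Finset.filter_ne']
      exact sum_pow_gap_ne_le hx0 (by linarith) s i
    have hr2 : w ^ 3 * ∑ l ∈ s.erase i, x ^ gap i l ≤ w ^ 3 * (4 * x) := by gcongr
    have hc2 : u ^ 3 * ∑ l ∈ s.erase i, x ^ gap i l ≤ u ^ 3 * (4 * x) := by gcongr
    rw [gap_self, pow_zero, mul_one]
    have hbig : x ^ 3 < u ^ 4 ∨ x ^ 3 < w ^ 4 := by
      by_contra hcon
      push Not at hcon
      exact hnot rfl ⟨by linarith [hcon.1], by linarith [hcon.2]⟩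
    obtain ⟨m, hum, hwm, hm16, hxm, hcd⟩ := exists_offmass hx0 hx1' hci0 hdj0 hci3 hdj3 hu0 hw0
      hcu hdw hu16 hw16 hbig
    have hm0 : 0 ≤ m := hu0.trans hum
    have h1 : w ^ 3 * (4 * x) ≤ m ^ 4 / 8 := by
      calc w ^ 3 * (4 * x) ≤ m ^ 3 * (m / 8) := by gcongr; linarith
        _ = _ := by ring
    have h2 : u ^ 3 * (4 * x) ≤ m ^ 4 / 8 := by
      calc u ^ 3 * (4 * x) ≤ m ^ 3 * (m / 8) := by gcongr; linarith
        _ = _ := by ring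
    have h3 : (u ^ 6 + w ^ 6) / 2 * (1 + 4 * x) ≤ m ^ 4 / 8 := by
      calc (u ^ 6 + w ^ 6) / 2 * (1 + 4 * x) ≤ (m ^ 6 + m ^ 6) / 2 * 2 := by
            gcongr; linarith
        _ = m ^ 4 * (2 * m ^ 2) := by ring
        _ ≤ m ^ 4 * (1 / 8) := by gcongr; nlinarith
        _ = _ := by ring
    have h4 : 0 ≤ m ^ 4 := by positivity
    linarith
  · have hgap : x ^ gap i j ≤ x := pow_le_of_le_one hx0 (by linarith) (by
      have := one_le_gap hij; omega)
    have hr2 : w ^ 3 * ∑ l ∈ s.erase j, x ^ gap i l ≤ w ^ 3 * 2 := by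
      gcongr
      refine (sum_pow_gap_le hx0 (by linarith) _ i).trans ?_
      linarith
    have hc2 : u ^ 3 * ∑ l ∈ s.erase i, x ^ gap j l ≤ u ^ 3 * 2 := by
      gcongr
      refine (sum_pow_gap_le hx0 (by linarith) _ j).trans ?_
      linarith
    have hfirst : c i ^ 3 * d j ^ 3 * x ^ gap i j ≤ x := by
      calc c i ^ 3 * d j ^ 3 * x ^ gap i j ≤ 1 * 1 * x := by gcongr
        _ = x := by ring
    have hu3 : u ^ 3 ≤ (1 / 16) ^ 3 := by gcongr
    have hw3 : w ^ 3 ≤ (1 / 16) ^ 3 := by gcongr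
    have h3 : (u ^ 6 + w ^ 6) / 2 * (1 + 4 * x) ≤ ((1 / 16) ^ 6 + (1 / 16) ^ 6) / 2 * 2 := by
      gcongr; linarith
    norm_num at hu3 hw3 h3
    linarith

lemma local_gap_fourth {x : ℝ} (hx0 : 0 ≤ x) (hx1 : x ≤ 1 / 2 ^ 20) (s : Finset ℕ)
    {c d : ℕ → ℝ} (hc : ∀ i, 0 ≤ c i) (hd : ∀ i, 0 ≤ d i) (hcs : ∑ i ∈ s, c i ^ 4 = 1)
    (hds : ∑ i ∈ s, d i ^ 4 = 1)
    (hnot : ¬ ∃ i ∈ s, 1 - x ^ 3 ≤ c i ^ 4 ∧ 1 - x ^ 3 ≤ d i ^ 4) :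
    ∑ i ∈ s, ∑ j ∈ s, c i ^ 3 * d j ^ 3 * x ^ gap i j ≤ 1 := by
  have hx2 : x ≤ 1 / 256 := hx1.trans (by norm_num)
  by_cases h1 : ∀ i ∈ s, c i ^ 4 ≤ 1 - 16 * x
  · exact local_gap_flat hx0 hx2 s hc hd hcs hds h1
  by_cases h2 : ∀ i ∈ s, d i ^ 4 ≤ 1 - 16 * x
  · rw [Finset.sum_comm]
    refine le_of_eq_of_le ?_ (local_gap_flat hx0 hx2 s hd hc hds hcs h2)
    refine Finset.sum_congr rfl fun i _ => Finset.sum_congr rfl fun j _ => ?_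
    rw [gap_comm]; ring
  push Not at h1 h2
  obtain ⟨i, hi, hci⟩ := h1
  obtain ⟨j, hj, hdj⟩ := h2
  refine local_gap_peaked hx0 hx1 s hc hd hcs hds hi hj hci hdj ?_
  rintro rfl h
  exact hnot ⟨i, hi, h⟩

lemma local_gap_any {x : ℝ} (hx0 : 0 ≤ x) (hx1 : x ≤ 7 / 8) (s : Finset ℕ)
    {c d : ℕ → ℝ} (hc : ∀ i, 0 ≤ c i) (hd : ∀ i, 0 ≤ d i) (hcs : ∑ i ∈ s, c i ^ 4 = 1)
    (hds : ∑ i ∈ s, d i ^ 4 = 1) :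
    ∑ i ∈ s, ∑ j ∈ s, c i ^ 3 * d j ^ 3 * x ^ gap i j ≤ 16 := by
  have hk : 2 * x / (1 - x) ≤ 14 := by
    rw [div_le_iff₀ (by linarith)]; linarith
  have hk0 : 0 ≤ 2 * x / (1 - x) := by apply div_nonneg <;> linarith
  have h1 := sum_sixth_pow_le (w := 1) hc zero_le_one (by rw [hcs]; norm_num)
  have h2 := sum_sixth_pow_le (w := 1) hd zero_le_one (by rw [hds]; norm_num)
  refine (schur_gap hx0 (by linarith) s s (fun i => c i ^ 3) (fun i => d i ^ 3)).trans ?_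
  calc _ ≤ ((1 : ℝ) ^ 6 + 1 ^ 6) / 2 * (1 + 14) := by gcongr
    _ ≤ 16 := by norm_num

lemma sum_rpow_gap_eq {α β : ℕ → ℝ} (hα : ∀ i, 0 ≤ α i) (hβ : ∀ i, 0 ≤ β i) (s : Finset ℕ)
    (x : ℝ) (ha : 0 < ∑ i ∈ s, α i) (hb : 0 < ∑ i ∈ s, β i) :
    ∃ c d : ℕ → ℝ, (∀ i, 0 ≤ c i) ∧ (∀ i, 0 ≤ d i) ∧ ∑ i ∈ s, c i ^ 4 = 1 ∧
      ∑ i ∈ s, d i ^ 4 = 1 ∧ (∀ i, c i ^ 4 = α i / ∑ i ∈ s, α i) ∧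
      (∀ i, d i ^ 4 = β i / ∑ i ∈ s, β i) ∧
      ∑ i ∈ s, ∑ j ∈ s, (α i * β j) ^ (3 / 4 : ℝ) * x ^ gap i j
        = (∑ i ∈ s, ∑ j ∈ s, c i ^ 3 * d j ^ 3 * x ^ gap i j)
          * ((∑ i ∈ s, α i) * ∑ i ∈ s, β i) ^ (3 / 4 : ℝ) := by
  set a := ∑ i ∈ s, α i
  set b := ∑ i ∈ s, β i
  have h4 : ∀ z : ℝ, 0 ≤ z → (z ^ (1 / 4 : ℝ)) ^ 4 = z := fun z hz => by
    rw [← Real.rpow_natCast, ← Real.rpow_mul hz]; norm_num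
  have h3 : ∀ z : ℝ, 0 ≤ z → (z ^ (1 / 4 : ℝ)) ^ 3 = z ^ (3 / 4 : ℝ) := fun z hz => by
    rw [← Real.rpow_natCast, ← Real.rpow_mul hz]; norm_num
  have hα' : ∀ i, 0 ≤ α i / a := fun i => div_nonneg (hα i) ha.le
  have hβ' : ∀ i, 0 ≤ β i / b := fun i => div_nonneg (hβ i) hb.le
  refine ⟨fun i => (α i / a) ^ (1 / 4 : ℝ), fun i => (β i / b) ^ (1 / 4 : ℝ),
    fun i => Real.rpow_nonneg (hα' i) _, fun i => Real.rpow_nonneg (hβ' i) _, ?_, ?_,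
    fun i => h4 _ (hα' i), fun i => h4 _ (hβ' i), ?_⟩
  · simp only [h4 _ (hα' _)]
    rw [← Finset.sum_div, div_self ha.ne']
  · simp only [h4 _ (hβ' _)]
    rw [← Finset.sum_div, div_self hb.ne']
  · rw [Finset.sum_mul]
    refine Finset.sum_congr rfl fun i _ => ?_
    rw [Finset.sum_mul]
    refine Finset.sum_congr rfl fun j _ => ?_
    rw [h3 _ (hα' i), h3 _ (hβ' j), ← Real.mul_rpow (hα' i) (hβ' j), mul_right_comm,
      ← Real.mul_rpow (mul_nonneg (hα' i) (hβ' j)) (mul_nonneg ha.le hb.le)]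
    congr 2
    field_simp

lemma sum_rpow_gap_zero {α β : ℕ → ℝ} (hα : ∀ i, 0 ≤ α i) (hβ : ∀ i, 0 ≤ β i) (s : Finset ℕ)
    (x : ℝ) (h : ∑ i ∈ s, α i = 0 ∨ ∑ i ∈ s, β i = 0) :
    ∑ i ∈ s, ∑ j ∈ s, (α i * β j) ^ (3 / 4 : ℝ) * x ^ gap i j = 0 := by
  refine Finset.sum_eq_zero fun i hi => Finset.sum_eq_zero fun j hj => ?_
  have : α i * β j = 0 := by
    rcases h with h | h
    · rw [(Finset.sum_eq_zero_iff_of_nonneg fun i _ => hα i).1 h i hi, zero_mul]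
    · rw [(Finset.sum_eq_zero_iff_of_nonneg fun i _ => hβ i).1 h j hj, mul_zero]
  rw [this, Real.zero_rpow (by norm_num), zero_mul]

/-- The local inequality: unless both weights concentrate at a common point, splitting them
does not increase the `3/4`-power energy. -/
lemma local_gap_le {x : ℝ} (hx0 : 0 ≤ x) (hx1 : x ≤ 1 / 2 ^ 20) (s : Finset ℕ)
    {α β : ℕ → ℝ} (hα : ∀ i, 0 ≤ α i) (hβ : ∀ i, 0 ≤ β i)
    (hnot : ¬ ∃ i, (1 - x ^ 3) * ∑ k ∈ s, α k ≤ α i ∧ (1 - x ^ 3) * ∑ k ∈ s, β k ≤ β i) :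
    ∑ i ∈ s, ∑ j ∈ s, (α i * β j) ^ (3 / 4 : ℝ) * x ^ gap i j
      ≤ ((∑ i ∈ s, α i) * ∑ i ∈ s, β i) ^ (3 / 4 : ℝ) := by
  have ha0 := Finset.sum_nonneg fun i (_ : i ∈ s) => hα i
  have hb0 := Finset.sum_nonneg fun i (_ : i ∈ s) => hβ i
  by_cases h : ∑ i ∈ s, α i = 0 ∨ ∑ i ∈ s, β i = 0
  · rw [sum_rpow_gap_zero hα hβ s x h]
    positivity
  push Not at h
  have ha := lt_of_le_of_ne ha0 h.1.symm
  have hb := lt_of_le_of_ne hb0 h.2.symm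
  obtain ⟨c, d, hc, hd, hcs, hds, hc4, hd4, heq⟩ := sum_rpow_gap_eq hα hβ s x ha hb
  rw [heq]
  refine mul_le_of_le_one_left (by positivity) (local_gap_fourth hx0 hx1 s hc hd hcs hds ?_)
  rintro ⟨i, _, h1, h2⟩
  rw [hc4, le_div_iff₀ ha] at h1
  rw [hd4, le_div_iff₀ hb] at h2
  exact hnot ⟨i, h1, h2⟩

lemma local_gap_le_any {x : ℝ} (hx0 : 0 ≤ x) (hx1 : x ≤ 7 / 8) (s : Finset ℕ)
    {α β : ℕ → ℝ} (hα : ∀ i, 0 ≤ α i) (hβ : ∀ i, 0 ≤ β i) :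
    ∑ i ∈ s, ∑ j ∈ s, (α i * β j) ^ (3 / 4 : ℝ) * x ^ gap i j
      ≤ 16 * ((∑ i ∈ s, α i) * ∑ i ∈ s, β i) ^ (3 / 4 : ℝ) := by
  have ha0 := Finset.sum_nonneg fun i (_ : i ∈ s) => hα i
  have hb0 := Finset.sum_nonneg fun i (_ : i ∈ s) => hβ i
  by_cases h : ∑ i ∈ s, α i = 0 ∨ ∑ i ∈ s, β i = 0
  · rw [sum_rpow_gap_zero hα hβ s x h]
    positivity
  push Not at h
  have ha := lt_of_le_of_ne ha0 h.1.symm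
  have hb := lt_of_le_of_ne hb0 h.2.symm
  obtain ⟨c, d, hc, hd, hcs, hds, _, _, heq⟩ := sum_rpow_gap_eq hα hβ s x ha hb
  rw [heq]
  gcongr
  exact local_gap_any hx0 hx1 s hc hd hcs hds

/-- Total weight of a finite set. -/
noncomputable def mass (lam : ℕ → ℝ) (V : Finset ℕ) : ℝ := ∑ q ∈ V, lam q

open Classical in
/-- Total weight of the edges of `E` in `V × W`. -/
noncomputable def edgeMass (lam : ℕ → ℝ) (E : ℕ → ℕ → Prop) (V W : Finset ℕ) : ℝ :=
  ∑ q ∈ V, ∑ r ∈ W, if E q r then lam q * lam r else 0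

lemma mass_nonneg {lam : ℕ → ℝ} (hlam : ∀ q, 0 ≤ lam q) (V : Finset ℕ) : 0 ≤ mass lam V :=
  Finset.sum_nonneg fun q _ => hlam q

lemma mass_mono {lam : ℕ → ℝ} (hlam : ∀ q, 0 ≤ lam q) {V W : Finset ℕ} (h : V ⊆ W) :
    mass lam V ≤ mass lam W :=
  Finset.sum_le_sum_of_subset_of_nonneg h fun q _ _ => hlam q

lemma mass_fiberwise (lam : ℕ → ℝ) (v : ℕ → ℕ) {V t : Finset ℕ} (h : ∀ q ∈ V, v q ∈ t) :
    ∑ k ∈ t, mass lam (V.filter fun q => v q = k) = mass lam V :=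
  Finset.sum_fiberwise_of_maps_to h lam

lemma edgeMass_fiberwise (lam : ℕ → ℝ) (E : ℕ → ℕ → Prop) (v : ℕ → ℕ) {V W t : Finset ℕ}
    (hV : ∀ q ∈ V, v q ∈ t) (hW : ∀ q ∈ W, v q ∈ t) :
    ∑ k ∈ t, ∑ l ∈ t, edgeMass lam E (V.filter fun q => v q = k) (W.filter fun q => v q = l)
      = edgeMass lam E V W := by
  unfold edgeMass
  rw [← Finset.sum_fiberwise_of_maps_to hV]
  refine Finset.sum_congr rfl fun k _ => ?_
  rw [Finset.sum_comm]
  refine Finset.sum_congr rfl fun q _ => ?_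
  rw [← Finset.sum_fiberwise_of_maps_to hW]

open Classical in
/-- Decomposition along the primes of `T`: split at every prime where the two sides do not
concentrate on a common exponent, until only concentrated primes are left. -/
lemma edgeMass_le_of_leaf {lam : ℕ → ℝ} (hlam : ∀ q, 0 ≤ lam q) (T S : Finset ℕ)
    (v : ℕ → ℕ → ℕ) (E : ℕ → ℕ → Prop) {x : ℕ → ℝ} (hx0 : ∀ p, 0 ≤ x p)
    (hx1 : ∀ p ∈ T, x p ≤ 7 / 8) (small : ℕ → Prop)
    (hsmall : ∀ p ∈ T, ¬ small p → x p ≤ 1 / 2 ^ 20) {ε K : ℝ} (hK : 0 ≤ K)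
    (leaf : ∀ U ⊆ T, ∀ V ⊆ S, ∀ W ⊆ S, ∀ i j : ℕ → ℕ,
      (∀ p ∈ T \ U, ∀ q ∈ V, v p q = i p) → (∀ p ∈ T \ U, ∀ q ∈ W, v p q = j p) →
      (∀ p ∈ U, ¬ small p ∧ ∃ n,
        (1 - x p ^ 3) * mass lam V ≤ mass lam (V.filter fun q => v p q = n) ∧
        (1 - x p ^ 3) * mass lam W ≤ mass lam (W.filter fun q => v p q = n)) →
      edgeMass lam E V W ≤ ε * (mass lam V * mass lam W)
        + K * (mass lam V * mass lam W) ^ (3 / 4 : ℝ) * ∏ p ∈ T \ U, x p ^ gap (i p) (j p)) :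
    ∀ U ⊆ T, ∀ V ⊆ S, ∀ W ⊆ S, ∀ i j : ℕ → ℕ,
      (∀ p ∈ T \ U, ∀ q ∈ V, v p q = i p) → (∀ p ∈ T \ U, ∀ q ∈ W, v p q = j p) →
      edgeMass lam E V W ≤ ε * (mass lam V * mass lam W)
        + K * 16 ^ (U.filter small).card * (mass lam V * mass lam W) ^ (3 / 4 : ℝ)
          * ∏ p ∈ T \ U, x p ^ gap (i p) (j p) := by
  intro U
  induction U using Finset.strongInduction with
  | H U ih =>
  intro hU V hV W hW i j hi hj
  have hm0 : 0 ≤ mass lam V * mass lam W := mul_nonneg (mass_nonneg hlam V) (mass_nonneg hlam W)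
  have hprod : 0 ≤ ∏ p ∈ T \ U, x p ^ gap (i p) (j p) :=
    Finset.prod_nonneg fun p _ => pow_nonneg (hx0 p) _
  by_cases hleaf : ∀ p ∈ U, ¬ small p ∧ ∃ n,
        (1 - x p ^ 3) * mass lam V ≤ mass lam (V.filter fun q => v p q = n) ∧
        (1 - x p ^ 3) * mass lam W ≤ mass lam (W.filter fun q => v p q = n)
  · refine (leaf U hU V hV W hW i j hi hj hleaf).trans ?_
    gcongr
    exact le_mul_of_one_le_right hK (one_le_pow₀ (by norm_num))
  push Not at hleaf
  obtain ⟨p, hpU, hp⟩ := hleaf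
  have hpT := hU hpU
  set t : Finset ℕ := S.image (v p)
  have hVt : ∀ q ∈ V, v p q ∈ t := fun q hq => Finset.mem_image_of_mem _ (hV hq)
  have hWt : ∀ q ∈ W, v p q ∈ t := fun q hq => Finset.mem_image_of_mem _ (hW hq)
  set α : ℕ → ℝ := fun k => mass lam (V.filter fun q => v p q = k) with hα
  set β : ℕ → ℝ := fun k => mass lam (W.filter fun q => v p q = k) with hβ
  have hαs : ∑ k ∈ t, α k = mass lam V := mass_fiberwise lam (v p) hVt
  have hβs : ∑ k ∈ t, β k = mass lam W := mass_fiberwise lam (v p) hWt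
  have hα0 : ∀ k, 0 ≤ α k := fun k => mass_nonneg hlam _
  have hβ0 : ∀ k, 0 ≤ β k := fun k => mass_nonneg hlam _
  have hlocal : 16 ^ ((U.erase p).filter small).card *
      ∑ k ∈ t, ∑ l ∈ t, (α k * β l) ^ (3 / 4 : ℝ) * x p ^ gap k l
      ≤ 16 ^ (U.filter small).card * (mass lam V * mass lam W) ^ (3 / 4 : ℝ) := by
    by_cases hs : small p
    · have hc : (U.filter small).card = ((U.erase p).filter small).card + 1 := by
        rw [Finset.filter_erase, Finset.card_erase_add_one]
        exact Finset.mem_filter.2 ⟨hpU, hs⟩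
      have := local_gap_le_any (hx0 p) (hx1 p hpT) t hα0 hβ0
      rw [hαs, hβs] at this
      rw [hc, pow_succ, mul_assoc]
      gcongr
    · have hc : (U.filter small).card = ((U.erase p).filter small).card := by
        rw [Finset.filter_erase, Finset.erase_eq_of_notMem]
        simp [hs]
      have := local_gap_le (hx0 p) (hsmall p hpT hs) t hα0 hβ0 (by
        rw [hαs, hβs]
        rintro ⟨n, h1, h2⟩
        exact absurd h2 (not_le.2 (hp hs n h1)))
      rw [hαs, hβs] at this
      rw [hc]
      gcongr
  have hTU : T \ U.erase p = insert p (T \ U) := by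
    ext z; simp only [Finset.mem_sdiff, Finset.mem_erase, Finset.mem_insert]
    by_cases hz : z = p
    · subst hz; simp [hpT]
    · simp [hz]
  have hpn : p ∉ T \ U := by simp [hpU]
  rw [← edgeMass_fiberwise lam E (v p) hVt hWt]
  calc _ ≤ ∑ k ∈ t, ∑ l ∈ t, (ε * (α k * β l)
        + K * 16 ^ ((U.erase p).filter small).card * (α k * β l) ^ (3 / 4 : ℝ)
          * (x p ^ gap k l * ∏ p ∈ T \ U, x p ^ gap (i p) (j p))) := by
        gcongr with k _ l _
        have h := ih (U.erase p) (Finset.erase_ssubset hpU) ((Finset.erase_subset _ _).trans hU)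
          (V.filter fun q => v p q = k) ((Finset.filter_subset _ _).trans hV)
          (W.filter fun q => v p q = l) ((Finset.filter_subset _ _).trans hW)
          (Function.update i p k) (Function.update j p l) ?_ ?_
        · rw [hTU, Finset.prod_insert hpn] at h
          have hcong : ∏ z ∈ T \ U, x z ^ gap (Function.update i p k z) (Function.update j p l z)
              = ∏ z ∈ T \ U, x z ^ gap (i z) (j z) := by
            refine Finset.prod_congr rfl fun z hz => ?_
            have : z ≠ p := fun h => hpn (h ▸ hz)
            simp [Function.update_of_ne this]
          rw [hcong] at h
          simpa using h
        · intro z hz q hq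
          rw [hTU, Finset.mem_insert] at hz
          rw [Finset.mem_filter] at hq
          by_cases hzp : z = p
          · subst hzp; simpa using hq.2
          · rw [Function.update_of_ne hzp]
            exact hi z (hz.resolve_left hzp) q hq.1
        · intro z hz q hq
          rw [hTU, Finset.mem_insert] at hz
          rw [Finset.mem_filter] at hq
          by_cases hzp : z = p
          · subst hzp; simpa using hq.2
          · rw [Function.update_of_ne hzp]
            exact hj z (hz.resolve_left hzp) q hq.1
    _ = ε * ((∑ k ∈ t, α k) * ∑ l ∈ t, β l) + K * (16 ^ ((U.erase p).filter small).card *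
          ∑ k ∈ t, ∑ l ∈ t, (α k * β l) ^ (3 / 4 : ℝ) * x p ^ gap k l)
          * ∏ p ∈ T \ U, x p ^ gap (i p) (j p) := by
        simp only [Finset.sum_add_distrib]
        rw [Finset.sum_mul_sum]
        simp only [Finset.mul_sum, Finset.sum_mul]
        congr 1
        refine Finset.sum_congr rfl fun k _ => Finset.sum_congr rfl fun l _ => ?_
        ring
    _ ≤ ε * (mass lam V * mass lam W) + K * (16 ^ (U.filter small).card *
          (mass lam V * mass lam W) ^ (3 / 4 : ℝ)) * ∏ p ∈ T \ U, x p ^ gap (i p) (j p) := by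
        rw [hαs, hβs]
        gcongr
    _ = _ := by ring

/-- The density `φ(n) / n` of the integers coprime to `n`. -/
noncomputable def phiDensity (n : ℕ) : ℝ := (n.totient : ℝ) / n

lemma phiDensity_nonneg (n : ℕ) : 0 ≤ phiDensity n := by unfold phiDensity; positivity

lemma phiDensity_le_one (n : ℕ) : phiDensity n ≤ 1 := by
  unfold phiDensity
  exact div_le_one_of_le₀ (by exact_mod_cast Nat.totient_le n) (by positivity)

lemma phiDensity_eq_prod {n : ℕ} (hn : n ≠ 0) :
    phiDensity n = ∏ p ∈ n.primeFactors, (1 - (p : ℝ)⁻¹) := by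
  have h := Nat.totient_eq_mul_prod_factors n
  have h' : (n.totient : ℝ) = n * ∏ p ∈ n.primeFactors, (1 - (p : ℝ)⁻¹) := by
    have h2 := congrArg (fun z : ℚ => (z : ℝ)) h
    push_cast at h2
    exact h2
  rw [phiDensity, h']
  field_simp

lemma one_sub_inv_prime_nonneg {p : ℕ} (hp : 1 ≤ p) : 0 ≤ 1 - (p : ℝ)⁻¹ := by
  have : (p : ℝ)⁻¹ ≤ 1 := inv_le_one_of_one_le₀ (by exact_mod_cast hp)
  linarith

lemma phiDensity_anti {d n : ℕ} (hn : n ≠ 0) (h : d ∣ n) : phiDensity n ≤ phiDensity d := by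
  have hd : d ≠ 0 := fun h0 => hn (by rw [h0] at h; exact zero_dvd_iff.1 h)
  rw [phiDensity_eq_prod hn, phiDensity_eq_prod hd]
  rw [← Finset.prod_sdiff (Nat.primeFactors_mono h hn)]
  refine mul_le_of_le_one_left (Finset.prod_nonneg fun p hp =>
    one_sub_inv_prime_nonneg (Nat.prime_of_mem_primeFactors hp).one_lt.le) ?_
  refine Finset.prod_le_one (fun p hp => one_sub_inv_prime_nonneg
    (Nat.prime_of_mem_primeFactors (Finset.mem_sdiff.1 hp).1).one_lt.le) fun p _ => ?_
  have : (0 : ℝ) ≤ (p : ℝ)⁻¹ := by positivity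
  linarith

/-- Counting integers `q = a d x` with `d ∣ N` and `x ≤ X`, weighted by `ψ(q) φ(q) / q`. -/
lemma sum_mul_phiDensity_le {ψ : ℕ → ℝ} {Q : Finset ℕ} {a N X : ℕ} {Y : ℝ}
    {d x : ℕ → ℕ} (hN : N ≠ 0) (hY : 0 ≤ Y) (hq0 : ∀ q ∈ Q, q ≠ 0)
    (hq : ∀ q ∈ Q, q = a * d q * x q) (hd : ∀ q ∈ Q, d q ∣ N) (hx : ∀ q ∈ Q, x q ≤ X)
    (hψ : ∀ q ∈ Q, ψ q * N ≤ Y * d q) :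
    ∑ q ∈ Q, ψ q * phiDensity q ≤ X * Y := by
  have hNpos : (0 : ℝ) < N := by exact_mod_cast Nat.pos_of_ne_zero hN
  have hx1 : ∀ q ∈ Q, 1 ≤ x q := fun q hqQ => Nat.one_le_iff_ne_zero.2 fun h0 => hq0 q hqQ (by
    rw [hq q hqQ, h0, mul_zero])
  have h1 : ∀ q ∈ Q, ψ q * phiDensity q ≤ Y / N * (d q).totient := by
    intro q hqQ
    have hdq : d q ∣ q := ⟨a * x q, by conv_lhs => rw [hq q hqQ]
                                       ring⟩
    have hd0 : d q ≠ 0 := fun h0 => hN (by have := hd q hqQ; rwa [h0, zero_dvd_iff] at this)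
    have hdpos : (0 : ℝ) < d q := by exact_mod_cast Nat.pos_of_ne_zero hd0
    calc ψ q * phiDensity q ≤ Y * d q / N * phiDensity q := by
          gcongr
          · exact phiDensity_nonneg q
          · rw [le_div_iff₀ hNpos]; exact hψ q hqQ
      _ ≤ Y * d q / N * phiDensity (d q) := by
          gcongr
          exact phiDensity_anti (hq0 q hqQ) hdq
      _ = Y / N * (d q).totient := by unfold phiDensity; field_simp
  calc ∑ q ∈ Q, ψ q * phiDensity q ≤ ∑ q ∈ Q, Y / N * (d q).totient := Finset.sum_le_sum h1
    _ = Y / N * ∑ q ∈ Q, ((d q).totient : ℝ) := by rw [Finset.mul_sum]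
    _ ≤ Y / N * (N * X : ℕ) := by
        gcongr
        have h2 : ∑ q ∈ Q, (d q).totient ≤ ∑ z ∈ N.divisors ×ˢ Finset.Icc 1 X, z.1.totient := by
          rw [← Finset.sum_image (s := Q) (g := fun q => (d q, x q))
            (f := fun z : ℕ × ℕ => z.1.totient)]
          · refine Finset.sum_le_sum_of_subset fun z hz => ?_
            obtain ⟨q, hqQ, rfl⟩ := Finset.mem_image.1 hz
            simp only [Finset.mem_product, Nat.mem_divisors, Finset.mem_Icc]
            exact ⟨⟨hd q hqQ, hN⟩, hx1 q hqQ, hx q hqQ⟩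
          · intro q hqQ r hrQ h
            simp only [Prod.mk.injEq] at h
            rw [hq q hqQ, hq r hrQ, h.1, h.2]
        rw [Finset.sum_product] at h2
        simp only [Finset.sum_const, Nat.card_Icc, Nat.add_sub_cancel, smul_eq_mul] at h2
        rw [← Finset.mul_sum, Nat.sum_totient, mul_comm] at h2
        exact_mod_cast h2
    _ = X * Y := by push_cast; field_simp

/-- The elements whose initial segment (in the order given by `x`) is light are light. -/
lemma sum_light_initial_le {lam : ℕ → ℝ} (hlam : ∀ q, 0 ≤ lam q) (x : ℕ → ℕ) (V : Finset ℕ)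
    {c : ℝ} (hc : 0 ≤ c) :
    mass lam (V.filter fun q => mass lam (V.filter fun q' => x q' ≤ x q) < c) ≤ c := by
  set L := V.filter fun q => mass lam (V.filter fun q' => x q' ≤ x q) < c with hL
  rcases L.eq_empty_or_nonempty with h | h
  · rw [h]; simpa [mass] using hc
  · obtain ⟨q, hq, hmax⟩ := L.exists_max_image x h
    refine (mass_mono hlam ?_).trans (Finset.mem_filter.1 hq).2.le
    intro r hr
    exact Finset.mem_filter.2 ⟨(Finset.mem_filter.1 hr).1, hmax r hr⟩

lemma edgeMass_le_mul {lam : ℕ → ℝ} (hlam : ∀ q, 0 ≤ lam q) {E : ℕ → ℕ → Prop}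
    {V W : Finset ℕ} {c : ℝ} (hc : ∀ r ∈ W, ∀ Q ⊆ V, (∀ q ∈ Q, E q r) → mass lam Q ≤ c) :
    edgeMass lam E V W ≤ c * mass lam W := by
  classical
  unfold edgeMass
  rw [Finset.sum_comm, mass, Finset.mul_sum]
  refine Finset.sum_le_sum fun r hr => ?_
  have h := hc r hr (V.filter fun q => E q r) (Finset.filter_subset _ _)
    fun q hq => (Finset.mem_filter.1 hq).2
  rw [← Finset.sum_filter, ← Finset.sum_mul]
  have := hlam r
  gcongr
  exact h

lemma edgeMass_swap (lam : ℕ → ℝ) (E : ℕ → ℕ → Prop) (V W : Finset ℕ) :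
    edgeMass lam E V W = edgeMass lam (fun r q => E q r) W V := by
  unfold edgeMass
  rw [Finset.sum_comm]
  simp only [mul_comm]

lemma edgeMass_le_add {lam : ℕ → ℝ} (hlam : ∀ q, 0 ≤ lam q) {E E₁ E₂ : ℕ → ℕ → Prop}
    {V W : Finset ℕ} (h : ∀ q ∈ V, ∀ r ∈ W, E q r → E₁ q r ∨ E₂ q r) :
    edgeMass lam E V W ≤ edgeMass lam E₁ V W + edgeMass lam E₂ V W := by
  unfold edgeMass
  simp only [← Finset.sum_add_distrib]
  refine Finset.sum_le_sum fun q hq => Finset.sum_le_sum fun r hr => ?_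
  have hqr : 0 ≤ lam q * lam r := mul_nonneg (hlam q) (hlam r)
  have := h q hq r hr
  split_ifs <;> simp_all

/-- A dense bipartite graph contains an edge both of whose endpoints have high rank among the
neighbours of the other endpoint. -/
lemma exists_high_rank_edge {lam : ℕ → ℝ} (hlam : ∀ q, 0 ≤ lam q) (x : ℕ → ℕ)
    {E : ℕ → ℕ → Prop} {V W : Finset ℕ} {ε : ℝ} (hε : 0 < ε)
    (hpos : 0 < mass lam V * mass lam W)
    (hE : ε * (mass lam V * mass lam W) ≤ edgeMass lam E V W) :
    ∃ q ∈ V, ∃ r ∈ W, E q r ∧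
      (∃ Q ⊆ V, (∀ q' ∈ Q, E q' r ∧ x q' ≤ x q) ∧ ε / 4 * mass lam V ≤ mass lam Q) ∧
      (∃ R ⊆ W, (∀ r' ∈ R, E q r' ∧ x r' ≤ x r) ∧ ε / 4 * mass lam W ≤ mass lam R) := by
  classical
  by_contra hcon
  have hV := mass_nonneg hlam V
  have hW := mass_nonneg hlam W
  set E₁ : ℕ → ℕ → Prop := fun q r => E q r ∧
    mass lam ((V.filter fun q => E q r).filter fun q' => x q' ≤ x q) < ε / 4 * mass lam V with hE₁
  set E₂ : ℕ → ℕ → Prop := fun q r => E q r ∧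
    mass lam ((W.filter fun r => E q r).filter fun r' => x r' ≤ x r) < ε / 4 * mass lam W with hE₂
  have hsub : ∀ q ∈ V, ∀ r ∈ W, E q r → E₁ q r ∨ E₂ q r := by
    intro q hq r hr h
    by_contra hno
    rw [not_or] at hno
    have h1 := not_lt.1 fun hlt => hno.1 ⟨h, hlt⟩
    have h2 := not_lt.1 fun hlt => hno.2 ⟨h, hlt⟩
    refine hcon ⟨q, hq, r, hr, h, ⟨_, ?_, ?_, h1⟩, ⟨_, ?_, ?_, h2⟩⟩
    · exact (Finset.filter_subset _ _).trans (Finset.filter_subset _ _)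
    · intro q' hq'
      simp only [Finset.mem_filter] at hq'
      exact ⟨hq'.1.2, hq'.2⟩
    · exact (Finset.filter_subset _ _).trans (Finset.filter_subset _ _)
    · intro r' hr'
      simp only [Finset.mem_filter] at hr'
      exact ⟨hr'.1.2, hr'.2⟩
  have h1 : edgeMass lam E₁ V W ≤ ε / 4 * mass lam V * mass lam W := by
    refine edgeMass_le_mul hlam fun r _ Q hQ h => ?_
    refine (mass_mono hlam ?_).trans
      (sum_light_initial_le hlam x (V.filter fun q => E q r) (by positivity))
    intro q hq
    simp only [Finset.mem_filter]
    exact ⟨⟨hQ hq, (h q hq).1⟩, (h q hq).2⟩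
  have h2 : edgeMass lam E₂ V W ≤ ε / 4 * mass lam W * mass lam V := by
    rw [edgeMass_swap]
    refine edgeMass_le_mul hlam fun r _ Q hQ h => ?_
    refine (mass_mono hlam ?_).trans
      (sum_light_initial_le hlam x (W.filter fun q => E r q) (by positivity))
    intro q hq
    simp only [Finset.mem_filter]
    exact ⟨⟨hQ hq, (h q hq).1⟩, (h q hq).2⟩
  have h3 := edgeMass_le_add hlam hsub
  have : ε * (mass lam V * mass lam W) ≤ ε / 2 * (mass lam V * mass lam W) := by linarith
  nlinarith [mul_pos hε hpos]

/-- The extremal bound at a leaf of the decomposition. -/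
lemma mass_mul_mass_le_of_dense {ψ : ℕ → ℝ} (hψ : ∀ q, 0 ≤ ψ q) {V W : Finset ℕ}
    {E : ℕ → ℕ → Prop} {a b N : ℕ} {A B M ε : ℝ} {d x : ℕ → ℕ} (hN : N ≠ 0) (hA : 0 < A)
    (hB : 0 < B) (hM : 0 ≤ M) (hε : 0 < ε)
    (hV0 : ∀ q ∈ V, q ≠ 0) (hW0 : ∀ q ∈ W, q ≠ 0)
    (hV : ∀ q ∈ V, q = a * d q * x q ∧ d q ∣ N) (hW : ∀ q ∈ W, q = b * d q * x q ∧ d q ∣ N)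
    (hEV : ∀ q ∈ V, ∀ r ∈ W, E q r → ψ q * A * x r * N ≤ M * d q)
    (hEW : ∀ q ∈ V, ∀ r ∈ W, E q r → ψ r * B * x q * N ≤ M * d r)
    (hE : ε * (mass (fun q => ψ q * phiDensity q) V * mass (fun q => ψ q * phiDensity q) W)
      ≤ edgeMass (fun q => ψ q * phiDensity q) E V W) :
    mass (fun q => ψ q * phiDensity q) V * mass (fun q => ψ q * phiDensity q) W
      ≤ 16 * M ^ 2 / (ε ^ 2 * (A * B)) := by
  set lam : ℕ → ℝ := fun q => ψ q * phiDensity q with hlamdef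
  have hlam : ∀ q, 0 ≤ lam q := fun q => mul_nonneg (hψ q) (phiDensity_nonneg q)
  rcases (mul_nonneg (mass_nonneg hlam V) (mass_nonneg hlam W)).eq_or_lt with h0 | hpos
  · rw [← h0]; positivity
  obtain ⟨q, hq, r, hr, hqr, ⟨Q, hQV, hQ, hQm⟩, ⟨R, hRW, hR, hRm⟩⟩ :=
    exists_high_rank_edge hlam x hε hpos hE
  have hxq : (0 : ℝ) < x q := by
    have : x q ≠ 0 := fun h => hV0 q hq (by rw [(hV q hq).1, h, mul_zero])
    exact_mod_cast Nat.pos_of_ne_zero this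
  have hxr : (0 : ℝ) < x r := by
    have : x r ≠ 0 := fun h => hW0 r hr (by rw [(hW r hr).1, h, mul_zero])
    exact_mod_cast Nat.pos_of_ne_zero this
  have h1 : mass lam Q ≤ x q * (M / (A * x r)) := by
    refine sum_mul_phiDensity_le (a := a) (d := d) (x := x) hN (by positivity)
      (fun q' h => hV0 q' (hQV h)) (fun q' h => (hV q' (hQV h)).1)
      (fun q' h => (hV q' (hQV h)).2) (fun q' h => (hQ q' h).2) fun q' h => ?_
    have := hEV q' (hQV h) r hr (hQ q' h).1
    rw [div_mul_eq_mul_div, le_div_iff₀ (by positivity)]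
    linarith
  have h2 : mass lam R ≤ x r * (M / (B * x q)) := by
    refine sum_mul_phiDensity_le (a := b) (d := d) (x := x) hN (by positivity)
      (fun q' h => hW0 q' (hRW h)) (fun q' h => (hW q' (hRW h)).1)
      (fun q' h => (hW q' (hRW h)).2) (fun q' h => (hR q' h).2) fun q' h => ?_
    have := hEW q hq q' (hRW h) (hR q' h).1
    rw [div_mul_eq_mul_div, le_div_iff₀ (by positivity)]
    linarith
  have hmV := mass_nonneg hlam V
  have hmW := mass_nonneg hlam W
  have h3 : (ε / 4 * mass lam V) * (ε / 4 * mass lam W)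
      ≤ (x q * (M / (A * x r))) * (x r * (M / (B * x q))) := by
    apply mul_le_mul (hQm.trans h1) (hRm.trans h2) (by positivity) (by positivity)
  have h4 : (x q * (M / (A * x r))) * (x r * (M / (B * x q))) = M ^ 2 / (A * B) := by
    field_simp
  rw [h4, le_div_iff₀ (by positivity)] at h3
  rw [le_div_iff₀ (by positivity)]
  linarith

open Classical in
lemma edgeMass_le_sum_mul {lam : ℕ → ℝ} (hlam : ∀ q, 0 ≤ lam q) {E : ℕ → ℕ → Prop}
    {F : ℕ → ℕ → ℕ → Prop} {U V W : Finset ℕ} {w : ℕ → ℝ}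
    (h : ∀ q ∈ V, ∀ r ∈ W, E q r → ∃ Q ⊆ U, (∀ p ∈ Q, F p q r) ∧ 1 ≤ ∑ p ∈ Q, w p)
    (hw : ∀ p ∈ U, 0 ≤ w p) :
    edgeMass lam E V W ≤ ∑ p ∈ U, w p * edgeMass lam (F p) V W := by
  unfold edgeMass
  have hswap : ∑ p ∈ U, w p * ∑ q ∈ V, ∑ r ∈ W, (if F p q r then lam q * lam r else 0)
      = ∑ q ∈ V, ∑ r ∈ W, ∑ p ∈ U, w p * (if F p q r then lam q * lam r else 0) := by
    simp only [Finset.mul_sum]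
    rw [Finset.sum_comm]
    exact Finset.sum_congr rfl fun q _ => Finset.sum_comm
  rw [hswap]
  refine Finset.sum_le_sum fun q hq => Finset.sum_le_sum fun r hr => ?_
  have hqr : 0 ≤ lam q * lam r := mul_nonneg (hlam q) (hlam r)
  have e : ∑ p ∈ U, w p * (if F p q r then lam q * lam r else 0)
      = (∑ p ∈ U.filter (fun p => F p q r), w p) * (lam q * lam r) := by
    rw [Finset.sum_filter, Finset.sum_mul]
    refine Finset.sum_congr rfl fun p _ => ?_
    split_ifs <;> simp
  rw [e]
  split_ifs with hE
  · obtain ⟨Q, hQU, hQ, h1⟩ := h q hq r hr hE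
    refine le_mul_of_one_le_left hqr (h1.trans ?_)
    refine Finset.sum_le_sum_of_subset_of_nonneg (fun p hp => ?_) fun p hp _ =>
      hw p (Finset.mem_filter.1 hp).1
    exact Finset.mem_filter.2 ⟨hQU hp, hQ p hp⟩
  · exact mul_nonneg (Finset.sum_nonneg fun p hp => hw p (Finset.mem_filter.1 hp).1) hqr

lemma edgeMass_mono {lam : ℕ → ℝ} (hlam : ∀ q, 0 ≤ lam q) {E F : ℕ → ℕ → Prop}
    {V W : Finset ℕ} (h : ∀ q ∈ V, ∀ r ∈ W, E q r → F q r) :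
    edgeMass lam E V W ≤ edgeMass lam F V W := by
  unfold edgeMass
  refine Finset.sum_le_sum fun q hq => Finset.sum_le_sum fun r hr => ?_
  have hqr : 0 ≤ lam q * lam r := mul_nonneg (hlam q) (hlam r)
  have := h q hq r hr
  split_ifs <;> simp_all

lemma edgeMass_prod (lam : ℕ → ℝ) (A B : ℕ → Prop) [DecidablePred A] [DecidablePred B]
    (V W : Finset ℕ) :
    edgeMass lam (fun q r => A q ∧ B r) V W
      = mass lam (V.filter A) * mass lam (W.filter B) := by
  unfold edgeMass mass
  rw [Finset.sum_mul_sum, Finset.sum_filter]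
  refine Finset.sum_congr rfl fun q _ => ?_
  by_cases h : A q
  · simp only [h, true_and, if_true, Finset.sum_filter]
  · simp [h]

lemma mass_filter_ne_le {lam : ℕ → ℝ} {V : Finset ℕ} {v : ℕ → ℕ} {n : ℕ} {η : ℝ}
    (h : (1 - η) * mass lam V ≤ mass lam (V.filter fun q => v q = n)) :
    mass lam (V.filter fun q => v q ≠ n) ≤ η * mass lam V := by
  have := Finset.sum_filter_add_sum_filter_not V (fun q => v q = n) lam
  simp only [mass, ne_eq] at *
  linarith

/-- If both sides concentrate at the exponent `n` then few edges avoid it at both ends. -/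
lemma edgeMass_ne_and_ne_le {lam : ℕ → ℝ} (hlam : ∀ q, 0 ≤ lam q) {V W : Finset ℕ}
    {v : ℕ → ℕ} {n : ℕ} {η : ℝ} (hη : 0 ≤ η)
    (hV : (1 - η) * mass lam V ≤ mass lam (V.filter fun q => v q = n))
    (hW : (1 - η) * mass lam W ≤ mass lam (W.filter fun q => v q = n)) :
    edgeMass lam (fun q r => v q ≠ n ∧ v r ≠ n) V W ≤ η ^ 2 * (mass lam V * mass lam W) := by
  rw [edgeMass_prod]
  have h1 := mass_filter_ne_le hV
  have h2 := mass_filter_ne_le hW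
  calc _ ≤ (η * mass lam V) * (η * mass lam W) :=
        mul_le_mul h1 h2 (mass_nonneg hlam _) (mul_nonneg hη (mass_nonneg hlam _))
    _ = _ := by ring

lemma edgeMass_ne_le {lam : ℕ → ℝ} (hlam : ∀ q, 0 ≤ lam q) {V W : Finset ℕ}
    {v : ℕ → ℕ} {n : ℕ} {η : ℝ}
    (hV : (1 - η) * mass lam V ≤ mass lam (V.filter fun q => v q = n))
    (hW : (1 - η) * mass lam W ≤ mass lam (W.filter fun q => v q = n)) :
    edgeMass lam (fun q r => v q ≠ v r) V W ≤ 2 * η * (mass lam V * mass lam W) := by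
  have h := edgeMass_le_add hlam (E := fun q r => v q ≠ v r) (E₁ := fun q r => v q ≠ n ∧ True)
    (E₂ := fun q r => True ∧ v r ≠ n) (V := V) (W := W) (by
      intro q _ r _ hne
      by_contra hno
      simp only [ne_eq, and_true, true_and, not_or, not_not] at hno
      exact hne (hno.1.trans hno.2.symm))
  rw [edgeMass_prod, edgeMass_prod] at h
  simp only [Finset.filter_true] at h
  have h1 := mul_le_mul_of_nonneg_right (mass_filter_ne_le hV) (mass_nonneg hlam W)
  have h2 := mul_le_mul_of_nonneg_left (mass_filter_ne_le hW) (mass_nonneg hlam V)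
  linarith

/-- `r / gcd(q, r)` for integers with prime factors in `T`. -/
def coRatio (T : Finset ℕ) (q r : ℕ) : ℕ := ∏ p ∈ T, p ^ (r.factorization p - q.factorization p)

/-- Pairs with small numerators whose quotient has many medium sized prime factors. -/
def BadPair (T : Finset ℕ) (ψ : ℕ → ℝ) (M : ℝ) (y q r : ℕ) : Prop :=
  ψ q * coRatio T q r ≤ M ∧ ψ r * coRatio T r q ≤ M ∧
    1 ≤ ∑ p ∈ T.filter (fun p => y < p ∧ q.factorization p ≠ r.factorization p), (p : ℝ)⁻¹

/-- The decay factor attached to a prime. -/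
noncomputable def decay (p : ℕ) : ℝ := (p : ℝ) ^ (-(1 / 5) : ℝ)

lemma decay_nonneg (p : ℕ) : 0 ≤ decay p := by unfold decay; positivity

lemma decay_le_one {p : ℕ} (hp : 1 ≤ p) : decay p ≤ 1 :=
  Real.rpow_le_one_of_one_le_of_nonpos (by exact_mod_cast hp) (by norm_num)

lemma decay_pow_five (p : ℕ) : decay p ^ 5 = (p : ℝ)⁻¹ := by
  unfold decay
  rw [← Real.rpow_natCast, ← Real.rpow_mul (by positivity)]
  norm_num
  exact Real.rpow_neg_one _

section Leaf

variable {S T U : Finset ℕ} {n : ℕ → ℕ}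

lemma eq_prod_factorization {q : ℕ} (hq : q ≠ 0) (hqT : q.primeFactors ⊆ T) :
    q = ∏ p ∈ T, p ^ q.factorization p := by
  conv_lhs => rw [← Nat.prod_factorization_pow_eq_self hq]
  rw [Finsupp.prod_of_support_subset _ (by simpa using hqT)]
  intro p _; simp

lemma eq_split_prod {i : ℕ → ℕ} {q : ℕ} (hU : U ⊆ T) (hq : q ≠ 0) (hqT : q.primeFactors ⊆ T)
    (hi : ∀ p ∈ T \ U, q.factorization p = i p) :
    q = (∏ p ∈ T \ U, p ^ i p) * (∏ p ∈ U, p ^ min (n p) (q.factorization p))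
      * ∏ p ∈ U, p ^ (q.factorization p - n p) := by
  conv_lhs => rw [eq_prod_factorization hq hqT, ← Finset.prod_sdiff hU]
  rw [mul_assoc, ← Finset.prod_mul_distrib]
  congr 1
  · exact Finset.prod_congr rfl fun p hp => by rw [hi p hp]
  · refine Finset.prod_congr rfl fun p hp => ?_
    rw [← pow_add]; congr 1; omega

lemma nice_pair_le {i j : ℕ → ℕ} (hT : ∀ p ∈ T, p.Prime) (hU : U ⊆ T) {q r : ℕ} {ψ : ℕ → ℝ}
    (hψ : 0 ≤ ψ q) {M : ℝ} (hi : ∀ p ∈ T \ U, q.factorization p = i p)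
    (hj : ∀ p ∈ T \ U, r.factorization p = j p)
    (hnice : ∀ p ∈ U, q.factorization p = n p ∨ r.factorization p = n p)
    (hM : ψ q * coRatio T q r ≤ M) :
    ψ q * (∏ p ∈ T \ U, p ^ (j p - i p) : ℕ) * (∏ p ∈ U, p ^ (r.factorization p - n p) : ℕ)
      * (∏ p ∈ U, p ^ n p : ℕ) ≤ M * (∏ p ∈ U, p ^ min (n p) (q.factorization p) : ℕ) := by
  have h1 : coRatio T q r = (∏ p ∈ T \ U, p ^ (j p - i p)) *
      ∏ p ∈ U, p ^ (r.factorization p - q.factorization p) := by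
    unfold coRatio
    rw [← Finset.prod_sdiff hU]
    congr 1
    exact Finset.prod_congr rfl fun p hp => by rw [hi p hp, hj p hp]
  have h2 : (∏ p ∈ U, p ^ (r.factorization p - n p)) * ∏ p ∈ U, p ^ n p
      ≤ (∏ p ∈ U, p ^ (r.factorization p - q.factorization p))
        * ∏ p ∈ U, p ^ min (n p) (q.factorization p) := by
    rw [← Finset.prod_mul_distrib, ← Finset.prod_mul_distrib]
    refine Finset.prod_le_prod' fun p hp => ?_
    rw [← pow_add, ← pow_add]
    refine Nat.pow_le_pow_right (hT p (hU hp)).pos ?_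
    have := hnice p hp
    omega
  have h2' : ((∏ p ∈ U, p ^ (r.factorization p - n p) : ℕ) : ℝ) * (∏ p ∈ U, p ^ n p : ℕ)
      ≤ (∏ p ∈ U, p ^ (r.factorization p - q.factorization p) : ℕ)
        * (∏ p ∈ U, p ^ min (n p) (q.factorization p) : ℕ) := by exact_mod_cast h2
  calc _ = ψ q * (∏ p ∈ T \ U, p ^ (j p - i p) : ℕ) *
        (((∏ p ∈ U, p ^ (r.factorization p - n p) : ℕ) : ℝ) * (∏ p ∈ U, p ^ n p : ℕ)) := by ring
    _ ≤ ψ q * (∏ p ∈ T \ U, p ^ (j p - i p) : ℕ) *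
        ((∏ p ∈ U, p ^ (r.factorization p - q.factorization p) : ℕ)
          * (∏ p ∈ U, p ^ min (n p) (q.factorization p) : ℕ)) := by gcongr
    _ = ψ q * coRatio T q r * (∏ p ∈ U, p ^ min (n p) (q.factorization p) : ℕ) := by
        rw [h1]; push_cast; ring
    _ ≤ _ := by gcongr

/-- Energy gain at a leaf with many unequal split exponents. -/
lemma prod_gap_gain (hT : ∀ p ∈ T, p.Prime) {i j : ℕ → ℕ} {k : ℕ}
    (hk : k ≤ (T.filter fun p => i p ≠ j p).card) {P C : ℝ} (hP : 0 ≤ P) (hC : 0 ≤ C)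
    (h : P ≤ C / ((∏ p ∈ T, p ^ (j p - i p) : ℕ) * (∏ p ∈ T, p ^ (i p - j p) : ℕ))) :
    P ≤ C ^ (1 / 4 : ℝ) * (2 : ℝ) ^ (-(k / 20) : ℝ) * P ^ (3 / 4 : ℝ)
      * ∏ p ∈ T, decay p ^ gap (i p) (j p) := by
  have hprodpos : (0 : ℝ) < ∏ p ∈ T, (p : ℝ) ^ gap (i p) (j p) :=
    Finset.prod_pos fun p hp => pow_pos (by exact_mod_cast (hT p hp).pos) _
  have h1 : P ≤ C / ∏ p ∈ T, (p : ℝ) ^ gap (i p) (j p) := by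
    refine h.trans (le_of_eq ?_)
    congr 1
    push_cast
    rw [← Finset.prod_mul_distrib]
    refine Finset.prod_congr rfl fun p _ => ?_
    rw [← pow_add, gap, add_comm]
  have h2 : P = P ^ (1 / 4 : ℝ) * P ^ (3 / 4 : ℝ) := by
    rw [← Real.rpow_add' hP (by norm_num)]; norm_num
  have h3 : P ^ (1 / 4 : ℝ) ≤ C ^ (1 / 4 : ℝ) *
      ∏ p ∈ T, ((p : ℝ) ^ (-(1 / 4) : ℝ)) ^ gap (i p) (j p) := by
    calc P ^ (1 / 4 : ℝ) ≤ (C / ∏ p ∈ T, (p : ℝ) ^ gap (i p) (j p)) ^ (1 / 4 : ℝ) := by gcongr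
      _ = C ^ (1 / 4 : ℝ) / (∏ p ∈ T, (p : ℝ) ^ gap (i p) (j p)) ^ (1 / 4 : ℝ) :=
          Real.div_rpow hC hprodpos.le _
      _ = _ := by
          rw [div_eq_mul_inv, ← Real.rpow_neg hprodpos.le,
            ← Real.finsetProd_rpow _ _ fun p _ => by positivity]
          congr 1
          refine Finset.prod_congr rfl fun p _ => ?_
          rw [← Real.rpow_natCast, ← Real.rpow_natCast, ← Real.rpow_mul (by positivity),
            ← Real.rpow_mul (by positivity), mul_comm]
  have h4 : ∏ p ∈ T, ((p : ℝ) ^ (-(1 / 4) : ℝ)) ^ gap (i p) (j p)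
      ≤ (2 : ℝ) ^ (-(k / 20) : ℝ) * ∏ p ∈ T, decay p ^ gap (i p) (j p) := by
    have h5 : ∏ p ∈ T, ((p : ℝ) ^ (-(1 / 4) : ℝ)) ^ gap (i p) (j p)
        ≤ ∏ p ∈ T, ((if i p ≠ j p then (2 : ℝ) ^ (-(1 / 20) : ℝ) else 1)
          * decay p ^ gap (i p) (j p)) := by
      refine Finset.prod_le_prod (fun p _ => by positivity) fun p hp => ?_
      split_ifs with hij
      · have hp0 : (0 : ℝ) < p := by exact_mod_cast (hT p hp).pos
        have hp2 : (2 : ℝ) ≤ p := by exact_mod_cast (hT p hp).two_le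
        have e : (p : ℝ) ^ (-(1 / 4) : ℝ) = (p : ℝ) ^ (-(1 / 20) : ℝ) * decay p := by
          rw [decay, ← Real.rpow_add hp0]; norm_num
        rw [e, mul_pow]
        have hd := decay_nonneg p
        gcongr
        have hle : (p : ℝ) ^ (-(1 / 20) : ℝ) ≤ (2 : ℝ) ^ (-(1 / 20) : ℝ) :=
          Real.rpow_le_rpow_of_nonpos (by norm_num) hp2 (by norm_num)
        have hle1 : (p : ℝ) ^ (-(1 / 20) : ℝ) ≤ 1 :=
          Real.rpow_le_one_of_one_le_of_nonpos (by linarith) (by norm_num)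
        refine le_trans (pow_le_of_le_one (by positivity) hle1 ?_) hle
        have := one_le_gap hij
        omega
      · rw [not_not] at hij
        rw [hij, gap_self]; simp
    refine h5.trans ?_
    rw [Finset.prod_mul_distrib, ← Finset.prod_filter, Finset.prod_const]
    gcongr
    · exact Finset.prod_nonneg fun p _ => pow_nonneg (decay_nonneg p) _
    · rw [← Real.rpow_natCast, ← Real.rpow_mul (by norm_num)]
      apply Real.rpow_le_rpow_of_exponent_le (by norm_num)
      have : (k : ℝ) ≤ (T.filter fun p => i p ≠ j p).card := by exact_mod_cast hk
      linarith
  calc P = P ^ (1 / 4 : ℝ) * P ^ (3 / 4 : ℝ) := h2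
    _ ≤ (C ^ (1 / 4 : ℝ) * ((2 : ℝ) ^ (-(k / 20) : ℝ) * ∏ p ∈ T, decay p ^ gap (i p) (j p)))
        * P ^ (3 / 4 : ℝ) := by
        gcongr
        exact h3.trans (by gcongr)
    _ = _ := by ring

end Leaf

lemma edgeMass_leaf_le {S T U V W : Finset ℕ} (hT : ∀ p ∈ T, p.Prime)
    (hS : ∀ q ∈ S, q ≠ 0 ∧ q.primeFactors ⊆ T) {ψ : ℕ → ℝ} (hψ : ∀ q, 0 ≤ ψ q) {M δ : ℝ}
    (hM : 0 ≤ M) (hδ : 0 < δ) (y : ℕ) (hU : U ⊆ T) (hV : V ⊆ S) (hW : W ⊆ S) {i j : ℕ → ℕ}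
    (hi : ∀ p ∈ T \ U, ∀ q ∈ V, q.factorization p = i p)
    (hj : ∀ p ∈ T \ U, ∀ q ∈ W, q.factorization p = j p)
    (hsum : ∑ p ∈ U, decay p ^ 6 ≤ δ / 2)
    (hconc : ∀ p ∈ U, ∃ n,
      (1 - decay p ^ 3) * mass (fun q => ψ q * phiDensity q) V
        ≤ mass (fun q => ψ q * phiDensity q) (V.filter fun q => q.factorization p = n) ∧
      (1 - decay p ^ 3) * mass (fun q => ψ q * phiDensity q) W
        ≤ mass (fun q => ψ q * phiDensity q) (W.filter fun q => q.factorization p = n)) :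
    edgeMass (fun q => ψ q * phiDensity q) (BadPair T ψ M y) V W
      ≤ 2 * δ * (mass (fun q => ψ q * phiDensity q) V * mass (fun q => ψ q * phiDensity q) W)
        + (16 * M ^ 2 / (δ / 2) ^ 2) ^ (1 / 4 : ℝ) * (2 : ℝ) ^ (-((y / 2 : ℕ) / 20) : ℝ)
          * (mass (fun q => ψ q * phiDensity q) V
            * mass (fun q => ψ q * phiDensity q) W) ^ (3 / 4 : ℝ)
          * ∏ p ∈ T \ U, decay p ^ gap (i p) (j p) := by
  classical
  choose! n hn using hconc
  set lam : ℕ → ℝ := fun q => ψ q * phiDensity q with hlamdef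
  have hlam : ∀ q, 0 ≤ lam q := fun q => mul_nonneg (hψ q) (phiDensity_nonneg q)
  set P := mass lam V * mass lam W with hP
  have hP0 : 0 ≤ P := mul_nonneg (mass_nonneg hlam V) (mass_nonneg hlam W)
  have hsecond : 0 ≤ (16 * M ^ 2 / (δ / 2) ^ 2) ^ (1 / 4 : ℝ) *
      (2 : ℝ) ^ (-((y / 2 : ℕ) / 20) : ℝ) * P ^ (3 / 4 : ℝ)
      * ∏ p ∈ T \ U, decay p ^ gap (i p) (j p) :=
    mul_nonneg (by positivity) (Finset.prod_nonneg fun p _ => pow_nonneg (decay_nonneg p) _)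
  have hp1 : ∀ p ∈ U, 1 ≤ p := fun p hp => (hT p (hU hp)).one_lt.le
  by_cases hlight : ∑ p ∈ (T \ U).filter (fun p => y < p ∧ i p ≠ j p), (p : ℝ)⁻¹ < 1 / 2
  · have h1 : edgeMass lam (BadPair T ψ M y) V W ≤ ∑ p ∈ U, 2 * (p : ℝ)⁻¹ *
        edgeMass lam (fun q r => q.factorization p ≠ r.factorization p) V W := by
      refine edgeMass_le_sum_mul hlam (w := fun p => 2 * (p : ℝ)⁻¹)
        (F := fun p q r => q.factorization p ≠ r.factorization p) ?_ fun p _ => by positivity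
      rintro q hq r hr ⟨_, _, hlarge⟩
      have hsplit : T.filter (fun p => y < p ∧ q.factorization p ≠ r.factorization p)
          ⊆ (T \ U).filter (fun p => y < p ∧ i p ≠ j p)
            ∪ U.filter (fun p => q.factorization p ≠ r.factorization p) := by
        intro p hp
        simp only [Finset.mem_filter, Finset.mem_union, Finset.mem_sdiff] at hp ⊢
        by_cases hpU : p ∈ U
        · exact Or.inr ⟨hpU, hp.2.2⟩
        · have hpTU := Finset.mem_sdiff.2 ⟨hp.1, hpU⟩
          exact Or.inl ⟨⟨hp.1, hpU⟩, hp.2.1, by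
            rw [← hi p hpTU q hq, ← hj p hpTU r hr]; exact hp.2.2⟩
      have h2 := Finset.sum_le_sum_of_subset_of_nonneg (f := fun p : ℕ => (p : ℝ)⁻¹) hsplit
        fun p _ _ => by positivity
      have h3 := Finset.sum_union_inter (f := fun p : ℕ => (p : ℝ)⁻¹)
        (s₁ := (T \ U).filter (fun p => y < p ∧ i p ≠ j p))
        (s₂ := U.filter (fun p => q.factorization p ≠ r.factorization p))
      have h4 : 0 ≤ ∑ p ∈ (T \ U).filter (fun p => y < p ∧ i p ≠ j p)
          ∩ U.filter (fun p => q.factorization p ≠ r.factorization p), (p : ℝ)⁻¹ :=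
        Finset.sum_nonneg fun p _ => by positivity
      refine ⟨U.filter (fun p => q.factorization p ≠ r.factorization p), Finset.filter_subset _ _,
        fun p hp => (Finset.mem_filter.1 hp).2, ?_⟩
      rw [← Finset.mul_sum]
      linarith
    have h2 : ∑ p ∈ U, 2 * (p : ℝ)⁻¹ *
        edgeMass lam (fun q r => q.factorization p ≠ r.factorization p) V W
        ≤ ∑ p ∈ U, 4 * decay p ^ 6 * P := by
      refine Finset.sum_le_sum fun p hp => ?_
      have h3 := edgeMass_ne_le hlam (v := fun q => q.factorization p) (hn p hp).1 (hn p hp).2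
      calc 2 * (p : ℝ)⁻¹ * edgeMass lam (fun q r => q.factorization p ≠ r.factorization p) V W
          ≤ 2 * (p : ℝ)⁻¹ * (2 * decay p ^ 3 * P) := by gcongr
        _ = 4 * decay p ^ 6 * P * decay p ^ 2 := by rw [← decay_pow_five]; ring
        _ ≤ 4 * decay p ^ 6 * P * 1 := by
            have := decay_nonneg p
            gcongr
            exact pow_le_one₀ this (decay_le_one (hp1 p hp))
        _ = _ := by ring
    rw [← Finset.sum_mul, ← Finset.mul_sum] at h2
    have h3 : 4 * (∑ p ∈ U, decay p ^ 6) * P ≤ 4 * (δ / 2) * P := by gcongr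
    linarith
  · set Nice : ℕ → ℕ → Prop := fun q r => BadPair T ψ M y q r ∧
      ∀ p ∈ U, q.factorization p = n p ∨ r.factorization p = n p with hNice
    set Rough : ℕ → ℕ → Prop := fun q r =>
      ∃ p ∈ U, q.factorization p ≠ n p ∧ r.factorization p ≠ n p with hRough
    have hsplit : edgeMass lam (BadPair T ψ M y) V W
        ≤ edgeMass lam Nice V W + edgeMass lam Rough V W := by
      refine edgeMass_le_add hlam fun q _ r _ h => ?_
      by_cases hR : Rough q r
      · exact Or.inr hR
      · refine Or.inl ⟨h, fun p hp => ?_⟩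
        by_contra hno
        rw [not_or] at hno
        exact hR ⟨p, hp, hno⟩
    have hrough : edgeMass lam Rough V W ≤ δ / 2 * P := by
      have h1 : edgeMass lam Rough V W ≤ ∑ p ∈ U, 1 *
          edgeMass lam (fun q r => q.factorization p ≠ n p ∧ r.factorization p ≠ n p) V W := by
        refine edgeMass_le_sum_mul hlam (w := fun _ => 1)
          (F := fun p q r => q.factorization p ≠ n p ∧ r.factorization p ≠ n p) ?_
          fun p _ => zero_le_one
        rintro q _ r _ ⟨p, hp, h⟩
        exact ⟨{p}, by simpa using hp, by simpa using h, by simp⟩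
      refine h1.trans ?_
      calc _ ≤ ∑ p ∈ U, decay p ^ 6 * P := by
            refine Finset.sum_le_sum fun p hp => ?_
            have h3 := edgeMass_ne_and_ne_le hlam (v := fun q => q.factorization p)
              (pow_nonneg (decay_nonneg p) 3) (hn p hp).1 (hn p hp).2
            rw [one_mul]
            refine h3.trans (le_of_eq ?_)
            ring
        _ ≤ δ / 2 * P := by rw [← Finset.sum_mul]; gcongr
    by_cases hdense : edgeMass lam Nice V W ≤ δ / 2 * P
    · nlinarith [mul_nonneg hδ.le hP0]
    push Not at hdense hlight
    have hTU : ∀ p ∈ T \ U, p.Prime := fun p hp => hT p (Finset.mem_sdiff.1 hp).1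
    have hcard : y / 2 ≤ ((T \ U).filter fun p => i p ≠ j p).card := by
      rcases Nat.eq_zero_or_pos y with hy | hy
      · simp [hy]
      have hypos : (0 : ℝ) < y := by exact_mod_cast hy
      have h1 : ∑ p ∈ (T \ U).filter (fun p => y < p ∧ i p ≠ j p), (p : ℝ)⁻¹
          ≤ ∑ p ∈ (T \ U).filter (fun p => y < p ∧ i p ≠ j p), (y : ℝ)⁻¹ := by
        refine Finset.sum_le_sum fun p hp => ?_
        have : (y : ℝ) ≤ p := by exact_mod_cast (Finset.mem_filter.1 hp).2.1.le
        gcongr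
      rw [Finset.sum_const, nsmul_eq_mul] at h1
      have h2 := hlight.trans h1
      rw [← div_eq_mul_inv, le_div_iff₀ hypos] at h2
      have h3 : y ≤ 2 * ((T \ U).filter fun p => y < p ∧ i p ≠ j p).card := by
        have : (y : ℝ) ≤ 2 * ((T \ U).filter fun p => y < p ∧ i p ≠ j p).card := by linarith
        exact_mod_cast this
      have h4 : ((T \ U).filter fun p => y < p ∧ i p ≠ j p).card
          ≤ ((T \ U).filter fun p => i p ≠ j p).card := by
        apply Finset.card_le_card
        intro p hp
        simp only [Finset.mem_filter] at hp ⊢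
        exact ⟨hp.1, hp.2.2⟩
      omega
    have hpow : ∀ (R : Finset ℕ), R ⊆ T → ∀ e : ℕ → ℕ, 0 < ∏ p ∈ R, p ^ e p := fun R hR e =>
      Finset.prod_pos fun p hp => pow_pos (hT p (hR hp)).pos _
    have hsd : T \ U ⊆ T := Finset.sdiff_subset
    have hdvd : ∀ q : ℕ, ∏ p ∈ U, p ^ min (n p) (q.factorization p) ∣ ∏ p ∈ U, p ^ n p :=
      fun q => Finset.prod_dvd_prod_of_dvd _ _ fun p _ => pow_dvd_pow p (min_le_left _ _)
    have hbound : P ≤ 16 * M ^ 2 / ((δ / 2) ^ 2 *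
        ((∏ p ∈ T \ U, p ^ (j p - i p) : ℕ) * (∏ p ∈ T \ U, p ^ (i p - j p) : ℕ))) := by
      refine mass_mul_mass_le_of_dense hψ (E := Nice) (N := ∏ p ∈ U, p ^ n p)
        (a := ∏ p ∈ T \ U, p ^ i p) (b := ∏ p ∈ T \ U, p ^ j p)
        (d := fun q => ∏ p ∈ U, p ^ min (n p) (q.factorization p))
        (x := fun q => ∏ p ∈ U, p ^ (q.factorization p - n p))
        (hpow U hU n).ne' (by exact_mod_cast hpow _ hsd _) (by exact_mod_cast hpow _ hsd _)
        hM (by positivity) (fun q hq => (hS q (hV hq)).1) (fun q hq => (hS q (hW hq)).1)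
        (fun q hq => ⟨eq_split_prod hU (hS q (hV hq)).1 (hS q (hV hq)).2
          fun p hp => hi p hp q hq, hdvd q⟩)
        (fun q hq => ⟨eq_split_prod hU (hS q (hW hq)).1 (hS q (hW hq)).2
          fun p hp => hj p hp q hq, hdvd q⟩) ?_ ?_ hdense.le
      · intro q hq r hr h
        exact nice_pair_le hT hU (hψ q) (fun p hp => hi p hp q hq) (fun p hp => hj p hp r hr)
          h.2 h.1.1
      · intro q hq r hr h
        exact nice_pair_le hT hU (hψ r) (fun p hp => hj p hp r hr) (fun p hp => hi p hp q hq)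
          (fun p hp => (h.2 p hp).symm) h.1.2.1
    rw [← div_div] at hbound
    have hgain := prod_gap_gain hTU hcard hP0 (by positivity) hbound
    have hall : edgeMass lam (BadPair T ψ M y) V W ≤ P := by
      refine (edgeMass_mono hlam (F := fun _ _ => True ∧ True) fun _ _ _ _ _ =>
        ⟨trivial, trivial⟩).trans ?_
      rw [edgeMass_prod]
      simp [hP]
    nlinarith [mul_nonneg hδ.le hP0]

lemma decay_anti {m n : ℕ} (hm : 1 ≤ m) (h : m ≤ n) : decay n ≤ decay m :=
  Real.rpow_le_rpow_of_nonpos (by exact_mod_cast hm) (by exact_mod_cast h) (by norm_num)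

lemma decay_pos {n : ℕ} (hn : 1 ≤ n) : 0 < decay n :=
  Real.rpow_pos_of_pos (by exact_mod_cast hn) _

lemma decay_pow_six_le {n : ℕ} (hn : 1 ≤ n) :
    decay (n + 1) ^ 6 ≤ 10 * (decay n - decay (n + 1)) := by
  set a := decay n
  set b := decay (n + 1)
  have hb : 0 < b := decay_pos (by omega)
  have hab : b ≤ a := decay_anti hn (by omega)
  have ha : 0 < a := hb.trans_le hab
  have hn0 : (0 : ℝ) < n := by exact_mod_cast hn
  have hn1 : (1 : ℝ) ≤ n := by exact_mod_cast hn
  have ha5 : a ^ 5 * n = 1 := by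
    rw [decay_pow_five]; field_simp
  have hb5 : b ^ 5 * (n + 1) = 1 := by
    rw [decay_pow_five]; push_cast; field_simp
  have h1 : b ^ 10 ≤ a ^ 5 - b ^ 5 := by
    have : a ^ 5 - b ^ 5 = a ^ 5 * b ^ 5 := by
      have e1 : a ^ 5 * b ^ 5 = a ^ 5 * b ^ 5 * (n + 1) - a ^ 5 * b ^ 5 * n := by ring
      have e2 : a ^ 5 * b ^ 5 * (n + 1) = a ^ 5 := by rw [mul_assoc, hb5, mul_one]
      have e3 : a ^ 5 * b ^ 5 * n = b ^ 5 := by rw [mul_right_comm, ha5, one_mul]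
      rw [e2, e3] at e1
      exact e1.symm
    rw [this]
    calc b ^ 10 = b ^ 5 * b ^ 5 := by ring
      _ ≤ a ^ 5 * b ^ 5 := by gcongr
  have h2 : a ^ 5 - b ^ 5 ≤ 5 * a ^ 4 * (a - b) := by
    have e : a ^ 5 - b ^ 5 = (a ^ 4 + a ^ 3 * b + a ^ 2 * b ^ 2 + a * b ^ 3 + b ^ 4) * (a - b) := by
      ring
    rw [e]
    gcongr
    have i1 : a ^ 3 * b ≤ a ^ 3 * a := by gcongr
    have i2 : a ^ 2 * b ^ 2 ≤ a ^ 2 * a ^ 2 := by gcongr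
    have i3 : a * b ^ 3 ≤ a * a ^ 3 := by gcongr
    have i4 : b ^ 4 ≤ a ^ 4 := by gcongr
    nlinarith
  have h3 : a ^ 4 ≤ 2 * b ^ 4 := by
    have e1 : a ^ 5 ≤ 2 * b ^ 5 := by
      have e2 : a ^ 5 = 1 / n := by field_simp; linarith
      have e3 : b ^ 5 = 1 / (n + 1) := by field_simp; linarith
      rw [e2, e3, mul_one_div, div_le_div_iff₀ hn0 (by linarith)]
      linarith
    have e4 : a ^ 4 * b ≤ 2 * b ^ 4 * b := by
      calc a ^ 4 * b ≤ a ^ 4 * a := by gcongr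
        _ = a ^ 5 := by ring
        _ ≤ 2 * b ^ 5 := e1
        _ = _ := by ring
    exact le_of_mul_le_mul_right e4 hb
  have h4 : b ^ 6 * b ^ 4 ≤ 10 * (a - b) * b ^ 4 := by
    calc b ^ 6 * b ^ 4 = b ^ 10 := by ring
      _ ≤ 5 * a ^ 4 * (a - b) := h1.trans h2
      _ ≤ 5 * (2 * b ^ 4) * (a - b) := by gcongr
      _ = _ := by ring
  exact le_of_mul_le_mul_right h4 (by positivity)

lemma sum_decay_pow_six_le {A : ℕ} (hA : 1 ≤ A) {U : Finset ℕ} (hU : ∀ p ∈ U, A < p) :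
    ∑ p ∈ U, decay p ^ 6 ≤ 10 * decay A := by
  have key : ∀ B, A ≤ B → ∑ p ∈ Finset.Ioc A B, decay p ^ 6 ≤ 10 * (decay A - decay B) := by
    intro B hB
    induction B, hB using Nat.le_induction with
    | base => simp
    | succ B hB ih =>
      rw [← Finset.insert_Ioc_right_eq_Ioc_add_one hB, Finset.sum_insert (by simp)]
      have := decay_pow_six_le (hA.trans hB)
      linarith
  have hsub : U ⊆ Finset.Ioc A (A + U.sup id) := by
    intro p hp
    have := Finset.le_sup (f := id) hp
    rw [Finset.mem_Ioc]
    exact ⟨hU p hp, by simp only [id] at this; omega⟩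
  have h1 := Finset.sum_le_sum_of_subset_of_nonneg (f := fun p => decay p ^ 6) hsub
    fun p _ _ => pow_nonneg (decay_nonneg p) _
  have h2 := key (A + U.sup id) (by omega)
  have := decay_nonneg (A + U.sup id)
  linarith

lemma decay_le_of_pow_le {n k : ℕ} (hk : 1 ≤ k) (h : k ^ 5 ≤ n) : decay n ≤ 1 / k := by
  have hk0 : (0 : ℝ) < k := by exact_mod_cast hk
  refine le_of_pow_le_pow_left₀ (n := 5) (by norm_num) (by positivity) ?_
  rw [decay_pow_five, one_div, inv_pow]
  have : (k : ℝ) ^ 5 ≤ n := by exact_mod_cast h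
  gcongr

lemma exists_exponent_bound : ∃ C : ℝ, ∀ t : ℕ, 1 ≤ t →
    (6 + 14 * t : ℝ) - ((t ^ 20 / 2 : ℕ) : ℝ) / 20 + 4 * (2 ^ 20 * t ^ 3) ^ 5 ≤ C - 3 * t := by
  obtain ⟨D, hD, hD1⟩ : ∃ D : ℝ, D = 24 + 4 * (2 ^ 20) ^ 5 ∧ 1 ≤ D := ⟨_, rfl, by norm_num⟩
  refine ⟨D * (40 * D) ^ 3, fun t ht => ?_⟩
  have ht1 : (1 : ℝ) ≤ t := by exact_mod_cast ht
  have h1 : (t : ℝ) ^ 20 / 2 - 1 ≤ ((t ^ 20 / 2 : ℕ) : ℝ) := by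
    have : t ^ 20 ≤ 2 * (t ^ 20 / 2) + 1 := by omega
    have h : (t : ℝ) ^ 20 ≤ 2 * ((t ^ 20 / 2 : ℕ) : ℝ) + 1 := by exact_mod_cast this
    linarith
  have h15 : (t : ℝ) ≤ t ^ 15 := le_self_pow₀ ht1 (by norm_num)
  have e : (4 * (2 ^ 20 * t ^ 3) ^ 5 : ℝ) = (D - 24) * t ^ 15 := by rw [hD]; ring
  rw [e]
  have hmain : D * (t : ℝ) ^ 15 - t ^ 20 / 40 ≤ D * (40 * D) ^ 3 := by
    by_cases h : (t : ℝ) ^ 5 ≤ 40 * D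
    · have : (t : ℝ) ^ 15 ≤ (40 * D) ^ 3 := by
        calc (t : ℝ) ^ 15 = (t ^ 5) ^ 3 := by ring
          _ ≤ _ := by gcongr
      have h20 : (0 : ℝ) ≤ t ^ 20 := by positivity
      nlinarith
    · push Not at h
      have : 40 * D * (t : ℝ) ^ 15 ≤ t ^ 20 := by
        calc 40 * D * (t : ℝ) ^ 15 ≤ t ^ 5 * t ^ 15 := by gcongr
          _ = _ := by ring
      have : 0 ≤ D * (40 * D) ^ 3 := by positivity
      linarith
  have : (1 : ℝ) ≤ t ^ 15 := ht1.trans h15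
  linarith

/-- Bad pairs at scale `t` have total weight `O(t⁻³)`. -/
lemma exists_edgeMass_badPair_le : ∃ C : ℝ, 0 ≤ C ∧ ∀ t : ℕ, 1 ≤ t → ∀ S T : Finset ℕ,
    ∀ ψ : ℕ → ℝ, (∀ q, 0 ≤ ψ q) → (∀ p ∈ T, p.Prime) →
    (∀ q ∈ S, q ≠ 0 ∧ q.primeFactors ⊆ T) → mass (fun q => ψ q * phiDensity q) S ≤ 1 →
    edgeMass (fun q => ψ q * phiDensity q) (BadPair T ψ (16 ^ t) (t ^ 20)) S S
      ≤ C / (t : ℝ) ^ 3 := by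
  obtain ⟨C, hC⟩ := exists_exponent_bound
  refine ⟨2 + 2 ^ C, by positivity, fun t ht S T ψ hψ hT hS hmass => ?_⟩
  set lam : ℕ → ℝ := fun q => ψ q * phiDensity q with hlamdef
  have hlam : ∀ q, 0 ≤ lam q := fun q => mul_nonneg (hψ q) (phiDensity_nonneg q)
  have ht0 : (0 : ℝ) < t := by exact_mod_cast ht
  have ht1 : (1 : ℝ) ≤ t := by exact_mod_cast ht
  set δ : ℝ := 1 / (t : ℝ) ^ 3 with hδ
  have hδ0 : 0 < δ := by positivity
  obtain ⟨k, hk⟩ : ∃ k : ℕ, k = 2 ^ 20 * t ^ 3 := ⟨_, rfl⟩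
  have hk1 : 1 ≤ k := by rw [hk]; exact Nat.one_le_iff_ne_zero.2 (by positivity)
  have hkR : (k : ℝ) = 2 ^ 20 * t ^ 3 := by rw [hk]; push_cast; ring
  have hA1 : 1 ≤ k ^ 5 := Nat.one_le_pow _ _ hk1
  have hdA : decay (k ^ 5) ≤ 1 / k := decay_le_of_pow_le hk1 le_rfl
  set K : ℝ := (16 * (16 ^ t) ^ 2 / (δ / 2) ^ 2) ^ (1 / 4 : ℝ)
    * (2 : ℝ) ^ (-((t ^ 20 / 2 : ℕ) / 20) : ℝ) with hK
  have hmain := edgeMass_le_of_leaf hlam T S (fun p q => q.factorization p)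
    (BadPair T ψ (16 ^ t) (t ^ 20)) decay_nonneg (fun p hp => ?_) (fun p => p ≤ k ^ 5)
    (fun p hp hsm => ?_) (ε := 2 * δ) (K := K) (by positivity)
    (fun U hU V hV W hW i j hi hj h => edgeMass_leaf_le hT hS hψ (by positivity) hδ0 (t ^ 20)
      hU hV hW hi hj ?_ fun p hp => (h p hp).2) T subset_rfl S subset_rfl S subset_rfl
    (fun _ => 0) (fun _ => 0) (by simp) (by simp)
  · rw [Finset.sdiff_self, Finset.prod_empty, mul_one] at hmain
    have hm0 := mass_nonneg hlam S
    have hmm : mass lam S * mass lam S ≤ 1 := mul_le_one₀ hmass hm0 hmass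
    have hmm0 : 0 ≤ mass lam S * mass lam S := mul_nonneg hm0 hm0
    have hrp : (mass lam S * mass lam S) ^ (3 / 4 : ℝ) ≤ 1 :=
      Real.rpow_le_one hmm0 hmm (by norm_num)
    have hcard : (T.filter fun p => p ≤ k ^ 5).card ≤ k ^ 5 := by
      have : T.filter (fun p => p ≤ k ^ 5) ⊆ Finset.Ioc 0 (k ^ 5) := by
        intro p hp
        rw [Finset.mem_filter] at hp
        exact Finset.mem_Ioc.2 ⟨(hT p hp.1).pos, hp.2⟩
      simpa using Finset.card_le_card this
    have hKb : (16 * ((16 : ℝ) ^ t) ^ 2 / (δ / 2) ^ 2) ^ (1 / 4 : ℝ) ≤ 2 ^ (6 + 14 * t : ℝ) := by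
      have e : 16 * ((16 : ℝ) ^ t) ^ 2 / (δ / 2) ^ 2 = 64 * (256 ^ t) * t ^ 6 := by
        rw [hδ]
        have : (256 : ℝ) ^ t = (16 ^ t) ^ 2 := by rw [← pow_mul, mul_comm, pow_mul]; norm_num
        rw [this]
        field_simp
        norm_num
      have h1 : (1 : ℝ) ≤ 64 * (256 ^ t) * t ^ 6 := by
        have a1 : (1 : ℝ) ≤ 256 ^ t := one_le_pow₀ (by norm_num)
        have a2 : (1 : ℝ) ≤ (t : ℝ) ^ 6 := one_le_pow₀ ht1
        nlinarith
      rw [e]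
      calc (64 * (256 ^ t) * (t : ℝ) ^ 6) ^ (1 / 4 : ℝ)
          ≤ (64 * (256 ^ t) * (t : ℝ) ^ 6) ^ (1 : ℝ) :=
            Real.rpow_le_rpow_of_exponent_le h1 (by norm_num)
        _ = 64 * (256 ^ t) * (t : ℝ) ^ 6 := Real.rpow_one _
        _ ≤ 64 * (256 ^ t) * (2 ^ t) ^ 6 := by
            gcongr
            exact_mod_cast Nat.lt_two_pow_self.le
        _ = 2 ^ (6 + 14 * t) := by
            have a1 : (256 : ℝ) ^ t = 2 ^ (8 * t) := by rw [pow_mul]; norm_num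
            have a2 : ((2 : ℝ) ^ t) ^ 6 = 2 ^ (6 * t) := by rw [← pow_mul, mul_comm]
            have a3 : (64 : ℝ) = 2 ^ 6 := by norm_num
            rw [a1, a2, a3, ← pow_add, ← pow_add]; congr 1; ring
        _ = _ := by
            rw [← Real.rpow_natCast]; push_cast; rfl
    have hKtotal : K * 16 ^ (T.filter fun p => p ≤ k ^ 5).card ≤ 2 ^ C * δ := by
      calc K * 16 ^ (T.filter fun p => p ≤ k ^ 5).card
          ≤ (2 ^ (6 + 14 * t : ℝ) * (2 : ℝ) ^ (-((t ^ 20 / 2 : ℕ) / 20) : ℝ))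
            * 16 ^ (k ^ 5) := by
            rw [hK]
            gcongr
            norm_num
        _ = (2 : ℝ) ^ ((6 + 14 * t : ℝ) - ((t ^ 20 / 2 : ℕ) : ℝ) / 20
              + 4 * (2 ^ 20 * t ^ 3) ^ 5) := by
            have a1 : (16 : ℝ) ^ (k ^ 5) = (2 : ℝ) ^ (4 * (2 ^ 20 * t ^ 3) ^ 5 : ℝ) := by
              rw [Real.rpow_mul (by norm_num), ← hkR, ← Nat.cast_pow, Real.rpow_natCast]
              norm_num
            rw [a1, ← Real.rpow_add (by norm_num), ← Real.rpow_add (by norm_num)]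
            congr 1
        _ ≤ (2 : ℝ) ^ (C - 3 * t) :=
            Real.rpow_le_rpow_of_exponent_le (by norm_num) (hC t ht)
        _ = 2 ^ C * ((2 : ℝ) ^ (3 * t))⁻¹ := by
            rw [sub_eq_add_neg, Real.rpow_add (by norm_num), Real.rpow_neg (by norm_num)]
            congr 2
            rw [← Real.rpow_natCast]; push_cast; rfl
        _ ≤ 2 ^ C * δ := by
            rw [hδ, one_div]
            gcongr
            rw [mul_comm, pow_mul]
            gcongr
            exact_mod_cast Nat.lt_two_pow_self.le
    have hB := mul_le_mul hKtotal hrp (Real.rpow_nonneg hmm0 _) (by positivity)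
    have hA := mul_le_mul_of_nonneg_left hmm (show 0 ≤ 2 * δ by positivity)
    calc _ ≤ _ := hmain.trans (add_le_add hA (le_of_eq_of_le (by congr!) hB))
      _ = _ := by rw [hδ]; ring
  · have hp2 : (2 : ℝ) ≤ p := by exact_mod_cast (hT p hp).two_le
    refine le_of_pow_le_pow_left₀ (n := 5) (by norm_num) (by norm_num) ?_
    rw [decay_pow_five]
    calc (p : ℝ)⁻¹ ≤ (2 : ℝ)⁻¹ := by gcongr
      _ ≤ _ := by norm_num
  · push Not at hsm
    refine (decay_anti hA1 hsm.le).trans (hdA.trans ?_)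
    rw [hkR]
    gcongr
    have : (1 : ℝ) ≤ (t : ℝ) ^ 3 := one_le_pow₀ ht1
    nlinarith
  · refine (sum_decay_pow_six_le hA1 fun p hp => not_le.1 (h p hp).1).trans ?_
    have : 10 * decay (k ^ 5) ≤ 10 * (1 / k) := by gcongr
    refine this.trans ?_
    rw [hkR, hδ]
    rw [mul_one_div, div_div, div_le_div_iff₀ (by positivity) (by positivity)]
    have : (0 : ℝ) ≤ (t : ℝ) ^ 3 := by positivity
    nlinarith

/-- The primes up to `n`. -/
def primesTo (n : ℕ) : Finset ℕ := (Finset.Ioc 0 n).filter Nat.Prime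

lemma mem_primesTo {n p : ℕ} : p ∈ primesTo n ↔ p ≤ n ∧ p.Prime := by
  simp only [primesTo, Finset.mem_filter, Finset.mem_Ioc]
  exact ⟨fun h => ⟨h.1.2, h.2⟩, fun h => ⟨⟨h.2.pos, h.1⟩, h.2⟩⟩

lemma sum_log_primeFactors_le {m : ℕ} (hm : m ≠ 0) :
    ∑ p ∈ m.primeFactors, Real.log p ≤ Real.log m := by
  rw [← Real.log_prod fun p hp => by exact_mod_cast (Nat.prime_of_mem_primeFactors hp).ne_zero]
  apply Real.log_le_log
  · exact Finset.prod_pos fun p hp => by exact_mod_cast (Nat.prime_of_mem_primeFactors hp).pos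
  · rw [← Nat.cast_prod]
    exact_mod_cast Nat.le_of_dvd (Nat.pos_of_ne_zero hm) (Nat.prod_primeFactors_dvd m)

lemma sum_log_mul_div_le (n : ℕ) :
    ∑ p ∈ primesTo n, Real.log p * ((n / p : ℕ) : ℝ) ≤ n * Real.log n := by
  have h1 : ∑ m ∈ Finset.Ioc 0 n, Real.log m ≤ n * Real.log n := by
    have := Finset.sum_le_card_nsmul (Finset.Ioc 0 n) (fun m : ℕ => Real.log m) (Real.log n)
      fun m hm => by
        rw [Finset.mem_Ioc] at hm
        exact Real.log_le_log (by exact_mod_cast hm.1) (by exact_mod_cast hm.2)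
    simpa using this
  refine le_trans ?_ h1
  calc ∑ p ∈ primesTo n, Real.log p * ((n / p : ℕ) : ℝ)
      = ∑ p ∈ primesTo n, ∑ m ∈ Finset.Ioc 0 n, if p ∣ m then Real.log p else 0 := by
        refine Finset.sum_congr rfl fun p _ => ?_
        rw [← Finset.sum_filter, Finset.sum_const, Nat.Ioc_filter_dvd_card_eq_div, nsmul_eq_mul,
          mul_comm]
    _ = ∑ m ∈ Finset.Ioc 0 n, ∑ p ∈ primesTo n, if p ∣ m then Real.log p else 0 :=
        Finset.sum_comm
    _ ≤ ∑ m ∈ Finset.Ioc 0 n, Real.log m := by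
        refine Finset.sum_le_sum fun m hm => ?_
        rw [Finset.mem_Ioc] at hm
        refine le_of_eq_of_le ?_ (sum_log_primeFactors_le hm.1.ne')
        rw [← Finset.sum_filter]
        congr 1
        ext p
        rw [Finset.mem_filter, mem_primesTo, Nat.mem_primeFactors_of_ne_zero hm.1.ne']
        exact ⟨fun h => ⟨h.1.2, h.2⟩, fun h => ⟨⟨(Nat.le_of_dvd hm.1 h.2).trans hm.2, h.1⟩, h.2⟩⟩

/-- Upper half of Mertens' first theorem. -/
lemma sum_log_div_le (n : ℕ) :
    ∑ p ∈ primesTo n, Real.log p / p ≤ Real.log n + Real.log 4 := by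
  rcases Nat.eq_zero_or_pos n with rfl | hn
  · simp [primesTo]; positivity
  have hn0 : (0 : ℝ) < n := by exact_mod_cast hn
  have hθ : ∑ p ∈ primesTo n, Real.log p ≤ Real.log 4 * n := by
    have := Chebyshev.theta_le_log4_mul_x (x := n) hn0.le
    simpa [Chebyshev.theta, primesTo] using this
  have h1 : ∑ p ∈ primesTo n, (Real.log p * (n / p) - Real.log p)
      ≤ ∑ p ∈ primesTo n, Real.log p * ((n / p : ℕ) : ℝ) := by
    refine Finset.sum_le_sum fun p hp => ?_
    have hp1 := (mem_primesTo.1 hp).2.one_lt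
    have hl : 0 ≤ Real.log p := Real.log_nonneg (by exact_mod_cast hp1.le)
    have : (n / p : ℝ) < (n / p : ℕ) + 1 := by
      have := Nat.lt_floor_add_one ((n : ℝ) / p)
      rwa [Nat.floor_div_eq_div] at this
    nlinarith
  have h2 := sum_log_mul_div_le n
  have h3 : ∑ p ∈ primesTo n, Real.log p * ((n : ℝ) / p) =
      n * ∑ p ∈ primesTo n, Real.log p / p := by
    rw [Finset.mul_sum]
    exact Finset.sum_congr rfl fun p _ => by ring
  rw [Finset.sum_sub_distrib, h3] at h1
  refine le_of_mul_le_mul_left ?_ hn0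
  linarith

lemma primesTo_succ_of_prime {n : ℕ} (h : (n + 1).Prime) :
    primesTo (n + 1) = insert (n + 1) (primesTo n) := by
  ext p
  rw [Finset.mem_insert, mem_primesTo, mem_primesTo]
  constructor
  · rintro ⟨h1, h2⟩
    rcases Nat.lt_or_ge n p with h | h
    · left; omega
    · right; exact ⟨h, h2⟩
  · rintro (rfl | ⟨h1, h2⟩)
    · exact ⟨le_rfl, h⟩
    · exact ⟨by omega, h2⟩

lemma primesTo_succ_of_not_prime {n : ℕ} (h : ¬(n + 1).Prime) :
    primesTo (n + 1) = primesTo n := by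
  ext p
  rw [mem_primesTo, mem_primesTo]
  refine ⟨fun ⟨h1, h2⟩ => ⟨?_, h2⟩, fun ⟨h1, h2⟩ => ⟨by omega, h2⟩⟩
  by_contra h3
  have : p = n + 1 := by omega
  exact h (this ▸ h2)

lemma not_mem_primesTo_succ (n : ℕ) : n + 1 ∉ primesTo n := fun h => by
  have := (mem_primesTo.1 h).1; omega

/-- Upper half of Mertens' second theorem. -/
lemma sum_inv_primes_le {n : ℕ} (hn : 2 ≤ n) :
    ∑ p ∈ primesTo n, (p : ℝ)⁻¹ ≤ Real.log (Real.log n) + 4 := by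
  have key : ∀ n, 2 ≤ n → ∑ p ∈ primesTo n, (p : ℝ)⁻¹ -
      (∑ p ∈ primesTo n, Real.log p / p) / Real.log n ≤
      Real.log (Real.log n) - Real.log (Real.log 2) - Real.log 4 / Real.log n + 2 := by
    intro n hn
    induction n, hn using Nat.le_induction with
    | base =>
      have e : primesTo 2 = {2} := by decide
      have h2 : Real.log 2 ≠ 0 := (Real.log_pos (by norm_num)).ne'
      have h4 : Real.log 4 = 2 * Real.log 2 := by
        rw [show (4 : ℝ) = 2 ^ 2 by norm_num, Real.log_pow]; norm_num
      rw [e, h4]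
      simp only [Finset.sum_singleton]
      push_cast
      field_simp
      norm_num
    | succ n hn ih =>
      have hn2 : (2 : ℝ) ≤ n := by exact_mod_cast hn
      have hl : 0 < Real.log n := Real.log_pos (by linarith)
      have hl1 : Real.log n ≤ Real.log ((n + 1 : ℕ) : ℝ) :=
        Real.log_le_log (by linarith) (by push_cast; linarith)
      set L := Real.log n
      set M := Real.log ((n + 1 : ℕ) : ℝ)
      have hM : 0 < M := hl.trans_le hl1
      have hA := sum_log_div_le n
      set A := ∑ p ∈ primesTo n, Real.log p / p
      have e : ∑ p ∈ primesTo (n + 1), (p : ℝ)⁻¹ - (∑ p ∈ primesTo (n + 1), Real.log p / p) / M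
          = ∑ p ∈ primesTo n, (p : ℝ)⁻¹ - A / M := by
        by_cases hp : (n + 1).Prime
        · rw [primesTo_succ_of_prime hp, Finset.sum_insert (not_mem_primesTo_succ n),
            Finset.sum_insert (not_mem_primesTo_succ n), add_div, div_right_comm, div_self hM.ne']
          ring
        · rw [primesTo_succ_of_not_prime hp]
      have h1 : A / L - A / M ≤ (L + Real.log 4) / L - (L + Real.log 4) / M := by
        have hd : 1 / M ≤ 1 / L := one_div_le_one_div_of_le hl hl1
        have : A * (1 / L - 1 / M) ≤ (L + Real.log 4) * (1 / L - 1 / M) :=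
          mul_le_mul_of_nonneg_right hA (by linarith)
        calc A / L - A / M = A * (1 / L - 1 / M) := by ring
          _ ≤ _ := this
          _ = _ := by ring
      have h2 : 1 - L / M ≤ Real.log M - Real.log L := by
        have := Real.log_le_sub_one_of_pos (div_pos hl hM)
        rw [Real.log_div hl.ne' hM.ne'] at this
        linarith
      have h3 : (L + Real.log 4) / L - (L + Real.log 4) / M =
          1 - L / M + Real.log 4 / L - Real.log 4 / M := by
        field_simp; ring
      linarith
  have h := key n hn
  have hn2 : (2 : ℝ) ≤ n := by exact_mod_cast hn
  have hl : 0 < Real.log n := Real.log_pos (by linarith)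
  have hA := sum_log_div_le n
  have h1 : (∑ p ∈ primesTo n, Real.log p / p) / Real.log n ≤ 1 + Real.log 4 / Real.log n := by
    rw [div_le_iff₀ hl, add_mul, div_mul_cancel₀ _ hl.ne']
    linarith
  have h2 : -1 ≤ Real.log (Real.log 2) := by
    rw [Real.le_log_iff_exp_le (Real.log_pos (by norm_num))]
    have := Real.exp_neg_one_lt_d9
    have := Real.log_two_gt_d9
    linarith
  linarith

lemma sum_inv_primes_between_le {z : ℕ} (hz : 1 ≤ z) :
    ∑ p ∈ (primesTo ((z + 1) ^ 20)).filter (z < ·), (p : ℝ)⁻¹ ≤ 22 := by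
  have hz1 : (2 : ℝ) ≤ z + 1 := by exact_mod_cast Nat.succ_le_succ hz
  have h2 : 0 < Real.log 2 := Real.log_pos (by norm_num)
  have hl2 : Real.log 2 ≤ Real.log (z + 1) := Real.log_le_log (by norm_num) hz1
  have hl : 0 < Real.log (z + 1 : ℝ) := h2.trans_le hl2
  have h4 : Real.log 4 = 2 * Real.log 2 := by
    rw [show (4 : ℝ) = 2 ^ 2 by norm_num, Real.log_pow]; norm_num
  have h := sum_log_div_le ((z + 1) ^ 20)
  have h3 : Real.log (((z + 1) ^ 20 : ℕ) : ℝ) = 20 * Real.log (z + 1) := by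
    push_cast; rw [Real.log_pow]; norm_num
  have h5 : Real.log (z + 1) * ∑ p ∈ (primesTo ((z + 1) ^ 20)).filter (z < ·), (p : ℝ)⁻¹ ≤
      ∑ p ∈ primesTo ((z + 1) ^ 20), Real.log p / p := by
    rw [Finset.mul_sum]
    refine le_trans (Finset.sum_le_sum fun p hp => ?_)
      (Finset.sum_le_sum_of_subset_of_nonneg (Finset.filter_subset _ _) fun p _ _ => ?_)
    · rw [div_eq_mul_inv]
      have : z + 1 ≤ p := (Finset.mem_filter.1 hp).2
      gcongr
      exact_mod_cast this
    · exact div_nonneg (Real.log_natCast_nonneg p) (by positivity)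
  refine le_of_mul_le_mul_left ?_ hl
  linarith

lemma sum_inv_sq_le (U : Finset ℕ) (hU : ∀ p ∈ U, 2 ≤ p) : ∑ p ∈ U, ((p : ℝ)⁻¹) ^ 2 ≤ 1 := by
  have key : ∀ n : ℕ, ∑ k ∈ Finset.Ioc 1 (1 + n), ((k : ℝ)⁻¹) ^ 2 ≤ 1 - ((n : ℝ) + 1)⁻¹ := by
    intro n
    induction n with
    | zero => simp
    | succ n ih =>
      rw [← add_assoc, ← Finset.insert_Ioc_right_eq_Ioc_add_one (by omega),
        Finset.sum_insert (by simp)]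
      have : (((1 + n + 1 : ℕ) : ℝ)⁻¹) ^ 2 ≤ ((n : ℝ) + 1)⁻¹ - ((n : ℝ) + 1 + 1)⁻¹ := by
        push_cast
        rw [inv_pow, inv_sub_inv (by positivity) (by positivity), ← one_div,
          div_le_div_iff₀ (by positivity) (by positivity)]
        have : (0 : ℝ) ≤ n := by positivity
        nlinarith
      push_cast at this ⊢
      linarith
  have hsub : U ⊆ Finset.Ioc 1 (1 + U.sup id) := by
    intro p hp
    have h := Finset.le_sup (f := id) hp
    have := hU p hp
    rw [Finset.mem_Ioc]
    simp only [id] at h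
    constructor <;> omega
  refine (Finset.sum_le_sum_of_subset_of_nonneg hsub fun _ _ _ => by positivity).trans ?_
  refine (key _).trans ?_
  have : (0 : ℝ) ≤ ((U.sup id : ℕ) + 1 : ℝ)⁻¹ := by positivity
  linarith

/-- Euler-type products are controlled by the exponential of the sum of reciprocals. -/
lemma exp_le_prod_one_sub_inv (U : Finset ℕ) (hU : ∀ p ∈ U, 2 ≤ p) :
    Real.exp (-(∑ p ∈ U, (p : ℝ)⁻¹) - 2) ≤ ∏ p ∈ U, (1 - (p : ℝ)⁻¹) := by
  have h1 : ∀ p ∈ U, Real.exp (-(p : ℝ)⁻¹ - 2 * ((p : ℝ)⁻¹) ^ 2) ≤ 1 - (p : ℝ)⁻¹ := by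
    intro p hp
    have hp2 : (2 : ℝ) ≤ p := by exact_mod_cast hU p hp
    have hx0 : (0 : ℝ) ≤ (p : ℝ)⁻¹ := by positivity
    have hx : (p : ℝ)⁻¹ ≤ 1 / 2 := by
      rw [one_div]; gcongr
    set x := (p : ℝ)⁻¹
    have hpos : 0 < 1 - x := by linarith
    rw [← Real.le_log_iff_exp_le hpos]
    have := Real.one_sub_inv_le_log_of_pos hpos
    refine le_trans ?_ this
    rw [show 1 - (1 - x)⁻¹ = -x / (1 - x) by field_simp; ring, le_div_iff₀ hpos]
    nlinarith [mul_nonneg hx0 hx0]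
  calc Real.exp (-(∑ p ∈ U, (p : ℝ)⁻¹) - 2)
      ≤ Real.exp (∑ p ∈ U, (-(p : ℝ)⁻¹ - 2 * ((p : ℝ)⁻¹) ^ 2)) := by
        rw [Real.exp_le_exp, Finset.sum_sub_distrib, ← Finset.mul_sum, Finset.sum_neg_distrib]
        have := sum_inv_sq_le U hU
        linarith
    _ = ∏ p ∈ U, Real.exp (-(p : ℝ)⁻¹ - 2 * ((p : ℝ)⁻¹) ^ 2) := Real.exp_sum _ _
    _ ≤ _ := Finset.prod_le_prod (fun _ _ => (Real.exp_pos _).le) h1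

lemma one_le_Log (x : ℝ) : 1 ≤ Log x := le_max_left _ _

lemma one_le_Log2 (x : ℝ) : 1 ≤ Log2 x := le_max_left _ _

lemma Log_pos (x : ℝ) : 0 < Log x := one_pos.trans_le (one_le_Log x)

lemma Log2_pos (x : ℝ) : 0 < Log2 x := one_pos.trans_le (one_le_Log2 x)

lemma card_primeFactors_mul_log_two_le {h : ℕ} (hh : h ≠ 0) :
    (h.primeFactors.card : ℝ) * Real.log 2 ≤ Real.log h := by
  refine le_trans ?_ (sum_log_primeFactors_le hh)
  rw [← nsmul_eq_mul]
  refine Finset.card_nsmul_le_sum _ _ _ fun p hp => ?_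
  exact Real.log_le_log (by norm_num)
    (by exact_mod_cast (Nat.prime_of_mem_primeFactors hp).two_le)

lemma sum_inv_primeFactors_le {h : ℕ} (hh : h ≠ 0) :
    ∑ p ∈ h.primeFactors, (p : ℝ)⁻¹ ≤ Real.log (Log2 h) + 6 := by
  set n := ⌊Log h⌋₊
  have hL := Log_pos h
  have hsmall : ∑ p ∈ h.primeFactors.filter (· ≤ n), (p : ℝ)⁻¹ ≤ Real.log (Log2 h) + 4 := by
    have hsub : h.primeFactors.filter (· ≤ n) ⊆ primesTo n := by
      intro p hp
      rw [Finset.mem_filter] at hp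
      exact mem_primesTo.2 ⟨hp.2, Nat.prime_of_mem_primeFactors hp.1⟩
    refine (Finset.sum_le_sum_of_subset_of_nonneg hsub fun _ _ _ => by positivity).trans ?_
    rcases Nat.lt_or_ge n 2 with h2 | h2
    · have : primesTo n = ∅ := by
        refine Finset.eq_empty_of_forall_notMem fun p hp => ?_
        have := mem_primesTo.1 hp
        have := this.2.two_le
        omega
      rw [this, Finset.sum_empty]
      have := Real.log_nonneg (one_le_Log2 h)
      linarith
    · refine (sum_inv_primes_le h2).trans ?_
      have hn2 : (2 : ℝ) ≤ n := by exact_mod_cast h2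
      gcongr
      · exact Real.log_pos (by linarith)
      · exact (Real.log_le_log (by linarith) (Nat.floor_le hL.le)).trans (le_max_right _ _)
  have hlarge : ∑ p ∈ h.primeFactors.filter (¬ · ≤ n), (p : ℝ)⁻¹ ≤ 2 := by
    have h1 : ∀ p ∈ h.primeFactors.filter (¬ · ≤ n), (p : ℝ)⁻¹ ≤ (Log h)⁻¹ := by
      intro p hp
      have := Nat.lt_of_floor_lt (not_le.1 (Finset.mem_filter.1 hp).2)
      gcongr
    have h2 := Finset.sum_le_card_nsmul _ _ _ h1
    have h3 : ((h.primeFactors.filter (¬ · ≤ n)).card : ℝ) ≤ h.primeFactors.card := by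
      exact_mod_cast Finset.card_filter_le _ _
    have h4 := card_primeFactors_mul_log_two_le hh
    have h5 : Real.log h ≤ Log h := le_max_right _ _
    have h6 := Real.log_two_gt_d9
    rw [nsmul_eq_mul] at h2
    refine h2.trans ?_
    rw [← div_eq_mul_inv, div_le_iff₀ hL]
    have h7 : (0 : ℝ) ≤ h.primeFactors.card := by positivity
    nlinarith
  rw [← Finset.sum_filter_add_sum_filter_not h.primeFactors (· ≤ n)]
  linarith

/-- `φ(h)/h ≫ 1 / log log h`. -/
lemma le_phiDensity_mul_Log2 {h : ℕ} (hh : h ≠ 0) :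
    Real.exp (-8) ≤ phiDensity h * Log2 h := by
  have h1 := exp_le_prod_one_sub_inv h.primeFactors
    fun p hp => (Nat.prime_of_mem_primeFactors hp).two_le
  rw [← phiDensity_eq_prod hh] at h1
  have h2 := sum_inv_primeFactors_le hh
  calc Real.exp (-8) = Real.exp (-(Real.log (Log2 h) + 6) - 2) * Log2 h := by
        nth_rewrite 2 [← Real.exp_log (Log2_pos h)]
        rw [← Real.exp_add]; congr 1; ring
    _ ≤ Real.exp (-(∑ p ∈ h.primeFactors, (p : ℝ)⁻¹) - 2) * Log2 h := by
        have := (Log2_pos h).le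
        gcongr
    _ ≤ _ := mul_le_mul_of_nonneg_right h1 (Log2_pos h).le

open Classical in
/-- Sieving by residue classes modulo distinct primes, over complete periods. -/
lemma card_filter_mod_le {T : Finset ℕ} (hT : ∀ p ∈ T, p.Prime) (k : ℕ) (good : ℕ → ℕ → Prop) :
    ((Finset.range (k * ∏ p ∈ T, p)).filter fun t => ∀ p ∈ T, good p (t % p)).card ≤
      k * ∏ p ∈ T, ((Finset.range p).filter (good p)).card := by
  set P := ∏ p ∈ T, p
  have hcard : (Finset.range k ×ˢ T.pi fun p => (Finset.range p).filter (good p)).card =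
      k * ∏ p ∈ T, ((Finset.range p).filter (good p)).card := by
    rw [Finset.card_product, Finset.card_range, Finset.card_pi]
  rw [← hcard]
  refine Finset.card_le_card_of_injOn (fun t => (t / P, fun p _ => t % p)) ?_ ?_
  · intro t ht
    simp only [Finset.coe_filter, Finset.mem_range, Set.mem_ofPred_eq] at ht
    simp only [Finset.coe_product, Set.mem_prod, Finset.mem_coe, Finset.mem_range, Finset.mem_pi,
      Finset.mem_filter]
    refine ⟨Nat.div_lt_of_lt_mul (by rw [mul_comm]; exact ht.1), fun p hp => ⟨?_, ht.2 p hp⟩⟩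
    exact Nat.mod_lt _ (hT p hp).pos
  · intro s _ t _ h
    simp only [Prod.mk.injEq] at h
    have h2 : ∀ p ∈ T, s % p = t % p := fun p hp => congrFun (congrFun h.2 p) hp
    have hdvd : (P : ℤ) ∣ (t : ℤ) - s := by
      have : (P : ℤ) = ∏ p ∈ T, (p : ℤ) := by simp [P]
      rw [this]
      refine Finset.prod_dvd_of_coprime (fun p hp q hq hpq => ?_) fun p hp =>
        (Nat.modEq_iff_dvd (n := p)).1 (h2 p hp)
      exact Nat.isCoprime_iff_coprime.2 ((Nat.coprime_primes (hT p hp) (hT q hq)).2 hpq)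
    have hmod : s % P = t % P := (Nat.modEq_iff_dvd (n := P)).2 hdvd
    rw [← Nat.div_add_mod s P, ← Nat.div_add_mod t P, h.1, hmod]

lemma prod_one_add_inv_le {U : Finset ℕ} (hU : ∀ p ∈ U, p.Prime) :
    ∏ p ∈ U, (1 + (p : ℝ)⁻¹) ≤ ∑ d ∈ (∏ p ∈ U, p).divisors, (d : ℝ)⁻¹ := by
  induction U using Finset.induction_on with
  | empty => simp
  | insert p U hp ih =>
    have hpp := hU p (Finset.mem_insert_self _ _)
    have hU' : ∀ q ∈ U, q.Prime := fun q hq => hU q (Finset.mem_insert_of_mem hq)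
    have hn : ∏ q ∈ U, q ≠ 0 := Finset.prod_ne_zero_iff.2 fun q hq => (hU' q hq).ne_zero
    have hpn : ¬p ∣ ∏ q ∈ U, q := by
      rw [hpp.prime.dvd_finsetProd_iff]
      rintro ⟨q, hq, h⟩
      exact hp ((Nat.prime_dvd_prime_iff_eq hpp (hU' q hq)).1 h ▸ hq)
    rw [Finset.prod_insert hp, Finset.prod_insert hp]
    set n := ∏ q ∈ U, q
    have hdis : Disjoint n.divisors (n.divisors.image (p * ·)) := by
      rw [Finset.disjoint_left]
      rintro d hd hd'
      obtain ⟨e, he, rfl⟩ := Finset.mem_image.1 hd'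
      exact hpn ((dvd_mul_right p e).trans (Nat.dvd_of_mem_divisors hd))
    have hsub : n.divisors ∪ n.divisors.image (p * ·) ⊆ (p * n).divisors := by
      intro d hd
      have hpn0 : p * n ≠ 0 := mul_ne_zero hpp.ne_zero hn
      rcases Finset.mem_union.1 hd with h | h
      · exact Nat.mem_divisors.2 ⟨(Nat.dvd_of_mem_divisors h).mul_left p, hpn0⟩
      · obtain ⟨e, he, rfl⟩ := Finset.mem_image.1 h
        exact Nat.mem_divisors.2 ⟨mul_dvd_mul_left p (Nat.dvd_of_mem_divisors he), hpn0⟩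
    refine le_trans ?_ (Finset.sum_le_sum_of_subset_of_nonneg hsub fun _ _ _ => by positivity)
    rw [Finset.sum_union hdis, Finset.sum_image fun a _ b _ h =>
      Nat.eq_of_mul_eq_mul_left hpp.pos h]
    have e : ∑ d ∈ n.divisors, ((p * d : ℕ) : ℝ)⁻¹ = (p : ℝ)⁻¹ * ∑ d ∈ n.divisors, (d : ℝ)⁻¹ := by
      rw [Finset.mul_sum]
      exact Finset.sum_congr rfl fun d _ => by push_cast; rw [mul_inv]
    rw [e, add_mul, one_mul]
    have := ih hU'
    gcongr

lemma phiDensity_pos {n : ℕ} (hn : n ≠ 0) : 0 < phiDensity n := by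
  have := Nat.totient_pos.2 (Nat.pos_of_ne_zero hn)
  have := Nat.pos_of_ne_zero hn
  unfold phiDensity; positivity

lemma inv_phiDensity_le {m : ℕ} (hm : m ≠ 0) :
    (phiDensity m)⁻¹ ≤ Real.exp 2 * ∑ d ∈ m.divisors, (d : ℝ)⁻¹ := by
  have hprime : ∀ p ∈ m.primeFactors, p.Prime := fun p => Nat.prime_of_mem_primeFactors
  have h1 : ∀ p ∈ m.primeFactors,
      (1 - (p : ℝ)⁻¹)⁻¹ ≤ Real.exp (2 * ((p : ℝ)⁻¹) ^ 2) * (1 + (p : ℝ)⁻¹) := by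
    intro p hp
    have hp2 : (2 : ℝ) ≤ p := by exact_mod_cast (hprime p hp).two_le
    have hx0 : (0 : ℝ) ≤ (p : ℝ)⁻¹ := by positivity
    have hx : (p : ℝ)⁻¹ ≤ 1 / 2 := by rw [one_div]; gcongr
    set x := (p : ℝ)⁻¹
    rw [inv_le_iff_one_le_mul₀ (by linarith)]
    have h := Real.add_one_le_exp (2 * x ^ 2)
    have hy : x ^ 2 ≤ 1 / 4 := by nlinarith
    calc (1 : ℝ) ≤ (2 * x ^ 2 + 1) * (1 - x ^ 2) := by nlinarith [sq_nonneg x]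
      _ ≤ Real.exp (2 * x ^ 2) * (1 - x ^ 2) := by
          apply mul_le_mul_of_nonneg_right h; linarith
      _ = _ := by ring
  have h2 : ∏ p ∈ m.primeFactors, p ∣ m := Nat.prod_primeFactors_dvd m
  rw [phiDensity_eq_prod hm, ← Finset.prod_inv_distrib]
  calc ∏ p ∈ m.primeFactors, (1 - (p : ℝ)⁻¹)⁻¹
      ≤ ∏ p ∈ m.primeFactors, (Real.exp (2 * ((p : ℝ)⁻¹) ^ 2) * (1 + (p : ℝ)⁻¹)) :=
        Finset.prod_le_prod (fun p hp => inv_nonneg.2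
          (one_sub_inv_prime_nonneg (hprime p hp).one_lt.le)) h1
    _ = Real.exp (2 * ∑ p ∈ m.primeFactors, ((p : ℝ)⁻¹) ^ 2)
          * ∏ p ∈ m.primeFactors, (1 + (p : ℝ)⁻¹) := by
        rw [Finset.prod_mul_distrib, ← Real.exp_sum, Finset.mul_sum]
    _ ≤ Real.exp 2 * ∑ d ∈ m.divisors, (d : ℝ)⁻¹ := by
        have := sum_inv_sq_le m.primeFactors fun p hp => (hprime p hp).two_le
        refine mul_le_mul (Real.exp_le_exp.2 (by linarith)) ?_ (by positivity) (by positivity)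
        exact (prod_one_add_inv_le hprime).trans (Finset.sum_le_sum_of_subset_of_nonneg
          (Nat.divisors_subset_of_dvd hm h2) fun _ _ _ => by positivity)

lemma card_coprime_le {Z : Finset ℕ} (hZ : ∀ p ∈ Z, p.Prime) (Y : ℕ) :
    (((Finset.Ioc 0 Y).filter fun m => ∀ p ∈ Z, ¬p ∣ m).card : ℝ) ≤
      (Y + (∏ p ∈ Z, p : ℕ)) * ∏ p ∈ Z, (1 - (p : ℝ)⁻¹) := by
  classical
  set P := ∏ p ∈ Z, p with hP
  have hP0 : 0 < P := Finset.prod_pos fun p hp => (hZ p hp).pos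
  have h := card_filter_mod_le hZ (Y / P + 1) fun _ r => r ≠ 0
  have hsub : ((Finset.Ioc 0 Y).filter fun m => ∀ p ∈ Z, ¬p ∣ m) ⊆
      (Finset.range ((Y / P + 1) * P)).filter fun t => ∀ p ∈ Z, t % p ≠ 0 := by
    intro m hm
    rw [Finset.mem_filter, Finset.mem_Ioc] at hm
    rw [Finset.mem_filter, Finset.mem_range]
    refine ⟨hm.1.2.trans_lt ?_, fun p hp h0 => hm.2 p hp (Nat.dvd_of_mod_eq_zero h0)⟩
    rw [mul_comm]
    exact Nat.lt_mul_div_succ Y hP0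
  have hc : ∀ p ∈ Z, ((((Finset.range p).filter fun r => r ≠ 0).card : ℕ) : ℝ)
      = p * (1 - (p : ℝ)⁻¹) := by
    intro p hp
    have h0 : 0 < p := (hZ p hp).pos
    have : (Finset.range p).filter (fun r => r ≠ 0) = (Finset.range p).erase 0 := by
      ext r; simp [and_comm]
    rw [this, Finset.card_erase_of_mem (by simpa using h0), Finset.card_range,
      Nat.cast_sub h0]
    have : (p : ℝ) ≠ 0 := by exact_mod_cast h0.ne'
    field_simp
    simp
  have h1 := (Finset.card_le_card hsub).trans (le_of_eq_of_le (by congr!) h)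
  have h2 : (((Finset.Ioc 0 Y).filter fun m => ∀ p ∈ Z, ¬p ∣ m).card : ℝ) ≤
      ((Y / P : ℕ) + 1) * ∏ p ∈ Z, ((((Finset.range p).filter fun r => r ≠ 0).card : ℕ) : ℝ) := by
    exact_mod_cast h1
  refine h2.trans ?_
  rw [Finset.prod_congr rfl hc, Finset.prod_mul_distrib, ← Nat.cast_prod, ← hP, ← mul_assoc]
  refine mul_le_mul_of_nonneg_right ?_ (Finset.prod_nonneg fun p hp =>
    one_sub_inv_prime_nonneg (hZ p hp).one_lt.le)
  have : ((Y / P * P : ℕ) : ℝ) ≤ Y := by exact_mod_cast Nat.div_mul_le_self Y P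
  push_cast at this
  linarith

/-- Average of `m / φ(m)` over `m ≤ X` free of a given set of small primes. -/
lemma sum_inv_phiDensity_le {Z : Finset ℕ} (hZ : ∀ p ∈ Z, p.Prime) {X : ℕ} (hX : 1 ≤ X)
    (hZX : (∏ p ∈ Z, p) ^ 2 ≤ X) :
    ∑ m ∈ (Finset.Ioc 0 X).filter (fun m => ∀ p ∈ Z, ¬p ∣ m), (phiDensity m)⁻¹ ≤
      4 * Real.exp 2 * (X * ∏ p ∈ Z, (1 - (p : ℝ)⁻¹)) := by
  set F := ∏ p ∈ Z, (1 - (p : ℝ)⁻¹)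
  have hF : 0 ≤ F := Finset.prod_nonneg fun p hp =>
    one_sub_inv_prime_nonneg (hZ p hp).one_lt.le
  set P := ∏ p ∈ Z, p
  set M := (Finset.Ioc 0 X).filter (fun m => ∀ p ∈ Z, ¬p ∣ m) with hM
  have hXR : (1 : ℝ) ≤ X := by exact_mod_cast hX
  have hcount : ∀ d ∈ Finset.Ioc 0 X, ((M.filter (d ∣ ·)).card : ℝ) ≤ (X / d + P) * F := by
    intro d hd
    rw [Finset.mem_Ioc] at hd
    have h1 : (M.filter (d ∣ ·)).card ≤
        ((Finset.Ioc 0 (X / d)).filter fun m => ∀ p ∈ Z, ¬p ∣ m).card := by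
      refine Finset.card_le_card_of_injOn (· / d) (fun m hm => ?_) fun m hm n hn h => ?_
      · simp only [hM, Finset.coe_filter, Finset.mem_filter, Finset.mem_Ioc,
          Set.mem_ofPred_eq] at hm ⊢
        obtain ⟨⟨⟨h1, h2⟩, h3⟩, e, rfl⟩ := hm
        rw [Nat.mul_div_cancel_left e hd.1]
        refine ⟨⟨Nat.pos_of_mul_pos_left h1, ?_⟩, fun p hp hpe => h3 p hp (hpe.mul_left d)⟩
        rw [Nat.le_div_iff_mul_le hd.1, mul_comm]; exact h2
      · simp only [Finset.coe_filter, Set.mem_ofPred_eq] at hm hn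
        exact Nat.div_left_inj hm.2 hn.2 |>.1 h
    have h2 := card_coprime_le hZ (X / d)
    have h3 : ((M.filter (d ∣ ·)).card : ℝ) ≤
        ((Finset.Ioc 0 (X / d)).filter fun m => ∀ p ∈ Z, ¬p ∣ m).card := by exact_mod_cast h1
    refine h3.trans (h2.trans ?_)
    have : ((X / d : ℕ) : ℝ) ≤ X / d := Nat.cast_div_le
    gcongr
  have hsq : ∑ d ∈ Finset.Ioc 0 X, ((d : ℝ)⁻¹) ^ 2 ≤ 2 := by
    have e : Finset.Ioc 0 X = insert 1 (Finset.Ioc 1 X) := by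
      ext d; simp only [Finset.mem_Ioc, Finset.mem_insert]; omega
    rw [e, Finset.sum_insert (by simp)]
    have := sum_inv_sq_le (Finset.Ioc 1 X) fun p hp => (Finset.mem_Ioc.1 hp).1
    norm_num
    norm_num at this
    linarith
  have hharm : ∑ d ∈ Finset.Ioc 0 X, (d : ℝ)⁻¹ ≤ 2 * √X := by
    have h1 := harmonic_le_one_add_log X
    have h2 : ((harmonic X : ℚ) : ℝ) = ∑ d ∈ Finset.Ioc 0 X, (d : ℝ)⁻¹ := by
      rw [harmonic_eq_sum_Icc]
      push_cast
      rfl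
    rw [h2] at h1
    have h3 : Real.log X = 2 * Real.log √X := by
      rw [Real.log_sqrt (by linarith)]; ring
    have h4 := Real.log_le_sub_one_of_pos (Real.sqrt_pos.2 (one_pos.trans_le hXR))
    linarith
  have hPX : (P : ℝ) ≤ √X := Real.le_sqrt_of_sq_le (by exact_mod_cast hZX)
  calc ∑ m ∈ M, (phiDensity m)⁻¹
      ≤ ∑ m ∈ M, Real.exp 2 * ∑ d ∈ Finset.Ioc 0 X, if d ∣ m then (d : ℝ)⁻¹ else 0 := by
        refine Finset.sum_le_sum fun m hm => ?_
        have hm1 := Finset.mem_Ioc.1 (Finset.mem_filter.1 hm).1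
        refine (inv_phiDensity_le hm1.1.ne').trans (le_of_eq ?_)
        rw [← Finset.sum_filter]
        congr 2
        ext d
        rw [Finset.mem_filter, Nat.mem_divisors, Finset.mem_Ioc]
        exact ⟨fun h => ⟨⟨Nat.pos_of_dvd_of_pos h.1 hm1.1, (Nat.le_of_dvd hm1.1 h.1).trans hm1.2⟩,
          h.1⟩, fun h => ⟨h.2, hm1.1.ne'⟩⟩
    _ = Real.exp 2 * ∑ d ∈ Finset.Ioc 0 X, (d : ℝ)⁻¹ * (M.filter (d ∣ ·)).card := by
        rw [← Finset.mul_sum, Finset.sum_comm]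
        congr 1
        refine Finset.sum_congr rfl fun d _ => ?_
        rw [← Finset.sum_filter, Finset.sum_const, nsmul_eq_mul, mul_comm]
    _ ≤ Real.exp 2 * ∑ d ∈ Finset.Ioc 0 X, (d : ℝ)⁻¹ * ((X / d + P) * F) := by
        gcongr with d hd
        exact hcount d hd
    _ = Real.exp 2 * (F * (X * ∑ d ∈ Finset.Ioc 0 X, ((d : ℝ)⁻¹) ^ 2
          + P * ∑ d ∈ Finset.Ioc 0 X, (d : ℝ)⁻¹)) := by
        congr 1
        rw [Finset.mul_sum, Finset.mul_sum, ← Finset.sum_add_distrib, Finset.mul_sum]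
        exact Finset.sum_congr rfl fun d _ => by ring
    _ ≤ Real.exp 2 * (F * (X * 2 + √X * (2 * √X))) := by
        gcongr
    _ = _ := by
        have := Real.mul_self_sqrt (show (0 : ℝ) ≤ X by positivity)
        linear_combination (2 * Real.exp 2 * F) * this

lemma exists_dvd_add_mul {p : ℕ} (hp : p.Prime) {u : ℤ} (hu : ¬(p : ℤ) ∣ u) (a : ℤ) :
    ∃ r < p, (p : ℤ) ∣ a + u * r := by
  have := Fact.mk hp
  have hu0 : (u : ZMod p) ≠ 0 := fun h => hu ((ZMod.intCast_zmod_eq_zero_iff_dvd u p).1 h)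
  refine ⟨(-(a : ZMod p) / u).val, ZMod.val_lt _, ?_⟩
  rw [← ZMod.intCast_zmod_eq_zero_iff_dvd]
  push_cast
  rw [ZMod.natCast_val, ZMod.cast_id]
  field_simp
  ring

open Classical in
lemma card_residues_le {p : ℕ} (hp : p.Prime) {u v : ℕ} (huv : u.Coprime v) {a b m : ℤ}
    (hm : (p : ℤ) ∣ a * v - b * u - m) :
    (((Finset.range p).filter fun r : ℕ =>
      ¬(p : ℤ) ∣ a + u * r ∧ ¬(p : ℤ) ∣ b + v * r).card : ℝ) ≤
      p * ((1 - (p : ℝ)⁻¹) * if p ∣ u * v ∨ (p : ℤ) ∣ m then 1 else 1 - (p : ℝ)⁻¹) := by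
  set G := (Finset.range p).filter fun r : ℕ => ¬(p : ℤ) ∣ a + u * r ∧ ¬(p : ℤ) ∣ b + v * r with hG
  have hp2 : (2 : ℝ) ≤ p := by exact_mod_cast hp.two_le
  have hp0 : (p : ℝ) ≠ 0 := by positivity
  have hone : ∀ r < p, ((p : ℤ) ∣ a + u * r ∨ (p : ℤ) ∣ b + v * r) → (G.card : ℝ) ≤ p - 1 := by
    intro r hr h
    have hsub : G ⊆ (Finset.range p).erase r := by
      intro s hs
      rw [hG, Finset.mem_filter] at hs
      refine Finset.mem_erase.2 ⟨?_, hs.1⟩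
      rintro rfl
      tauto
    have := Finset.card_le_card hsub
    rw [Finset.card_erase_of_mem (Finset.mem_range.2 hr), Finset.card_range] at this
    have h1 : G.card + 1 ≤ p := by have := hp.pos; omega
    have h2 : (G.card : ℝ) + 1 ≤ p := by exact_mod_cast h1
    linarith
  have hdu : (p : ℤ) ∣ u ↔ p ∣ u := Int.natCast_dvd_natCast
  have hdv : (p : ℤ) ∣ v ↔ p ∣ v := Int.natCast_dvd_natCast
  have hnot : ¬(p ∣ u ∧ p ∣ v) := fun h => hp.one_lt.ne' (Nat.dvd_one.1
    (huv ▸ Nat.dvd_gcd h.1 h.2))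
  split_ifs with h
  · rw [mul_one, mul_sub, mul_inv_cancel₀ hp0, mul_one]
    by_cases h1 : p ∣ u
    · obtain ⟨r, hr, hd⟩ := exists_dvd_add_mul hp (fun h2 => hnot ⟨h1, hdv.1 h2⟩) b
      exact hone r hr (Or.inr hd)
    · obtain ⟨r, hr, hd⟩ := exists_dvd_add_mul hp (fun h2 => h1 (hdu.1 h2)) a
      exact hone r hr (Or.inl hd)
  · push Not at h
    have h1 : ¬p ∣ u := fun h2 => h.1 (h2.mul_right v)
    have h1' : ¬p ∣ v := fun h2 => h.1 (h2.mul_left u)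
    obtain ⟨r, hr, hd⟩ := exists_dvd_add_mul hp (fun h2 => h1 (hdu.1 h2)) a
    obtain ⟨s, hs, hd'⟩ := exists_dvd_add_mul hp (fun h2 => h1' (hdv.1 h2)) b
    have hrs : r ≠ s := by
      rintro rfl
      apply h.2
      have e : m = v * (a + u * r) - u * (b + v * r) - (a * v - b * u - m) := by ring
      rw [e]
      exact dvd_sub (dvd_sub (hd.mul_left _) (hd'.mul_left _)) hm
    have hsub : G ⊆ ((Finset.range p).erase r).erase s := by
      intro t ht
      rw [hG, Finset.mem_filter] at ht
      refine Finset.mem_erase.2 ⟨?_, Finset.mem_erase.2 ⟨?_, ht.1⟩⟩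
      · rintro rfl; tauto
      · rintro rfl; tauto
    have := Finset.card_le_card hsub
    rw [Finset.card_erase_of_mem (Finset.mem_erase.2 ⟨hrs.symm, Finset.mem_range.2 hs⟩),
      Finset.card_erase_of_mem (Finset.mem_range.2 hr), Finset.card_range] at this
    have h1 : G.card + 2 ≤ p := by have := hp.two_le; omega
    have h2 : (G.card : ℝ) + 2 ≤ p := by exact_mod_cast h1
    have e : (p : ℝ) * ((1 - (p : ℝ)⁻¹) * (1 - (p : ℝ)⁻¹)) = p - 2 + (p : ℝ)⁻¹ := by
      field_simp; ring
    rw [e]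
    have : (0 : ℝ) ≤ (p : ℝ)⁻¹ := by positivity
    linarith

open Classical in
/-- Pairs of reduced numerators whose fractions differ by `m / (g u v)` modulo one. -/
noncomputable def numPairs (g u v : ℕ) (m : ℤ) : Finset (ℕ × ℕ) :=
  (Finset.range (g * u) ×ˢ Finset.range (g * v)).filter fun x =>
    x.1.Coprime (g * u) ∧ x.2.Coprime (g * v) ∧
      ((g * u * v : ℕ) : ℤ) ∣ (x.1 : ℤ) * v - x.2 * u - m

open Classical in
lemma card_numPairs_le_card {g u v : ℕ} (hg : 0 < g) (hu : 0 < u) (hv : 0 < v)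
    (huv : u.Coprime v) {m : ℤ} {a b : ℕ} (hab : (a, b) ∈ numPairs g u v m) :
    (numPairs g u v m).card ≤ ((Finset.range g).filter fun t : ℕ => ∀ p ∈ g.primeFactors,
      (¬(p : ℤ) ∣ (a : ℤ) + u * (t % p : ℕ) ∧ ¬(p : ℤ) ∣ (b : ℤ) + v * (t % p : ℕ))).card := by
  have hgZ : (0 : ℤ) < g := by exact_mod_cast hg
  have huZ : (0 : ℤ) < u := by exact_mod_cast hu
  have hvZ : (0 : ℤ) < v := by exact_mod_cast hv
  have hcop : IsCoprime (u : ℤ) (v : ℤ) := Nat.isCoprime_iff_coprime.2 huv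
  have hdiff : ∀ x ∈ numPairs g u v m, ∃ s s' : ℤ, (x.1 : ℤ) = a + u * s ∧
      (x.2 : ℤ) = b + v * s' ∧ (g : ℤ) ∣ s - s' := by
    intro x hx
    simp only [numPairs, Finset.mem_filter] at hx hab
    have h := dvd_sub hx.2.2.2 hab.2.2.2
    have e : (x.1 : ℤ) * v - x.2 * u - m - ((a : ℤ) * v - b * u - m) =
        (x.1 - a) * v - (x.2 - b) * u := by ring
    rw [e] at h
    have hu' : (u : ℤ) ∣ x.1 - a := by
      have h1 : (u : ℤ) ∣ (x.1 - a) * v - (x.2 - b) * u :=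
        (Dvd.intro_left (g * v : ℤ) (by push_cast; ring)).trans h
      have h2 := dvd_add h1 (dvd_mul_left (u : ℤ) (x.2 - b))
      rw [sub_add_cancel] at h2
      exact hcop.dvd_of_dvd_mul_right h2
    have hv' : (v : ℤ) ∣ x.2 - b := by
      have h1 : (v : ℤ) ∣ (x.1 - a) * v - (x.2 - b) * u :=
        (Dvd.intro_left (g * u : ℤ) (by push_cast; ring)).trans h
      have h2 := dvd_sub (dvd_mul_left (v : ℤ) (x.1 - a)) h1
      rw [sub_sub_cancel] at h2
      exact hcop.symm.dvd_of_dvd_mul_right h2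
    obtain ⟨s, hs⟩ := hu'
    obtain ⟨s', hs'⟩ := hv'
    refine ⟨s, s', by linarith, by linarith, ?_⟩
    rw [hs, hs', show (u : ℤ) * s * v - v * s' * u = (u * v) * (s - s') by ring] at h
    have h2 : ((u * v : ℤ)) * g ∣ (u * v) * (s - s') := by
      refine dvd_trans (dvd_of_eq ?_) h
      push_cast; ring
    exact Int.dvd_of_mul_dvd_mul_left (by positivity) h2
  choose! s s' h1 h2 h3 using hdiff
  have hs : ∀ x, (((s x % g).toNat : ℕ) : ℤ) = s x % g := fun x =>
    Int.toNat_of_nonneg (Int.emod_nonneg _ hgZ.ne')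
  refine Finset.card_le_card_of_injOn (fun x => (s x % g).toNat) ?_ ?_
  · intro x hx
    have hx' := hx
    simp only [numPairs, Finset.coe_filter, Set.mem_ofPred_eq] at hx'
    simp only [Finset.coe_filter, Finset.mem_range, Set.mem_ofPred_eq]
    refine ⟨?_, fun p hp => ?_⟩
    · have := Int.emod_lt_of_pos (s x) hgZ
      have := hs x
      omega
    · have hpp := Nat.prime_of_mem_primeFactors hp
      have hpg : p ∣ g := Nat.dvd_of_mem_primeFactors hp
      have hpgZ : (p : ℤ) ∣ g := Int.natCast_dvd_natCast.2 hpg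
      have hs1 : (p : ℤ) ∣ s x - (((s x % g).toNat % p : ℕ) : ℤ) := by
        have i1 : (p : ℤ) ∣ s x - s x % g := hpgZ.trans (Int.dvd_self_sub_emod)
        have i2 : (p : ℤ) ∣ s x % g - (((s x % g).toNat % p : ℕ) : ℤ) := by
          push_cast
          rw [hs]
          exact Int.dvd_self_sub_emod
        have := dvd_add i1 i2
        rwa [sub_add_sub_cancel] at this
      have hs2 : (p : ℤ) ∣ s' x - (((s x % g).toNat % p : ℕ) : ℤ) := by
        have := dvd_sub hs1 (hpgZ.trans (h3 x hx))
        rwa [show ∀ i j k : ℤ, i - k - (i - j) = j - k by intros; ring] at this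
      have hndvd : ∀ n k : ℕ, n.Coprime (g * k) → ¬(p : ℤ) ∣ n := fun n k hn hd =>
        hpp.one_lt.ne' (Nat.dvd_one.1 (hn ▸ Nat.dvd_gcd (Int.natCast_dvd_natCast.1 hd)
          (hpg.mul_right k)))
      constructor
      · intro hd
        apply hndvd _ _ hx'.2.1
        rw [h1 x hx]
        have := dvd_add hd (hs1.mul_left (u : ℤ))
        rwa [add_assoc, ← mul_add, add_sub_cancel] at this
      · intro hd
        apply hndvd _ _ hx'.2.2.1
        rw [h2 x hx]
        have := dvd_add hd (hs2.mul_left (v : ℤ))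
        rwa [add_assoc, ← mul_add, add_sub_cancel] at this
  · intro x hx y hy hxy
    have hx' := hx
    have hy' := hy
    simp only [numPairs, Finset.coe_filter, Set.mem_ofPred_eq, Finset.mem_product,
      Finset.mem_range] at hx' hy'
    have hmod : s x % g = s y % g := by rw [← hs x, ← hs y]; exact_mod_cast hxy
    have hd : (g : ℤ) ∣ s y - s x := Int.ModEq.dvd hmod
    have hd' : (g : ℤ) ∣ s' y - s' x := by
      have := dvd_add (dvd_sub hd (h3 y hy)) (h3 x hx)
      rwa [show ∀ i j k l : ℤ, i - j - (i - k) + (j - l) = k - l by intros; ring] at this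
    have eq_of : ∀ (w n k : ℕ) (c : ℤ), n < g * w → k < g * w → (g : ℤ) ∣ c →
        (k : ℤ) - n = w * c → n = k := by
      intro w n k c hn hk hc e
      have : ((g * w : ℕ) : ℤ) ∣ (k : ℤ) - n := by
        rw [e]; push_cast; rw [mul_comm (g : ℤ)]; exact mul_dvd_mul_left _ hc
      have := (Nat.modEq_iff_dvd (n := g * w)).2 this
      rwa [Nat.ModEq, Nat.mod_eq_of_lt hn, Nat.mod_eq_of_lt hk] at this
    refine Prod.ext ?_ ?_
    · exact eq_of u _ _ _ hx'.1.1 hy'.1.1 hd (by rw [h1 x hx, h1 y hy]; ring)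
    · exact eq_of v _ _ _ hx'.1.2 hy'.1.2 hd' (by rw [h2 x hx, h2 y hy]; ring)

lemma phiDensity_mul_phiDensity {g u v : ℕ} (hg : 0 < g) (hu : 0 < u) (hv : 0 < v)
    (huv : u.Coprime v) :
    phiDensity (g * u) * phiDensity (g * v) = phiDensity g * (phiDensity (u * v) *
      ∏ p ∈ g.primeFactors \ (u * v).primeFactors, (1 - (p : ℝ)⁻¹)) := by
  have hgcd : (g * u).gcd (g * v) = g := by rw [Nat.gcd_mul_left, huv, mul_one]
  have h := Nat.totient_gcd_mul_totient_mul (g * u) (g * v)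
  rw [hgcd] at h
  have hR : (g.totient : ℝ) * (g * u * (g * v)).totient =
      (g * u).totient * (g * v).totient * g := by exact_mod_cast h
  have hg0 : (g : ℝ) ≠ 0 := by positivity
  have hu0 : (u : ℝ) ≠ 0 := by positivity
  have hv0 : (v : ℝ) ≠ 0 := by positivity
  have e1 : phiDensity (g * u) * phiDensity (g * v) =
      phiDensity g * phiDensity (g * u * (g * v)) := by
    unfold phiDensity
    push_cast
    field_simp
    linear_combination -hR
  have e2 : (g * u * (g * v)).primeFactors =
      (u * v).primeFactors ∪ (g.primeFactors \ (u * v).primeFactors) := by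
    rw [Finset.union_sdiff_self_eq_union, Nat.primeFactors_mul (by positivity) (by positivity),
      Nat.primeFactors_mul hg.ne' hu.ne', Nat.primeFactors_mul hg.ne' hv.ne',
      Nat.primeFactors_mul hu.ne' hv.ne']
    ext p
    simp only [Finset.mem_union]
    tauto
  rw [e1, phiDensity_eq_prod (n := g * u * (g * v)) (by positivity), e2,
    Finset.prod_union Finset.disjoint_sdiff, phiDensity_eq_prod (n := u * v) (by positivity)]

/-- Bound for the number of pairs of reduced fractions at a prescribed distance. -/
lemma card_numPairs_le {g u v : ℕ} (hg : 0 < g) (hu : 0 < u) (hv : 0 < v)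
    (huv : u.Coprime v) {m : ℤ} (hm : m ≠ 0) :
    ((numPairs g u v m).card : ℝ) * phiDensity (u * v) ≤
      g * (phiDensity (g * u) * phiDensity (g * v)) * (phiDensity m.natAbs)⁻¹ := by
  classical
  have hm' : m.natAbs ≠ 0 := Int.natAbs_ne_zero.2 hm
  have hfm := phiDensity_pos hm'
  rcases (numPairs g u v m).eq_empty_or_nonempty with h0 | ⟨⟨a, b⟩, hab⟩
  · rw [h0, Finset.card_empty, Nat.cast_zero, zero_mul]
    have := phiDensity_nonneg (g * u)
    have := phiDensity_nonneg (g * v)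
    positivity
  have hrad : g / (∏ p ∈ g.primeFactors, p) * ∏ p ∈ g.primeFactors, p = g :=
    Nat.div_mul_cancel (Nat.prod_primeFactors_dvd g)
  set k := g / (∏ p ∈ g.primeFactors, p)
  have hprime : ∀ p ∈ g.primeFactors, p.Prime := fun p => Nat.prime_of_mem_primeFactors
  have hf0 : ∀ p ∈ g.primeFactors, 0 ≤ 1 - (p : ℝ)⁻¹ := fun p hp =>
    one_sub_inv_prime_nonneg (hprime p hp).one_lt.le
  have h1 := card_numPairs_le_card hg hu hv huv hab
  have h2 := card_filter_mod_le hprime k fun p r =>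
    (¬(p : ℤ) ∣ (a : ℤ) + u * r ∧ ¬(p : ℤ) ∣ (b : ℤ) + v * r)
  rw [hrad] at h2
  have hdvd : ((g * u * v : ℕ) : ℤ) ∣ (a : ℤ) * v - b * u - m := by
    simp only [numPairs, Finset.mem_filter] at hab
    exact hab.2.2.2
  have h3 : ((numPairs g u v m).card : ℝ) ≤ k * ∏ p ∈ g.primeFactors, ((p : ℝ) *
      ((1 - (p : ℝ)⁻¹) * if p ∣ u * v ∨ (p : ℤ) ∣ m then 1 else 1 - (p : ℝ)⁻¹)) := by
    have h4 := h1.trans (le_of_eq_of_le (by congr!) h2)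
    refine (Nat.cast_le (α := ℝ).2 h4).trans ?_
    have h5 := Finset.prod_le_prod (s := g.primeFactors) (fun p _ => Nat.cast_nonneg (α := ℝ) _)
      fun p hp => card_residues_le (hprime p hp) huv ((Int.natCast_dvd_natCast.2
        (((Nat.dvd_of_mem_primeFactors hp).mul_right u).mul_right v)).trans hdvd)
    rw [← Nat.cast_prod] at h5
    rw [Nat.cast_mul]
    exact mul_le_mul_of_nonneg_left (le_of_eq_of_le (by congr!) h5) (Nat.cast_nonneg _)
  have h5 : (k : ℝ) * ∏ p ∈ g.primeFactors, ((p : ℝ) *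
      ((1 - (p : ℝ)⁻¹) * if p ∣ u * v ∨ (p : ℤ) ∣ m then 1 else 1 - (p : ℝ)⁻¹)) =
      g * (phiDensity g * ∏ p ∈ g.primeFactors,
        if p ∣ u * v ∨ (p : ℤ) ∣ m then 1 else 1 - (p : ℝ)⁻¹) := by
    rw [Finset.prod_mul_distrib, Finset.prod_mul_distrib, phiDensity_eq_prod hg.ne', ← mul_assoc]
    congr 1
    rw [← Nat.cast_prod]
    exact_mod_cast hrad
  have h6 : (∏ p ∈ g.primeFactors, if p ∣ u * v ∨ (p : ℤ) ∣ m then 1 else 1 - (p : ℝ)⁻¹) *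
      phiDensity m.natAbs ≤ ∏ p ∈ g.primeFactors \ (u * v).primeFactors, (1 - (p : ℝ)⁻¹) := by
    have huv0 : u * v ≠ 0 := by positivity
    set W := g.primeFactors \ (u * v).primeFactors with hW
    have hWsub : W ⊆ g.primeFactors := Finset.sdiff_subset
    have e1 : (∏ p ∈ g.primeFactors, if p ∣ u * v ∨ (p : ℤ) ∣ m then (1 : ℝ) else 1 - (p : ℝ)⁻¹) =
        ∏ p ∈ W.filter (¬· ∣ m.natAbs), (1 - (p : ℝ)⁻¹) := by
      rw [← Finset.prod_filter_mul_prod_filter_not g.primeFactors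
        (fun p => p ∣ u * v ∨ (p : ℤ) ∣ m)]
      rw [Finset.prod_congr rfl fun p hp => if_pos (Finset.mem_filter.1 hp).2,
        Finset.prod_const_one, one_mul,
        Finset.prod_congr rfl fun p hp => if_neg (Finset.mem_filter.1 hp).2]
      congr 1
      ext p
      simp only [hW, Finset.mem_filter, Finset.mem_sdiff, Nat.mem_primeFactors_of_ne_zero huv0,
        Int.natCast_dvd]
      constructor
      · rintro ⟨h1, h2⟩; tauto
      · rintro ⟨⟨h1, h2⟩, h3⟩
        have := hprime p h1
        tauto
    have e2 : phiDensity m.natAbs ≤ ∏ p ∈ W.filter (· ∣ m.natAbs), (1 - (p : ℝ)⁻¹) := by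
      rw [phiDensity_eq_prod hm']
      refine Finset.prod_le_prod_of_subset_of_le_one ?_ ?_ ?_
      · intro p hp
        rw [Finset.mem_filter] at hp
        exact (Nat.mem_primeFactors_of_ne_zero hm').2 ⟨hprime p (hWsub hp.1), hp.2⟩
      · exact fun p hp => one_sub_inv_prime_nonneg (Nat.prime_of_mem_primeFactors hp).one_lt.le
      · intro p _ _
        have : (0 : ℝ) ≤ (p : ℝ)⁻¹ := by positivity
        linarith
    rw [e1, ← Finset.prod_filter_mul_prod_filter_not W (fun p : ℕ => p ∣ m.natAbs), mul_comm]
    refine mul_le_mul_of_nonneg_right e2 (Finset.prod_nonneg fun p hp => ?_)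
    exact hf0 p (hWsub (Finset.mem_filter.1 hp).1)
  rw [h5] at h3
  rw [phiDensity_mul_phiDensity hg hu hv huv, le_mul_inv_iff₀ hfm]
  have hfg := phiDensity_nonneg g
  have hfuv := phiDensity_nonneg (u * v)
  set Q := ∏ p ∈ g.primeFactors, if p ∣ u * v ∨ (p : ℤ) ∣ m then (1 : ℝ) else 1 - (p : ℝ)⁻¹
  calc ((numPairs g u v m).card : ℝ) * phiDensity (u * v) * phiDensity m.natAbs
      ≤ (g * (phiDensity g * Q)) * phiDensity (u * v) * phiDensity m.natAbs := by gcongr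
    _ = g * (phiDensity g * phiDensity (u * v)) * (Q * phiDensity m.natAbs) := by ring
    _ ≤ g * (phiDensity g * phiDensity (u * v)) * _ :=
        mul_le_mul_of_nonneg_left h6 (by positivity)
    _ = _ := by ring

/-- Numerators of the reduced fractions with denominator `q`. -/
def redNum (q : ℕ) : Finset ℕ := (Finset.range q).filter fun a => q.Coprime a

/-- Points of the circle within `ψ(q)/q` of a reduced fraction with denominator `q`. -/
noncomputable def approxSet (ψ : ℕ → ℝ) (q : ℕ) : Set UnitAddCircle :=
  approxAddOrderOf UnitAddCircle q (ψ q / q)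

lemma approxSet_eq {ψ : ℕ → ℝ} {q : ℕ} (hq : 0 < q) :
    approxSet ψ q =
      ⋃ a ∈ redNum q, Metric.ball (((a : ℝ) / q : ℝ) : UnitAddCircle) (ψ q / q) := by
  ext x
  rw [approxSet, UnitAddCircle.mem_approxAddOrderOf_iff hq]
  simp only [Set.mem_iUnion, redNum, Finset.mem_filter, Finset.mem_range, Metric.mem_ball,
    dist_eq_norm, exists_prop]
  refine exists_congr fun a => ?_
  rw [and_assoc, Nat.coprime_comm]
  rfl

lemma measurableSet_approxSet {ψ : ℕ → ℝ} {q : ℕ} (hq : 0 < q) :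
    MeasurableSet (approxSet ψ q) := by
  rw [approxSet_eq hq]
  exact Finset.measurableSet_biUnion _ fun _ _ => Metric.isOpen_ball.measurableSet

lemma measureReal_ball {x : UnitAddCircle} {ε : ℝ} (h0 : 0 ≤ ε) (h1 : ε ≤ 1 / 2) :
    volume.real (Metric.ball x ε) = 2 * ε := by
  rw [← measureReal_congr AddCircle.closedBall_ae_eq_ball, measureReal_def,
    AddCircle.volume_closedBall, ENNReal.toReal_ofReal (le_min zero_le_one (by linarith)),
    min_eq_right (by linarith)]

lemma div_natCast_le_half {ψ : ℕ → ℝ} {q : ℕ} (hq : 0 < q) (h1 : ψ q ≤ 1 / 2) :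
    ψ q / q ≤ 1 / 2 := by
  have : (1 : ℝ) ≤ q := by exact_mod_cast hq
  rw [div_le_iff₀ (by linarith)]
  linarith

lemma dist_fractions_mul (s : ℝ) {ℓ : ℝ} (hℓ : 0 < ℓ) :
    ℓ * ‖((s : ℝ) : UnitAddCircle)‖ = |ℓ * s - ℓ * (round s : ℤ)| := by
  rw [UnitAddCircle.norm_eq, ← mul_sub, abs_mul, abs_of_pos hℓ]

lemma measureReal_approxSet {ψ : ℕ → ℝ} {q : ℕ} (hq : 0 < q) (h0 : 0 ≤ ψ q)
    (h1 : ψ q ≤ 1 / 2) :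
    volume.real (approxSet ψ q) = 2 * (ψ q * phiDensity q) := by
  have hq0 : (0 : ℝ) < q := by exact_mod_cast hq
  rw [approxSet_eq hq, measureReal_biUnion_finset]
  · rw [Finset.sum_congr rfl fun a _ => measureReal_ball (div_nonneg h0 hq0.le)
      (div_natCast_le_half hq h1), Finset.sum_const, nsmul_eq_mul, phiDensity,
      Nat.totient_eq_card_coprime]
    simp only [redNum]
    ring
  · intro a ha b hb hab
    refine Metric.ball_disjoint_ball ?_
    have hlt : ∀ c ∈ (redNum q : Set ℕ), c < q := fun c hc =>
      Finset.mem_range.1 (Finset.mem_filter.1 hc).1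
    have e : dist (((a : ℝ) / q : ℝ) : UnitAddCircle) (((b : ℝ) / q : ℝ) : UnitAddCircle) =
        ‖(((a : ℝ) / q - b / q : ℝ) : UnitAddCircle)‖ := by
      rw [dist_eq_norm, AddCircle.coe_sub]
    rw [e]
    refine le_of_mul_le_mul_left ?_ hq0
    rw [dist_fractions_mul _ hq0]
    set j := round ((a : ℝ) / q - b / q)
    have e2 : (q : ℝ) * (a / q - b / q) - q * (j : ℤ) = (((a : ℤ) - b - q * j : ℤ) : ℝ) := by
      push_cast; field_simp
    have hne : (a : ℤ) - b - q * j ≠ 0 := by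
      intro h
      apply hab
      have : (b : ℤ) ≡ a [ZMOD q] := (Int.modEq_iff_dvd).2 ⟨j, by linarith⟩
      have := (Int.natCast_modEq_iff).1 this
      rw [Nat.ModEq, Nat.mod_eq_of_lt (hlt a ha), Nat.mod_eq_of_lt (hlt b hb)] at this
      exact this.symm
    rw [e2, ← Int.cast_abs]
    have h3 : (1 : ℝ) ≤ (|(a : ℤ) - b - q * j| : ℤ) := by exact_mod_cast Int.one_le_abs hne
    refine le_trans ?_ h3
    rw [← add_div, mul_div_cancel₀ _ hq0.ne']
    linarith
  · exact fun _ _ => Metric.isOpen_ball.measurableSet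

lemma coprime_offset {g u v : ℕ} {a b : ℕ} (ha : (g * u).Coprime a) (hb : (g * v).Coprime b)
    (huv : u.Coprime v) {j m : ℤ} (hm : m = (a : ℤ) * v - b * u - g * u * v * j)
    {p : ℕ} (hp : p.Prime) (hpuv : p ∣ u * v) : ¬(p : ℤ) ∣ m := by
  intro hpm
  have hc : ∀ {w c : ℕ}, (g * w).Coprime c → p ∣ w → p ∣ c → False := fun h h1 h2 =>
    hp.one_lt.ne' (Nat.dvd_one.1 (h ▸ Nat.dvd_gcd (h1.mul_left g) h2))
  have hnot : p ∣ u → p ∣ v → False := fun h1 h2 =>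
    hp.one_lt.ne' (Nat.dvd_one.1 (huv ▸ Nat.dvd_gcd h1 h2))
  have hp' := Nat.prime_iff_prime_int.1 hp
  rcases (Nat.Prime.dvd_mul hp).1 hpuv with h | h
  · have hZ : (p : ℤ) ∣ u := Int.natCast_dvd_natCast.2 h
    have h1 : (p : ℤ) ∣ a * v := by
      have e : (a : ℤ) * v = m + u * (b + g * v * j) := by rw [hm]; ring
      rw [e]
      exact dvd_add hpm (hZ.mul_right _)
    rcases hp'.dvd_or_dvd h1 with h2 | h2
    · exact hc ha h (Int.natCast_dvd_natCast.1 h2)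
    · exact hnot h (Int.natCast_dvd_natCast.1 h2)
  · have hZ : (p : ℤ) ∣ v := Int.natCast_dvd_natCast.2 h
    have h1 : (p : ℤ) ∣ b * u := by
      have e : (b : ℤ) * u = v * (a - g * u * j) - m := by rw [hm]; ring
      rw [e]
      exact dvd_sub (hZ.mul_right _) hpm
    rcases hp'.dvd_or_dvd h1 with h2 | h2
    · exact hc hb h (Int.natCast_dvd_natCast.1 h2)
    · exact hnot (Int.natCast_dvd_natCast.1 h2) h

open Classical in
/-- The overlap of two approximation sets is controlled by counting close fractions. -/
lemma measureReal_inter_le_count {ψ : ℕ → ℝ} (hψ0 : ∀ q, 0 ≤ ψ q) (hψ1 : ∀ q, ψ q ≤ 1 / 2)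
    {g u v : ℕ} (hg : 0 < g) (hu : 0 < u) (hv : 0 < v) (huv : u.Coprime v) (h1 : u * v ≠ 1)
    {X : ℕ} (hX : v * ψ (g * u) + u * ψ (g * v) ≤ X + 1) :
    volume.real (approxSet ψ (g * u) ∩ approxSet ψ (g * v)) ≤
      2 * min (ψ (g * u) / (g * u : ℕ)) (ψ (g * v) / (g * v : ℕ)) *
        ∑ n ∈ (Finset.Ioc 0 X).filter (fun n => ∀ p ∈ (u * v).primeFactors, ¬p ∣ n),
          (((numPairs g u v n).card : ℝ) + (numPairs g u v (-n)).card) := by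
  have hq : 0 < g * u := by positivity
  have hr : 0 < g * v := by positivity
  have hgR : (0 : ℝ) < g := by exact_mod_cast hg
  have huR : (0 : ℝ) < u := by exact_mod_cast hu
  have hvR : (0 : ℝ) < v := by exact_mod_cast hv
  set ε := ψ (g * u) / (g * u : ℕ) with hε
  set η := ψ (g * v) / (g * v : ℕ) with hη
  have hε0 : 0 ≤ ε := div_nonneg (hψ0 _) (by positivity)
  have hη0 : 0 ≤ η := div_nonneg (hψ0 _) (by positivity)
  set F := (Finset.Ioc 0 X).filter (fun n => ∀ p ∈ (u * v).primeFactors, ¬p ∣ n) with hF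
  set K := (redNum (g * u) ×ˢ redNum (g * v)).filter fun x =>
    dist (((x.1 : ℝ) / (g * u : ℕ) : ℝ) : UnitAddCircle)
      (((x.2 : ℝ) / (g * v : ℕ) : ℝ) : UnitAddCircle) < ε + η with hK
  have hKsub : K ⊆ F.biUnion fun n => numPairs g u v n ∪ numPairs g u v (-n) := by
    rintro ⟨a, b⟩ hab
    rw [hK, Finset.mem_filter, Finset.mem_product, redNum, redNum, Finset.mem_filter,
      Finset.mem_filter] at hab
    obtain ⟨⟨⟨ha, ha'⟩, hb, hb'⟩, hd⟩ := hab
    simp only at ha ha' hb hb' hd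
    rw [dist_eq_norm, ← AddCircle.coe_sub] at hd
    set s : ℝ := (a : ℝ) / (g * u : ℕ) - b / (g * v : ℕ) with hs
    have hℓ : (0 : ℝ) < g * u * v := by positivity
    have h2 := dist_fractions_mul s hℓ
    obtain ⟨m, hm⟩ : ∃ m : ℤ, m = (a : ℤ) * v - b * u - g * u * v * round s := ⟨_, rfl⟩
    have e1 : (g * u * v : ℝ) * s - g * u * v * (round s : ℤ) = (m : ℝ) := by
      rw [hm, hs]; push_cast; field_simp
    rw [e1] at h2
    have e2 : (g * u * v : ℝ) * (ε + η) = v * ψ (g * u) + u * ψ (g * v) := by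
      rw [hε, hη]; push_cast; field_simp
    have h3 : |(m : ℝ)| < X + 1 := by
      rw [← h2]
      calc _ < (g * u * v : ℝ) * (ε + η) := by gcongr
        _ ≤ _ := by rw [e2]; exact hX
    have h4 : m.natAbs ≤ X := by
      have : |m| < X + 1 := by exact_mod_cast h3
      rw [Int.abs_eq_natAbs] at this
      omega
    have hndvd : ∀ p ∈ (u * v).primeFactors, ¬p ∣ m.natAbs := fun p hp hd =>
      coprime_offset ha' hb' huv hm (Nat.prime_of_mem_primeFactors hp)
        (Nat.dvd_of_mem_primeFactors hp) (Int.natCast_dvd.2 hd)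
    have hm0 : m.natAbs ≠ 0 := by
      intro h0
      obtain ⟨p, hp, hpd⟩ := Nat.exists_prime_and_dvd h1
      exact hndvd p ((Nat.mem_primeFactors_of_ne_zero (by positivity)).2 ⟨hp, hpd⟩)
        (h0 ▸ dvd_zero p)
    have hmem : (a, b) ∈ numPairs g u v m := by
      simp only [numPairs, Finset.mem_filter, Finset.mem_product]
      refine ⟨⟨ha, hb⟩, ha'.symm, hb'.symm, ⟨round s, ?_⟩⟩
      rw [hm]; push_cast; ring
    rw [Finset.mem_biUnion]
    refine ⟨m.natAbs, Finset.mem_filter.2 ⟨Finset.mem_Ioc.2 ⟨Nat.pos_of_ne_zero hm0, h4⟩, hndvd⟩,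
      Finset.mem_union.2 ?_⟩
    rcases Int.natAbs_eq m with h | h
    · left; rwa [← h]
    · right; rwa [← h]
  have hKcard : (K.card : ℝ) ≤
      ∑ n ∈ F, (((numPairs g u v n).card : ℝ) + (numPairs g u v (-n)).card) := by
    have h2 : K.card ≤ ∑ n ∈ F, ((numPairs g u v n).card + (numPairs g u v (-n)).card) :=
      (Finset.card_le_card hKsub).trans (Finset.card_biUnion_le.trans
        (Finset.sum_le_sum fun n _ => Finset.card_union_le _ _))
    exact_mod_cast h2
  have hcover : approxSet ψ (g * u) ∩ approxSet ψ (g * v) ⊆ ⋃ x ∈ K,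
      (Metric.ball (((x.1 : ℝ) / (g * u : ℕ) : ℝ) : UnitAddCircle) ε ∩
        Metric.ball (((x.2 : ℝ) / (g * v : ℕ) : ℝ) : UnitAddCircle) η) := by
    rw [approxSet_eq hq, approxSet_eq hr]
    rintro y ⟨hy1, hy2⟩
    simp only [Set.mem_iUnion] at hy1 hy2
    obtain ⟨a, ha, hya⟩ := hy1
    obtain ⟨b, hb, hyb⟩ := hy2
    simp only [Set.mem_iUnion]
    refine ⟨(a, b), Finset.mem_filter.2 ⟨Finset.mem_product.2 ⟨ha, hb⟩, ?_⟩, hya, hyb⟩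
    have h2 := dist_triangle_left (((a : ℝ) / (g * u : ℕ) : ℝ) : UnitAddCircle)
      (((b : ℝ) / (g * v : ℕ) : ℝ) : UnitAddCircle) y
    rw [Metric.mem_ball] at hya hyb
    exact h2.trans_lt (add_lt_add hya hyb)
  have hterm : ∀ x ∈ K, volume.real
      (Metric.ball (((x.1 : ℝ) / (g * u : ℕ) : ℝ) : UnitAddCircle) ε ∩
        Metric.ball (((x.2 : ℝ) / (g * v : ℕ) : ℝ) : UnitAddCircle) η) ≤ 2 * min ε η := by
    intro x _
    rw [mul_min_of_nonneg _ _ (by norm_num)]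
    refine le_min ?_ ?_
    · rw [← measureReal_ball hε0 (div_natCast_le_half hq (hψ1 _))]
      exact measureReal_mono Set.inter_subset_left
    · rw [← measureReal_ball hη0 (div_natCast_le_half hr (hψ1 _))]
      exact measureReal_mono Set.inter_subset_right
  calc _ ≤ _ := measureReal_mono hcover (measure_ne_top _ _)
    _ ≤ _ := measureReal_biUnion_finset_le _ _
    _ ≤ K.card • (2 * min ε η) := Finset.sum_le_card_nsmul _ _ _ hterm
    _ = 2 * min ε η * K.card := by rw [nsmul_eq_mul, mul_comm]
    _ ≤ _ := mul_le_mul_of_nonneg_left hKcard (by positivity)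

open Classical in
lemma measureReal_inter_le {ψ : ℕ → ℝ} (hψ0 : ∀ q, 0 ≤ ψ q) (hψ1 : ∀ q, ψ q ≤ 1 / 2)
    {g u v : ℕ} (hg : 0 < g) (hu : 0 < u) (hv : 0 < v) (huv : u.Coprime v) (h1 : u * v ≠ 1)
    {X z : ℕ} (hX1 : 1 ≤ X) (hz : 16 ^ z ≤ X) (hX : v * ψ (g * u) + u * ψ (g * v) ≤ X + 1)
    (hX2 : (X : ℝ) ≤ 2 * max (v * ψ (g * u)) (u * ψ (g * v))) :
    volume.real (approxSet ψ (g * u) ∩ approxSet ψ (g * v)) ≤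
      32 * Real.exp 4 * ((ψ (g * u) * phiDensity (g * u)) * (ψ (g * v) * phiDensity (g * v))) *
        Real.exp (∑ p ∈ (u * v).primeFactors.filter (z < ·), (p : ℝ)⁻¹) := by
  have hgR : (0 : ℝ) < g := by exact_mod_cast hg
  have huR : (0 : ℝ) < u := by exact_mod_cast hu
  have hvR : (0 : ℝ) < v := by exact_mod_cast hv
  have huv0 : u * v ≠ 0 := by positivity
  have hmain := measureReal_inter_le_count hψ0 hψ1 hg hu hv huv h1 hX
  set F := (Finset.Ioc 0 X).filter (fun n => ∀ p ∈ (u * v).primeFactors, ¬p ∣ n) with hF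
  set Z := (u * v).primeFactors.filter (fun p => ¬z < p) with hZ
  set W := (u * v).primeFactors.filter (z < ·) with hW
  set s := ∑ p ∈ W, (p : ℝ)⁻¹
  set fq := phiDensity (g * u)
  set fr := phiDensity (g * v)
  have hfq : 0 ≤ fq := phiDensity_nonneg _
  have hfr : 0 ≤ fr := phiDensity_nonneg _
  have hprime : ∀ p ∈ (u * v).primeFactors, p.Prime := fun p hp => Nat.prime_of_mem_primeFactors hp
  have hZp : ∀ p ∈ Z, p.Prime := fun p hp => hprime p (Finset.mem_filter.1 hp).1
  have hZprod : (∏ p ∈ Z, p) ^ 2 ≤ X := by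
    have h2 : ∏ p ∈ Z, p ≤ primorial z := by
      refine Finset.prod_le_prod_of_subset_of_one_le' ?_ ?_
      · intro p hp
        have := (Finset.mem_filter.1 hp).2
        exact Finset.mem_filter.2 ⟨Finset.mem_range.2 (by omega), hZp p hp⟩
      · intro p hp _
        exact (Finset.mem_filter.1 hp).2.one_lt.le
    calc _ ≤ (4 ^ z) ^ 2 := Nat.pow_le_pow_left (h2.trans (primorial_le_four_pow z)) 2
      _ = 16 ^ z := by rw [← pow_mul, mul_comm, pow_mul]; norm_num
      _ ≤ X := hz
  have hsieve := sum_inv_phiDensity_le hZp hX1 hZprod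
  set FZ := ∏ p ∈ Z, (1 - (p : ℝ)⁻¹)
  set FW := ∏ p ∈ W, (1 - (p : ℝ)⁻¹)
  have hFW : Real.exp (-s - 2) ≤ FW := exp_le_prod_one_sub_inv W fun p hp =>
    (hprime p (Finset.mem_filter.1 hp).1).two_le
  have hsplit : phiDensity (u * v) = FW * FZ := by
    rw [phiDensity_eq_prod huv0, ← Finset.prod_filter_mul_prod_filter_not _ (z < ·)]
  have hFZ : 0 < FZ := Finset.prod_pos fun p hp => by
    have := inv_lt_one_of_one_lt₀ (Nat.one_lt_cast (α := ℝ).2 (hZp p hp).one_lt)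
    linarith
  set S := ∑ n ∈ F, (((numPairs g u v n).card : ℝ) + (numPairs g u v (-n)).card)
  have hS0 : 0 ≤ S := Finset.sum_nonneg fun _ _ => by positivity
  have hS1 : S * (FW * FZ) ≤ (2 * g * (fq * fr)) * (4 * Real.exp 2 * (X * FZ)) := by
    calc S * (FW * FZ) ≤ ∑ n ∈ F, (2 * g * (fq * fr)) * (phiDensity n)⁻¹ := by
          rw [← hsplit, Finset.sum_mul]
          refine Finset.sum_le_sum fun n hn => ?_
          have hn0 : (n : ℤ) ≠ 0 := by
            have := (Finset.mem_Ioc.1 (Finset.mem_filter.1 hn).1).1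
            omega
          have e1 := card_numPairs_le hg hu hv huv hn0
          have e2 := card_numPairs_le hg hu hv huv (neg_ne_zero.2 hn0)
          rw [Int.natAbs_natCast] at e1
          rw [Int.natAbs_neg, Int.natAbs_natCast] at e2
          rw [add_mul]
          linarith
      _ = (2 * g * (fq * fr)) * ∑ n ∈ F, (phiDensity n)⁻¹ := by rw [Finset.mul_sum]
      _ ≤ (2 * g * (fq * fr)) *
          ∑ n ∈ (Finset.Ioc 0 X).filter (fun m => ∀ p ∈ Z, ¬p ∣ m), (phiDensity n)⁻¹ := by
          refine mul_le_mul_of_nonneg_left ?_ (by positivity)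
          refine Finset.sum_le_sum_of_subset_of_nonneg ?_
            fun n _ _ => inv_nonneg.2 (phiDensity_nonneg n)
          intro n hn
          rw [Finset.mem_filter] at hn ⊢
          exact ⟨hn.1, fun p hp => hn.2 p (Finset.mem_filter.1 hp).1⟩
      _ ≤ _ := mul_le_mul_of_nonneg_left (le_of_eq_of_le (by congr!) hsieve) (by positivity)
  have hS2 : S * FW ≤ (2 * g * (fq * fr)) * (4 * Real.exp 2 * X) := by
    refine le_of_mul_le_mul_right ?_ hFZ
    linarith
  have hS3 : S ≤ 8 * Real.exp 4 * (fq * fr) * (g * X) * Real.exp s := by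
    have h2 : S * Real.exp (-s - 2) ≤ (2 * g * (fq * fr)) * (4 * Real.exp 2 * X) :=
      (mul_le_mul_of_nonneg_left hFW hS0).trans hS2
    have e1 : Real.exp (-s - 2) * Real.exp (s + 2) = 1 := by
      rw [← Real.exp_add]; simp
    have e2 : Real.exp (s + 2) = Real.exp s * Real.exp 2 := Real.exp_add _ _
    have e3 : Real.exp 4 = Real.exp 2 * Real.exp 2 := by rw [← Real.exp_add]; norm_num
    calc S = S * Real.exp (-s - 2) * Real.exp (s + 2) := by rw [mul_assoc, e1, mul_one]
      _ ≤ (2 * g * (fq * fr)) * (4 * Real.exp 2 * X) * Real.exp (s + 2) := by gcongr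
      _ = _ := by rw [e2, e3]; ring
  set A := ψ (g * u)
  set B := ψ (g * v)
  have hA : 0 ≤ A := hψ0 _
  have hB : 0 ≤ B := hψ0 _
  have hmin : min (A / (g * u : ℕ)) (B / (g * v : ℕ)) = min (v * A) (u * B) / (g * u * v) := by
    rw [← min_div_div_right (by positivity)]
    congr 1 <;> push_cast <;> field_simp
  have hm0 : 0 ≤ min (v * A) (u * B) := le_min (by positivity) (by positivity)
  have hfin : min (A / (g * u : ℕ)) (B / (g * v : ℕ)) * (g * X) ≤ 2 * (A * B) := by
    rw [hmin]
    calc _ ≤ min (v * A) (u * B) / (g * u * v) * (g * (2 * max (v * A) (u * B))) := by gcongr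
      _ = 2 * (min (v * A) (u * B) * max (v * A) (u * B)) / (u * v) := by field_simp
      _ = _ := by rw [min_mul_max]; field_simp
  have hmn0 : 0 ≤ min (A / (g * u : ℕ)) (B / (g * v : ℕ)) := le_min (by positivity) (by positivity)
  calc _ ≤ _ := hmain
    _ ≤ 2 * min (A / (g * u : ℕ)) (B / (g * v : ℕ)) *
        (8 * Real.exp 4 * (fq * fr) * (g * X) * Real.exp s) := by gcongr
    _ = 16 * Real.exp 4 * (fq * fr) * Real.exp s *
        (min (A / (g * u : ℕ)) (B / (g * v : ℕ)) * (g * X)) := by ring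
    _ ≤ 16 * Real.exp 4 * (fq * fr) * Real.exp s * (2 * (A * B)) := by gcongr
    _ = _ := by ring

/-- Approximation sets whose denominators are far apart relative to their radii are disjoint. -/
lemma measureReal_inter_eq_zero {ψ : ℕ → ℝ} (hψ0 : ∀ q, 0 ≤ ψ q) (hψ1 : ∀ q, ψ q ≤ 1 / 2)
    {g u v : ℕ} (hg : 0 < g) (hu : 0 < u) (hv : 0 < v) (huv : u.Coprime v) (h1 : u * v ≠ 1)
    (hX : v * ψ (g * u) + u * ψ (g * v) ≤ 1) :
    volume.real (approxSet ψ (g * u) ∩ approxSet ψ (g * v)) = 0 := by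
  refine le_antisymm ?_ measureReal_nonneg
  simpa using measureReal_inter_le_count hψ0 hψ1 hg hu hv huv h1 (X := 0) (by simpa using hX)

lemma factorization_div_gcd {q r : ℕ} (hq : q ≠ 0) (hr : r ≠ 0) (p : ℕ) :
    (q / q.gcd r).factorization p = q.factorization p - r.factorization p := by
  rw [Nat.factorization_div (Nat.gcd_dvd_left q r), Nat.factorization_gcd hq hr]
  simp only [Finsupp.coe_tsub, Pi.sub_apply, Finsupp.inf_apply]
  omega

lemma coRatio_eq {T : Finset ℕ} {q r : ℕ} (hq : q ≠ 0) (hr : r ≠ 0) (hT : r.primeFactors ⊆ T) :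
    coRatio T q r = r / q.gcd r := by
  have h0 : r / q.gcd r ≠ 0 := (Nat.div_pos (Nat.le_of_dvd (Nat.pos_of_ne_zero hr)
    (Nat.gcd_dvd_right q r)) (Nat.gcd_pos_of_pos_left _ (Nat.pos_of_ne_zero hq))).ne'
  conv_rhs => rw [← Nat.prod_factorization_pow_eq_self h0]
  rw [Finsupp.prod_of_support_subset (s := T)]
  · refine Finset.prod_congr rfl fun p _ => ?_
    rw [Nat.gcd_comm, factorization_div_gcd hr hq]
  · rw [Nat.support_factorization]
    exact (Nat.primeFactors_mono (Nat.div_dvd_of_dvd (Nat.gcd_dvd_right q r)) hr).trans hT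
  · simp

lemma primeFactors_ratio {T : Finset ℕ} {q r : ℕ} (hq : q ≠ 0) (hr : r ≠ 0)
    (hqT : q.primeFactors ⊆ T) (hrT : r.primeFactors ⊆ T) :
    (q / q.gcd r * (r / q.gcd r)).primeFactors =
      T.filter fun p => q.factorization p ≠ r.factorization p := by
  have hg := Nat.gcd_pos_of_pos_left r (Nat.pos_of_ne_zero hq)
  have hu : q / q.gcd r ≠ 0 := (Nat.div_pos (Nat.le_of_dvd (Nat.pos_of_ne_zero hq)
    (Nat.gcd_dvd_left q r)) hg).ne'
  have hv : r / q.gcd r ≠ 0 := (Nat.div_pos (Nat.le_of_dvd (Nat.pos_of_ne_zero hr)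
    (Nat.gcd_dvd_right q r)) hg).ne'
  ext p
  rw [← Nat.support_factorization, Finsupp.mem_support_iff, Nat.factorization_mul hu hv,
    Finsupp.add_apply, factorization_div_gcd hq hr, Nat.gcd_comm, factorization_div_gcd hr hq,
    Finset.mem_filter]
  constructor
  · intro h
    refine ⟨?_, by omega⟩
    by_cases h1 : q.factorization p = 0
    · exact hrT (by rw [← Nat.support_factorization, Finsupp.mem_support_iff]; omega)
    · exact hqT (by rwa [← Nat.support_factorization, Finsupp.mem_support_iff])
  · rintro ⟨_, h⟩
    omega

lemma exp_sum_inv_le {P : Finset ℕ} (hP : ∀ p ∈ P, p.Prime) {z y : ℕ} (hzy : z < y)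
    (hs : ∑ p ∈ P.filter (y ^ 20 < ·), (p : ℝ)⁻¹ < 1) :
    Real.exp (∑ p ∈ P.filter (z < ·), (p : ℝ)⁻¹) ≤ 20 * Real.exp 5 * y + Real.exp 1 := by
  rcases Nat.lt_or_ge y 2 with hy | hy
  · have e : P.filter (z < ·) = P.filter (y ^ 20 < ·) := by
      refine Finset.filter_congr fun p hp => ?_
      have := (hP p hp).two_le
      obtain rfl : z = 0 := by omega
      obtain rfl : y = 1 := by omega
      omega
    rw [e]
    have := Real.exp_le_exp.2 hs.le
    have h2 : 0 ≤ 20 * Real.exp 5 * y := by positivity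
    linarith
  · have h20 : 2 ≤ y ^ 20 := hy.trans (Nat.le_self_pow (by norm_num) y)
    have hsub : P.filter (z < ·) ⊆ P.filter (y ^ 20 < ·) ∪ primesTo (y ^ 20) := by
      intro p hp
      rw [Finset.mem_filter] at hp
      rw [Finset.mem_union, Finset.mem_filter, mem_primesTo]
      rcases Nat.lt_or_ge (y ^ 20) p with h | h
      · exact Or.inl ⟨hp.1, h⟩
      · exact Or.inr ⟨h, hP p hp.1⟩
    have hle : ∑ p ∈ P.filter (z < ·), (p : ℝ)⁻¹ ≤
        1 + (Real.log (Real.log ((y ^ 20 : ℕ) : ℝ)) + 4) := by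
      calc _ ≤ ∑ p ∈ P.filter (y ^ 20 < ·) ∪ primesTo (y ^ 20), (p : ℝ)⁻¹ :=
            Finset.sum_le_sum_of_subset_of_nonneg hsub fun _ _ _ => by positivity
        _ ≤ ∑ p ∈ P.filter (y ^ 20 < ·), (p : ℝ)⁻¹ + ∑ p ∈ primesTo (y ^ 20), (p : ℝ)⁻¹ := by
            rw [← Finset.sum_union_inter]
            exact le_add_of_nonneg_right (Finset.sum_nonneg fun _ _ => by positivity)
        _ ≤ _ := add_le_add hs.le (sum_inv_primes_le h20)
    have hy1 : (1 : ℝ) < y := by exact_mod_cast hy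
    have hlog : 0 < Real.log y := Real.log_pos hy1
    have hly : Real.log y ≤ y := (Real.log_le_sub_one_of_pos (by linarith)).trans (by linarith)
    calc _ ≤ Real.exp (1 + (Real.log (Real.log ((y ^ 20 : ℕ) : ℝ)) + 4)) := Real.exp_le_exp.2 hle
      _ = Real.exp 5 * (20 * Real.log y) := by
          rw [show (1 + (Real.log (Real.log ((y ^ 20 : ℕ) : ℝ)) + 4)) =
            5 + Real.log (Real.log ((y ^ 20 : ℕ) : ℝ)) by ring, Real.exp_add, Nat.cast_pow,
            Real.log_pow, Real.exp_log (by push_cast; positivity)]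
          push_cast; ring
      _ ≤ Real.exp 5 * (20 * y) := by gcongr
      _ ≤ _ := by linarith [Real.exp_pos 1]

lemma exp_sum_inv_le_const {P : Finset ℕ} (hP : ∀ p ∈ P, p.Prime) {z : ℕ}
    (hs : ∑ p ∈ P.filter ((z + 1) ^ 20 < ·), (p : ℝ)⁻¹ < 1) :
    Real.exp (∑ p ∈ P.filter (z < ·), (p : ℝ)⁻¹) ≤ Real.exp 23 := by
  refine Real.exp_le_exp.2 ?_
  rcases Nat.eq_zero_or_pos z with rfl | hz
  · have e : P.filter (0 < ·) = P.filter ((0 + 1) ^ 20 < ·) := by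
      refine Finset.filter_congr fun p hp => ?_
      have := (hP p hp).two_le
      omega
    rw [e]
    linarith
  · have hsub : P.filter (z < ·) ⊆
        P.filter ((z + 1) ^ 20 < ·) ∪ (primesTo ((z + 1) ^ 20)).filter (z < ·) := by
      intro p hp
      rw [Finset.mem_filter] at hp
      rw [Finset.mem_union, Finset.mem_filter, Finset.mem_filter, mem_primesTo]
      rcases Nat.lt_or_ge ((z + 1) ^ 20) p with h | h
      · exact Or.inl ⟨hp.1, h⟩
      · exact Or.inr ⟨⟨h, hP p hp.1⟩, hp.2⟩
    calc _ ≤ ∑ p ∈ P.filter ((z + 1) ^ 20 < ·) ∪ (primesTo ((z + 1) ^ 20)).filter (z < ·),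
          (p : ℝ)⁻¹ :=
          Finset.sum_le_sum_of_subset_of_nonneg hsub fun _ _ _ => by positivity
      _ ≤ ∑ p ∈ P.filter ((z + 1) ^ 20 < ·), (p : ℝ)⁻¹ +
          ∑ p ∈ (primesTo ((z + 1) ^ 20)).filter (z < ·), (p : ℝ)⁻¹ := by
          rw [← Finset.sum_union_inter]
          exact le_add_of_nonneg_right (Finset.sum_nonneg fun _ _ => by positivity)
      _ ≤ 23 := by linarith [sum_inv_primes_between_le hz]

open Classical in
/-- The overlap of two approximation sets, in terms of the scales at which the pair is bad. -/
lemma measureReal_inter_le_sum_badPair {ψ : ℕ → ℝ} (hψ0 : ∀ q, 0 ≤ ψ q)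
    (hψ1 : ∀ q, ψ q ≤ 1 / 2) {T : Finset ℕ} {L : ℕ} (hL : ∀ p ∈ T, p ≤ L)
    {q r : ℕ} (hq : q ≠ 0) (hr : r ≠ 0) (hqr : q ≠ r)
    (hqT : q.primeFactors ⊆ T) (hrT : r.primeFactors ⊆ T) :
    volume.real (approxSet ψ q ∩ approxSet ψ r) ≤
      32 * Real.exp 4 * ((ψ q * phiDensity q) * (ψ r * phiDensity r)) *
        (Real.exp 23 + ∑ t ∈ Finset.Ioc 0 L,
          if BadPair T ψ (16 ^ t) (t ^ 20) q r then (20 * Real.exp 5 + Real.exp 1) * ((t : ℝ) + 1)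
          else 0) := by
  set R := ∑ t ∈ Finset.Ioc 0 L,
    if BadPair T ψ (16 ^ t) (t ^ 20) q r then (20 * Real.exp 5 + Real.exp 1) * ((t : ℝ) + 1) else 0
    with hR
  have hR0 : 0 ≤ R := Finset.sum_nonneg fun t _ => by split_ifs <;> positivity
  have hpref : 0 ≤ 32 * Real.exp 4 * ((ψ q * phiDensity q) * (ψ r * phiDensity r)) := by
    have := phiDensity_nonneg q
    have := phiDensity_nonneg r
    have := hψ0 q
    have := hψ0 r
    positivity
  set g := q.gcd r with hg
  set u := q / g with hu
  set v := r / g with hv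
  have hg0 : 0 < g := Nat.gcd_pos_of_pos_left r (Nat.pos_of_ne_zero hq)
  have hgu : g * u = q := Nat.mul_div_cancel' (Nat.gcd_dvd_left q r)
  have hgv : g * v = r := Nat.mul_div_cancel' (Nat.gcd_dvd_right q r)
  have hu0 : 0 < u := Nat.pos_of_ne_zero fun h => hq (by rw [← hgu, h, mul_zero])
  have hv0 : 0 < v := Nat.pos_of_ne_zero fun h => hr (by rw [← hgv, h, mul_zero])
  have huv : u.Coprime v := Nat.coprime_div_gcd_div_gcd hg0
  have huv1 : u * v ≠ 1 := fun h => hqr (by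
    rw [← hgu, ← hgv, Nat.eq_one_of_mul_eq_one_right h, Nat.eq_one_of_mul_eq_one_left h])
  have hcv : coRatio T q r = v := coRatio_eq hq hr hrT
  have hcu : coRatio T r q = u := by rw [coRatio_eq hr hq hqT, Nat.gcd_comm]
  set P := (u * v).primeFactors with hP
  have hPT : P = T.filter fun p => q.factorization p ≠ r.factorization p :=
    primeFactors_ratio hq hr hqT hrT
  have hPp : ∀ p ∈ P, p.Prime := fun p hp => Nat.prime_of_mem_primeFactors hp
  have hPf : ∀ y, P.filter (y < ·) =
      T.filter fun p => y < p ∧ q.factorization p ≠ r.factorization p := fun y => by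
    rw [hPT, Finset.filter_filter]
    exact Finset.filter_congr fun _ _ => and_comm
  set D := max (v * ψ q) (u * ψ r) with hD
  have hDv : v * ψ q ≤ D := le_max_left _ _
  have hDu : u * ψ r ≤ D := le_max_right _ _
  rcases Nat.eq_zero_or_pos ⌊2 * D⌋₊ with hX0 | hX1
  · have h2 : 2 * D < 1 := Nat.floor_eq_zero.1 hX0
    have := measureReal_inter_eq_zero hψ0 hψ1 hg0 hu0 hv0 huv huv1
      (by rw [hgu, hgv]; linarith)
    rw [hgu, hgv] at this
    rw [this]
    positivity
  set X := ⌊2 * D⌋₊ with hX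
  have hD0 : 0 ≤ 2 * D := by
    have := hψ0 q
    have : (0 : ℝ) ≤ v * ψ q := by positivity
    linarith
  have hXle : (X : ℝ) ≤ 2 * D := Nat.floor_le hD0
  have hXlt : 2 * D < X + 1 := Nat.lt_floor_add_one _
  obtain ⟨z, hz⟩ : ∃ z, z = Nat.log 16 X := ⟨_, rfl⟩
  have hz1 : 16 ^ z ≤ X := hz ▸ Nat.pow_log_le_self 16 (by omega)
  have hz2 : X < 16 ^ (z + 1) := hz ▸ Nat.lt_pow_succ_log_self (by norm_num) X
  have hmain := measureReal_inter_le hψ0 hψ1 hg0 hu0 hv0 huv huv1 hX1 hz1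
    (by rw [hgu, hgv]; linarith) (by rw [hgu, hgv]; exact hXle)
  rw [hgu, hgv] at hmain
  refine hmain.trans (mul_le_mul_of_nonneg_left ?_ hpref)
  by_cases hs : ∑ p ∈ P.filter ((z + 1) ^ 20 < ·), (p : ℝ)⁻¹ < 1
  · exact (exp_sum_inv_le_const hPp hs).trans (le_add_of_nonneg_right hR0)
  · let Q : ℕ → Prop := fun t => 1 ≤ ∑ p ∈ P.filter (t ^ 20 < ·), (p : ℝ)⁻¹
    have hQL : ∀ t, Q t → t ≤ L := by
      intro t ht
      have hne : (P.filter (t ^ 20 < ·)).Nonempty := by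
        rw [Finset.nonempty_iff_ne_empty]
        intro h
        simp only [Q, h, Finset.sum_empty] at ht
        linarith
      obtain ⟨p, hp⟩ := hne
      rw [Finset.mem_filter] at hp
      have hpT : p ∈ T := by rw [hPT] at hp; exact (Finset.mem_filter.1 hp.1).1
      have := hL p hpT
      have := Nat.le_self_pow (show 20 ≠ 0 by norm_num) t
      omega
    have hQz : Q (z + 1) := not_lt.1 hs
    set t := Nat.findGreatest Q L with ht
    have hQt : Q t := Nat.findGreatest_spec (hQL _ hQz) hQz
    have hzt : z + 1 ≤ t := Nat.le_findGreatest (hQL _ hQz) hQz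
    have hQt1 : ¬Q (t + 1) := fun h =>
      Nat.findGreatest_is_greatest (Nat.lt_succ_self _) (hQL _ h) h
    have hbad : BadPair T ψ (16 ^ t) (t ^ 20) q r := by
      have hDt : D ≤ (16 : ℝ) ^ t := by
        have h1 : ((X : ℝ) + 1) ≤ 16 ^ (z + 1) := by exact_mod_cast hz2
        have h2 : (16 : ℝ) ^ (z + 1) ≤ 16 ^ t := pow_le_pow_right₀ (by norm_num) hzt
        linarith
      refine ⟨?_, ?_, ?_⟩
      · rw [hcv, mul_comm]; exact hDv.trans (by exact_mod_cast hDt)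
      · rw [hcu, mul_comm]; exact hDu.trans (by exact_mod_cast hDt)
      · have := hQt
        simp only [Q, hPf] at this
        exact this.trans (le_of_eq (by congr!))
    have hterm : (20 * Real.exp 5 + Real.exp 1) * ((t : ℝ) + 1) ≤ R := by
      have hmem : t ∈ Finset.Ioc 0 L := Finset.mem_Ioc.2 ⟨by omega, hQL t hQt⟩
      refine le_trans (le_of_eq ?_) (Finset.single_le_sum (f := fun t : ℕ =>
        if BadPair T ψ (16 ^ t) (t ^ 20) q r then
          (20 * Real.exp 5 + Real.exp 1) * ((t : ℝ) + 1) else 0)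
        (fun t _ => by split_ifs <;> positivity) hmem)
      exact (if_pos hbad).symm
    have hfin := exp_sum_inv_le hPp (show z < t + 1 by omega) (not_le.1 hQt1)
    push_cast at hfin
    have h1 : Real.exp 1 ≤ Real.exp 1 * ((t : ℝ) + 1) :=
      le_mul_of_one_le_right (Real.exp_pos 1).le (by linarith [(Nat.cast_nonneg t : (0 : ℝ) ≤ t)])
    have := Real.exp_pos 23
    linarith

open Classical in
lemma exists_sum_inter_le : ∃ C : ℝ, 0 ≤ C ∧ ∀ (ψ : ℕ → ℝ) (S : Finset ℕ),
    (∀ q, 0 ≤ ψ q) → (∀ q, ψ q ≤ 1 / 2) → (∀ q ∈ S, q ≠ 0) →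
    mass (fun q => ψ q * phiDensity q) S ≤ 1 →
    ∑ q ∈ S, ∑ r ∈ S, (if q ≠ r then volume.real (approxSet ψ q ∩ approxSet ψ r) else 0) ≤ C := by
  obtain ⟨C, hC0, hC⟩ := exists_edgeMass_badPair_le
  set K := 20 * Real.exp 5 + Real.exp 1 with hK
  have hK0 : 0 < K := by positivity
  refine ⟨32 * Real.exp 4 * (Real.exp 23 + 4 * (K * C)), by positivity,
    fun ψ S hψ0 hψ1 hS hmass => ?_⟩
  set lam : ℕ → ℝ := fun q => ψ q * phiDensity q with hlam
  have hlam0 : ∀ q, 0 ≤ lam q := fun q => mul_nonneg (hψ0 q) (phiDensity_nonneg q)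
  set T := S.biUnion Nat.primeFactors with hT
  set L := T.sup id with hL
  have hTp : ∀ p ∈ T, p.Prime := fun p hp => by
    obtain ⟨q, _, hq⟩ := Finset.mem_biUnion.1 hp
    exact Nat.prime_of_mem_primeFactors hq
  have hTL : ∀ p ∈ T, p ≤ L := fun p hp => Finset.le_sup (f := id) hp
  have hST : ∀ q ∈ S, q.primeFactors ⊆ T := fun q hq => Finset.subset_biUnion_of_mem _ hq
  have hpair : ∀ q ∈ S, ∀ r ∈ S,
      (if q ≠ r then volume.real (approxSet ψ q ∩ approxSet ψ r) else 0) ≤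
        32 * Real.exp 4 * (Real.exp 23 * (lam q * lam r) + ∑ t ∈ Finset.Ioc 0 L,
          K * ((t : ℝ) + 1) *
            if BadPair T ψ (16 ^ t) (t ^ 20) q r then lam q * lam r else 0) := by
    intro q hq r hr
    have hqr0 : 0 ≤ lam q * lam r := mul_nonneg (hlam0 q) (hlam0 r)
    split_ifs with h
    · refine (measureReal_inter_le_sum_badPair hψ0 hψ1 hTL (hS q hq) (hS r hr) h
        (hST q hq) (hST r hr)).trans (le_of_eq ?_)
      rw [mul_assoc, mul_add, Finset.mul_sum]
      congr 2
      · ring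
      · refine Finset.sum_congr rfl fun t _ => ?_
        split_ifs
        · ring
        · rw [mul_zero, mul_zero]
    · have : 0 ≤ ∑ t ∈ Finset.Ioc 0 L, K * ((t : ℝ) + 1) *
            (if BadPair T ψ (16 ^ t) (t ^ 20) q r then lam q * lam r else 0) :=
        Finset.sum_nonneg fun t _ => mul_nonneg (by positivity) (by split_ifs <;> positivity)
      positivity
  have hmass0 : 0 ≤ mass lam S := mass_nonneg hlam0 S
  have hsq : ∑ t ∈ Finset.Ioc 0 L, ((t : ℝ)⁻¹) ^ 2 ≤ 2 := by
    have hsub : Finset.Ioc 0 L ⊆ insert 1 (Finset.Ioc 1 L) := by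
      intro t ht
      simp only [Finset.mem_insert, Finset.mem_Ioc] at ht ⊢
      omega
    refine (Finset.sum_le_sum_of_subset_of_nonneg hsub fun _ _ _ => by positivity).trans ?_
    rw [Finset.sum_insert (by simp)]
    have := sum_inv_sq_le (Finset.Ioc 1 L) fun p hp => (Finset.mem_Ioc.1 hp).1
    norm_num
    norm_num at this
    linarith
  calc _ ≤ ∑ q ∈ S, ∑ r ∈ S, 32 * Real.exp 4 * (Real.exp 23 * (lam q * lam r) +
        ∑ t ∈ Finset.Ioc 0 L, K * ((t : ℝ) + 1) *
            if BadPair T ψ (16 ^ t) (t ^ 20) q r then lam q * lam r else 0) :=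
        Finset.sum_le_sum fun q hq => Finset.sum_le_sum fun r hr => hpair q hq r hr
    _ = 32 * Real.exp 4 * (Real.exp 23 * (mass lam S * mass lam S) +
        ∑ t ∈ Finset.Ioc 0 L, K * ((t : ℝ) + 1) *
          edgeMass lam (BadPair T ψ (16 ^ t) (t ^ 20)) S S) := by
        simp only [← Finset.mul_sum, Finset.sum_add_distrib, mass, edgeMass,
          Finset.sum_mul_sum]
        congr 2
        rw [Finset.sum_congr rfl fun q _ => Finset.sum_comm, Finset.sum_comm]
        simp only [Finset.mul_sum]
    _ ≤ 32 * Real.exp 4 * (Real.exp 23 * (1 * 1) +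
        ∑ t ∈ Finset.Ioc 0 L, 2 * (K * C) * ((t : ℝ)⁻¹) ^ 2) := by
        refine mul_le_mul_of_nonneg_left (add_le_add (mul_le_mul_of_nonneg_left
          (mul_le_mul hmass hmass hmass0 zero_le_one) (Real.exp_pos _).le)
          (Finset.sum_le_sum fun t ht => ?_)) (by positivity)
        have ht1 : 1 ≤ t := (Finset.mem_Ioc.1 ht).1
        have ht1R : (1 : ℝ) ≤ t := by exact_mod_cast ht1
        have h : edgeMass lam (BadPair T ψ (16 ^ t) (t ^ 20)) S S ≤ C / (t : ℝ) ^ 3 :=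
          hC t ht1 S T ψ hψ0 hTp (fun q hq => ⟨hS q hq, hST q hq⟩) hmass
        calc _ ≤ K * ((t : ℝ) + 1) * (C / (t : ℝ) ^ 3) :=
              mul_le_mul_of_nonneg_left h (by positivity)
          _ ≤ K * (2 * t) * (C / (t : ℝ) ^ 3) := by
              gcongr
              linarith
          _ = _ := by
              field_simp
    _ ≤ _ := by
        rw [← Finset.mul_sum]
        have := mul_le_mul_of_nonneg_left hsq (show 0 ≤ 2 * (K * C) by positivity)
        refine mul_le_mul_of_nonneg_left ?_ (by positivity)
        linarith

/-- A second-moment lower bound for the measure of a union. -/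
lemma le_measureReal_biUnion {Ω : Type*} [MeasurableSpace Ω] (μ : Measure Ω) [IsFiniteMeasure μ]
    (A : ℕ → Set Ω) (S : Finset ℕ) (hA : ∀ q ∈ S, MeasurableSet (A q)) (c : ℝ) :
    2 * c * ∑ q ∈ S, μ.real (A q) - c ^ 2 * ∑ q ∈ S, ∑ r ∈ S, μ.real (A q ∩ A r) ≤
      μ.real (⋃ q ∈ S, A q) := by
  set U := ⋃ q ∈ S, A q with hU
  have hUm : MeasurableSet U := Finset.measurableSet_biUnion _ hA
  have hindic : ∀ {B : Set Ω}, MeasurableSet B → Integrable (B.indicator (1 : Ω → ℝ)) μ :=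
    fun hB => (integrable_const (1 : ℝ)).indicator hB
  have e1 : ∑ q ∈ S, μ.real (A q) = ∫ x, ∑ q ∈ S, (A q).indicator (1 : Ω → ℝ) x ∂μ := by
    rw [integral_finsetSum _ fun q hq => hindic (hA q hq)]
    exact Finset.sum_congr rfl fun q hq => (integral_indicator_one (hA q hq)).symm
  have e2 : ∑ q ∈ S, ∑ r ∈ S, μ.real (A q ∩ A r) =
      ∫ x, ∑ q ∈ S, ∑ r ∈ S, (A q ∩ A r).indicator (1 : Ω → ℝ) x ∂μ := by
    rw [integral_finsetSum _ fun q hq => integrable_finsetSum _ fun r hr =>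
      hindic ((hA q hq).inter (hA r hr))]
    refine Finset.sum_congr rfl fun q hq => ?_
    rw [integral_finsetSum _ fun r hr => hindic ((hA q hq).inter (hA r hr))]
    exact Finset.sum_congr rfl fun r hr =>
      (integral_indicator_one ((hA q hq).inter (hA r hr))).symm
  have i1 : Integrable (fun x => ∑ q ∈ S, (A q).indicator (1 : Ω → ℝ) x) μ :=
    integrable_finsetSum _ fun q hq => hindic (hA q hq)
  have i2 : Integrable (fun x => ∑ q ∈ S, ∑ r ∈ S, (A q ∩ A r).indicator (1 : Ω → ℝ) x) μ :=
    integrable_finsetSum _ fun q hq => integrable_finsetSum _ fun r hr =>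
      hindic ((hA q hq).inter (hA r hr))
  rw [e1, e2, ← integral_const_mul, ← integral_const_mul,
    ← integral_sub (i1.const_mul _) (i2.const_mul _), ← integral_indicator_one hUm]
  refine integral_mono ((i1.const_mul _).sub (i2.const_mul _)) (hindic hUm) fun x => ?_
  have e3 : ∑ q ∈ S, ∑ r ∈ S, (A q ∩ A r).indicator (1 : Ω → ℝ) x =
      (∑ q ∈ S, (A q).indicator (1 : Ω → ℝ) x) ^ 2 := by
    rw [sq, Finset.sum_mul_sum]
    refine Finset.sum_congr rfl fun q _ => Finset.sum_congr rfl fun r _ => ?_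
    rw [Set.inter_indicator_one, Pi.mul_apply]
  simp only [e3]
  by_cases hx : x ∈ U
  · rw [Set.indicator_of_mem hx, Pi.one_apply]
    nlinarith [sq_nonneg (1 - c * ∑ q ∈ S, (A q).indicator (1 : Ω → ℝ) x)]
  · have : ∑ q ∈ S, (A q).indicator (1 : Ω → ℝ) x = 0 := by
      refine Finset.sum_eq_zero fun q hq => Set.indicator_of_notMem (fun h => hx ?_) _
      exact Set.mem_biUnion hq h
    rw [this, Set.indicator_of_notMem hx]
    simp

lemma exists_finset_mass {lam : ℕ → ℝ} (h0 : ∀ q, 0 ≤ lam q) (h1 : ∀ q, lam q ≤ 1 / 2)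
    (hdiv : ¬Summable lam) (n₀ : ℕ) :
    ∃ S : Finset ℕ, (∀ q ∈ S, n₀ ≤ q) ∧ 1 / 2 ≤ mass lam S ∧ mass lam S ≤ 1 := by
  have hex : ∃ n, 1 / 2 ≤ mass lam (Finset.Ico n₀ (n₀ + n)) := by
    have hsh : ¬Summable fun k => lam (k + n₀) := fun h => hdiv ((summable_nat_add_iff n₀).1 h)
    have ht := (not_summable_iff_tendsto_nat_atTop_of_nonneg fun k => h0 (k + n₀)).1 hsh
    obtain ⟨n, hn⟩ := (ht.eventually (eventually_ge_atTop (1 / 2))).exists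
    refine ⟨n, ?_⟩
    rw [mass, Finset.sum_Ico_eq_sum_range]
    simpa [add_comm] using hn
  classical
  set n := Nat.find hex with hn
  refine ⟨Finset.Ico n₀ (n₀ + n), fun q hq => (Finset.mem_Ico.1 hq).1, Nat.find_spec hex, ?_⟩
  rcases Nat.eq_zero_or_pos n with hz | hpos
  · rw [hz]; simp [mass]
  · have hlt := Nat.find_min hex (m := n - 1) (by omega)
    have e : mass lam (Finset.Ico n₀ (n₀ + n)) =
        mass lam (Finset.Ico n₀ (n₀ + (n - 1))) + lam (n₀ + (n - 1)) := by
      rw [mass, mass, ← Finset.sum_Ico_succ_top (by omega)]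
      congr 2
      omega
    rw [e]
    linarith [h1 (n₀ + (n - 1)), not_le.1 hlt]

lemma exists_measureReal_biUnion_ge : ∃ c : ℝ, 0 < c ∧ ∀ ψ : ℕ → ℝ,
    (∀ q, 0 ≤ ψ q) → (∀ q, ψ q ≤ 1 / 2) → ¬Summable (fun q => ψ q * phiDensity q) →
    ∀ n₀, 0 < n₀ → ∃ S : Finset ℕ, (∀ q ∈ S, n₀ ≤ q) ∧
      c ≤ volume.real (⋃ q ∈ S, approxSet ψ q) := by
  obtain ⟨C, hC0, hC⟩ := exists_sum_inter_le
  refine ⟨1 / (2 + C), by positivity, fun ψ h0 h1 hdiv n₀ hn₀ => ?_⟩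
  obtain ⟨S, hS, hm1, hm2⟩ := exists_finset_mass
    (fun q => mul_nonneg (h0 q) (phiDensity_nonneg q))
    (fun q => (mul_le_of_le_one_right (h0 q) (phiDensity_le_one q)).trans (h1 q)) hdiv n₀
  refine ⟨S, hS, le_trans ?_ (le_measureReal_biUnion volume (approxSet ψ) S
    (fun q hq => measurableSet_approxSet (hn₀.trans_le (hS q hq))) (1 / (2 + C)))⟩
  have hsum : ∑ q ∈ S, volume.real (approxSet ψ q) =
      2 * mass (fun q => ψ q * phiDensity q) S := by
    rw [mass, Finset.mul_sum]
    exact Finset.sum_congr rfl fun q hq =>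
      measureReal_approxSet (hn₀.trans_le (hS q hq)) (h0 q) (h1 q)
  have hcross := hC ψ S h0 h1 (fun q hq => (hn₀.trans_le (hS q hq)).ne') hm2
  have hsq : ∑ q ∈ S, ∑ r ∈ S, volume.real (approxSet ψ q ∩ approxSet ψ r) ≤ 2 + C := by
    classical
    have e : ∑ q ∈ S, ∑ r ∈ S, volume.real (approxSet ψ q ∩ approxSet ψ r) =
        ∑ q ∈ S, volume.real (approxSet ψ q) + ∑ q ∈ S, ∑ r ∈ S,
          (if q ≠ r then volume.real (approxSet ψ q ∩ approxSet ψ r) else 0) := by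
      rw [← Finset.sum_add_distrib]
      refine Finset.sum_congr rfl fun q hq => ?_
      rw [← Finset.sum_erase_add _ _ hq, ← Finset.sum_erase_add (a := q) S
        (fun r => if q ≠ r then volume.real (approxSet ψ q ∩ approxSet ψ r) else 0) hq,
        Set.inter_self, if_neg (by simp), add_zero, add_comm]
      congr 1
      exact Finset.sum_congr rfl fun r hr => (if_pos (Finset.ne_of_mem_erase hr).symm).symm
    rw [e, hsum]
    have := (le_of_eq_of_le (by congr!) hcross : (∑ q ∈ S, ∑ r ∈ S,
          (if q ≠ r then volume.real (approxSet ψ q ∩ approxSet ψ r) else 0)) ≤ C)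
    linarith
  have hpos : 0 < 2 + C := by positivity
  have h2 : (1 / (2 + C)) ^ 2 * ∑ q ∈ S, ∑ r ∈ S, volume.real (approxSet ψ q ∩ approxSet ψ r)
      ≤ 1 / (2 + C) := by
    calc _ ≤ (1 / (2 + C)) ^ 2 * (2 + C) := by gcongr
      _ = _ := by field_simp
  have h3 : 2 * (1 / (2 + C)) * 1 ≤ 2 * (1 / (2 + C)) * ∑ q ∈ S, volume.real (approxSet ψ q) := by
    rw [hsum]
    gcongr
    linarith
  linarith

lemma ae_mem_addWellApproximable {ψ : ℕ → ℝ} (h0 : ∀ q, 0 ≤ ψ q) (h1 : ∀ q, ψ q ≤ 1 / 2)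
    (hdiv : ¬Summable fun q => ψ q * phiDensity q) :
    ∀ᵐ x : UnitAddCircle, x ∈ addWellApproximable UnitAddCircle fun q => ψ q / q := by
  have hδ : Tendsto (fun q : ℕ => ψ q / q) atTop (nhds 0) := by
    refine squeeze_zero (fun q => div_nonneg (h0 q) q.cast_nonneg)
      (fun q => div_le_div_of_nonneg_right (h1 q) q.cast_nonneg) ?_
    exact tendsto_const_div_atTop_nhds_zero_nat (1 / 2)
  refine (AddCircle.addWellApproximable_ae_empty_or_univ _ hδ).resolve_left fun hae => ?_
  obtain ⟨c, hc, hcS⟩ := exists_measureReal_biUnion_ge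
  set B : ℕ → Set UnitAddCircle := fun n => ⋃ q, ⋃ _ : 0 < q ∧ n ≤ q, approxSet ψ q with hB
  have hBm : ∀ n, MeasurableSet (B n) := fun n =>
    MeasurableSet.iUnion fun q => MeasurableSet.iUnion fun hq => measurableSet_approxSet hq.1
  have hanti : Antitone B := fun m n hmn => Set.iUnion_mono fun q =>
    Set.iUnion_mono' fun hq => ⟨⟨hq.1, hmn.trans hq.2⟩, subset_rfl⟩
  have heq : addWellApproximable UnitAddCircle (fun q => ψ q / q) = ⋂ n, B n := by
    ext x
    rw [mem_add_wellApproximable_iff, blimsup_eq_iInf_biSup_of_nat]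
    rfl
  have hnull : volume (⋂ n, B n) = 0 := by
    rw [← heq]
    exact measure_eq_zero_iff_ae_notMem.2 hae
  have hlim := tendsto_measure_iInter_atTop (μ := volume) (fun n => (hBm n).nullMeasurableSet)
    hanti ⟨0, measure_ne_top _ _⟩
  rw [hnull] at hlim
  have hge : ∀ n, ENNReal.ofReal c ≤ volume (B n) := by
    intro n
    obtain ⟨S, hS, hSc⟩ := hcS ψ h0 h1 hdiv (n + 1) (Nat.succ_pos n)
    calc ENNReal.ofReal c ≤ volume (⋃ q ∈ S, approxSet ψ q) := by
          rw [← ENNReal.ofReal_toReal (measure_ne_top volume (⋃ q ∈ S, approxSet ψ q))]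
          exact ENNReal.ofReal_le_ofReal hSc
      _ ≤ volume (B n) := measure_mono <| Set.iUnion_mono fun q => Set.iUnion_mono' fun hq =>
          ⟨⟨by have := hS q hq; omega, by have := hS q hq; omega⟩, subset_rfl⟩
  have := ge_of_tendsto' hlim hge
  exact (ENNReal.ofReal_pos.2 hc).not_ge this

/-- The divergence part of the Duffin–Schaeffer theorem, with reducedness dropped in the
conclusion. -/
theorem ae_infinite_nint_lt {ψ : ℕ → ℝ} (h0 : ∀ q, 0 ≤ ψ q) (h1 : ∀ q, ψ q ≤ 1 / 2)
    (hdiv : ¬Summable fun q => ψ q * phiDensity q) :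
    ∀ᵐ α ∂(volume.restrict (Set.Icc (0 : ℝ) 1)), {q : ℕ | nint (α * q) < ψ q}.Infinite := by
  have h := (UnitAddCircle.measurePreserving_mk 0).quasiMeasurePreserving.ae
    (ae_mem_addWellApproximable h0 h1 hdiv)
  rw [zero_add, Measure.restrict_congr_set Ioc_ae_eq_Icc] at h
  filter_upwards [h] with α hα
  rw [UnitAddCircle.mem_addWellApproximable_iff] at hα
  refine hα.mono fun q hq => ?_
  obtain ⟨m, hmq, -, hm⟩ := hq
  have hq0 : (0 : ℝ) < q := by exact_mod_cast (Nat.zero_le m).trans_lt hmq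
  rw [← AddCircle.coe_sub, lt_div_iff₀' hq0, dist_fractions_mul _ hq0] at hm
  refine lt_of_le_of_lt ?_ hm
  set j := round (α - m / q)
  have e : (q : ℝ) * (α - m / q) - q * (j : ℤ) = α * q - ((m + q * j : ℤ) : ℝ) := by
    push_cast; field_simp; ring
  rw [e]
  exact round_le _ _

/-- The distinct floored differences among the first `N` terms. -/
noncomputable def diffSet (a : ℕ → ℝ) (N : ℕ) : Finset ℕ :=
  (((Finset.Icc 1 N) ×ˢ (Finset.Icc 1 N)).filter fun x => x.1 ≠ x.2).image
    fun x => ⌊|a x.1 - a x.2|⌋₊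

lemma mem_diffSet {a : ℕ → ℝ} {N k : ℕ} : k ∈ diffSet a N ↔
    ∃ m n : ℕ, 1 ≤ m ∧ m ≤ N ∧ 1 ≤ n ∧ n ≤ N ∧ m ≠ n ∧ k = ⌊|a m - a n|⌋₊ := by
  simp only [diffSet, Finset.mem_image, Finset.mem_filter, Finset.mem_product, Finset.mem_Icc,
    Prod.exists]
  constructor
  · rintro ⟨m, n, ⟨⟨⟨h1, h2⟩, h3, h4⟩, h5⟩, rfl⟩
    exact ⟨m, n, h1, h2, h3, h4, h5, rfl⟩
  · rintro ⟨m, n, h1, h2, h3, h4, h5, rfl⟩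
    exact ⟨m, n, ⟨⟨⟨h1, h2⟩, h3, h4⟩, h5⟩, rfl⟩

lemma intDiffs_eq (a : ℕ → ℝ) (N : ℕ) :
    {k : ℤ | ∃ m n : ℕ, 1 ≤ m ∧ m ≤ N ∧ 1 ≤ n ∧ n ≤ N ∧ m ≠ n ∧ k = ⌊|a m - a n|⌋} =
      Nat.cast '' (diffSet a N : Set ℕ) := by
  have e : ∀ m n, ⌊|a m - a n|⌋ = ((⌊|a m - a n|⌋₊ : ℕ) : ℤ) := fun m n =>
    (Int.natCast_floor_eq_floor (abs_nonneg _)).symm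
  ext k
  simp only [Set.mem_ofPred_eq, Set.mem_image, Finset.mem_coe, mem_diffSet]
  constructor
  · rintro ⟨m, n, h1, h2, h3, h4, h5, rfl⟩
    exact ⟨_, ⟨m, n, h1, h2, h3, h4, h5, rfl⟩, (e m n).symm⟩
  · rintro ⟨_, ⟨m, n, h1, h2, h3, h4, h5, rfl⟩, rfl⟩
    exact ⟨m, n, h1, h2, h3, h4, h5, (e m n).symm⟩

lemma Hcard_eq (a : ℕ → ℝ) (N : ℕ) : Hcard a N = (diffSet a N).card := by
  rw [Hcard, intDiffs_eq, Set.ncard_image_of_injective _ Nat.cast_injective, Set.ncard_coe_finset]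

lemma le_sSup_intDiffs {a : ℕ → ℝ} {N h : ℕ} (hh : h ∈ diffSet a N) :
    (h : ℤ) ≤ sSup {k : ℤ | ∃ m n : ℕ, 1 ≤ m ∧ m ≤ N ∧ 1 ≤ n ∧ n ≤ N ∧ m ≠ n ∧
      k = ⌊|a m - a n|⌋} := by
  rw [intDiffs_eq]
  exact le_csSup ((diffSet a N).finite_toSet.image _).bddAbove ⟨h, hh, rfl⟩

lemma diffSet_mono (a : ℕ → ℝ) : Monotone (diffSet a) := by
  intro M N hMN k hk
  rw [mem_diffSet] at hk ⊢
  obtain ⟨m, n, h1, h2, h3, h4, h5⟩ := hk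
  exact ⟨m, n, h1, h2.trans hMN, h3, h4.trans hMN, h5⟩

lemma nint_nonneg (x : ℝ) : 0 ≤ nint x := abs_nonneg _

lemma nint_le_half (x : ℝ) : nint x ≤ 1 / 2 := abs_sub_round x

lemma floorDeltaMin_le {a : ℕ → ℝ} {N h : ℕ} (hh : h ∈ diffSet a N) (α : ℝ) :
    floorDeltaMin a α N ≤ nint (α * h) := by
  obtain ⟨m, n, h1, h2, h3, h4, h5, rfl⟩ := mem_diffSet.1 hh
  refine csInf_le ⟨0, ?_⟩ ⟨m, n, h1, h2, h3, h4, h5, ?_⟩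
  · rintro _ ⟨_, _, _, _, _, _, _, rfl⟩
    exact nint_nonneg _
  · rw [natCast_floor_eq_intCast_floor (abs_nonneg _)]

lemma card_diffSet_succ_le (a : ℕ → ℝ) (N : ℕ) :
    (diffSet a (N + 1)).card ≤ (diffSet a N).card + N := by
  have hsub : diffSet a (N + 1) ⊆
      diffSet a N ∪ (Finset.Icc 1 N).image fun n => ⌊|a (N + 1) - a n|⌋₊ := by
    intro k hk
    obtain ⟨m, n, h1, h2, h3, h4, h5, rfl⟩ := mem_diffSet.1 hk
    rw [Finset.mem_union, Finset.mem_image, mem_diffSet]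
    rcases Nat.lt_or_ge N m with hm | hm
    · obtain rfl : m = N + 1 := by omega
      exact Or.inr ⟨n, Finset.mem_Icc.2 ⟨h3, by omega⟩, rfl⟩
    rcases Nat.lt_or_ge N n with hn | hn
    · obtain rfl : n = N + 1 := by omega
      exact Or.inr ⟨m, Finset.mem_Icc.2 ⟨h1, hm⟩, by rw [abs_sub_comm]⟩
    · exact Or.inl ⟨m, n, h1, hm, h3, hn, h5, rfl⟩
  refine (Finset.card_le_card hsub).trans ((Finset.card_union_le _ _).trans ?_)
  gcongr
  exact Finset.card_image_le.trans (by simp)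

lemma le_card_diffSet_add_one {a : ℕ → ℝ}
    (hsep : ∀ m n, 1 ≤ m → 1 ≤ n → m ≠ n → 1 ≤ |a m - a n|) (N : ℕ) :
    N ≤ (diffSet a N).card + 1 := by
  rcases Nat.eq_zero_or_pos N with rfl | hN
  · omega
  obtain ⟨m₀, hm₀, hmin⟩ := Finset.exists_min_image (Finset.Icc 1 N) a
    ⟨1, Finset.mem_Icc.2 ⟨le_rfl, hN⟩⟩
  have hcard : ((Finset.Icc 1 N).erase m₀).card ≤ (diffSet a N).card := by
    refine Finset.card_le_card_of_injOn (fun n => ⌊|a n - a m₀|⌋₊) ?_ ?_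
    · intro n hn
      have hn' := Finset.mem_erase.1 hn
      have h1 := Finset.mem_Icc.1 hn'.2
      have h2 := Finset.mem_Icc.1 hm₀
      exact mem_diffSet.2 ⟨n, m₀, h1.1, h1.2, h2.1, h2.2, hn'.1, rfl⟩
    · intro n hn n' hn' h
      by_contra hne
      have h1 := (Finset.mem_erase.1 hn).2
      have h2 := (Finset.mem_erase.1 hn').2
      have hs := hsep n n' (Finset.mem_Icc.1 h1).1 (Finset.mem_Icc.1 h2).1 hne
      simp only at h
      have p1 : 0 ≤ a n - a m₀ := sub_nonneg.2 (hmin n h1)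
      have p2 : 0 ≤ a n' - a m₀ := sub_nonneg.2 (hmin n' h2)
      rw [abs_of_nonneg p1, abs_of_nonneg p2] at h
      have q1 := Nat.floor_le p1
      have q2 := Nat.lt_floor_add_one (a n - a m₀)
      have q3 := Nat.floor_le p2
      have q4 := Nat.lt_floor_add_one (a n' - a m₀)
      rw [h] at q1 q2
      have : |a n - a n'| < 1 := abs_lt.2 ⟨by linarith, by linarith⟩
      linarith
  rw [Finset.card_erase_of_mem hm₀, Nat.card_Icc] at hcard
  omega

lemma log_sub_log_le {x y : ℝ} (hx : 0 < x) (hy : 0 < y) :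
    Real.log y - Real.log x ≤ (y - x) / x := by
  rw [← Real.log_div hy.ne' hx.ne', sub_div, div_self hx.ne']
  exact Real.log_le_sub_one_of_pos (by positivity)

lemma logloglog_sub_le {x y : ℝ} (hx0 : 0 < x) (hx1 : 1 ≤ Real.log x)
    (hx2 : 1 ≤ Real.log (Real.log x)) (hxy : x ≤ y) (hyx : y ≤ 3 * x) :
    Real.log (Real.log (Real.log y)) - Real.log (Real.log (Real.log x)) ≤
      27 * ((y - x) / (y * Real.log y * Real.log (Real.log y))) := by
  have hy0 : 0 < y := by linarith
  have hy1 : Real.log x ≤ Real.log y := Real.log_le_log hx0 hxy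
  have hy2 : Real.log (Real.log x) ≤ Real.log (Real.log y) :=
    Real.log_le_log (by linarith) hy1
  have h3 : Real.log 3 ≤ 2 := by
    have := Real.log_le_sub_one_of_pos (show (0 : ℝ) < 3 by norm_num)
    linarith
  have hly : Real.log y ≤ 3 * Real.log x := by
    have := Real.log_le_log hy0 hyx
    rw [Real.log_mul (by norm_num) hx0.ne'] at this
    linarith
  have hlly : Real.log (Real.log y) ≤ 3 * Real.log (Real.log x) := by
    have := Real.log_le_log (by linarith) hly
    rw [Real.log_mul (by norm_num) (by linarith)] at this
    linarith
  set lx := Real.log x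
  set ly := Real.log y
  set llx := Real.log lx
  set lly := Real.log ly
  have p1 : 0 < lx := by linarith
  have p2 : 0 < llx := by linarith
  have p3 : 0 < ly := by linarith
  have p4 : 0 < lly := by linarith
  calc Real.log lly - Real.log llx ≤ (lly - llx) / llx := log_sub_log_le p2 p4
    _ ≤ ((ly - lx) / lx) / llx := by gcongr; exact log_sub_log_le p1 p3
    _ ≤ (((y - x) / x) / lx) / llx := by gcongr; exact log_sub_log_le hx0 hy0
    _ = (y - x) / (x * lx * llx) := by rw [div_div, div_div, mul_assoc]
    _ ≤ (y - x) / ((y / 3) * (ly / 3) * (lly / 3)) := by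
        have : 0 ≤ y - x := by linarith
        gcongr <;> linarith
    _ = _ := by field_simp; norm_num

lemma Log_le_Log {x y : ℝ} (hx : 0 < x) (hxy : x ≤ y) : Log x ≤ Log y :=
  max_le_max le_rfl (Real.log_le_log hx hxy)

lemma Log2_le_Log2 {x y : ℝ} (hx : 0 < x) (hxy : x ≤ y) : Log2 x ≤ Log2 y :=
  Log_le_Log (Log_pos _) (Log_le_Log hx hxy)

/-- The claimed bound for `floorDeltaMin a α N`. -/
noncomputable def gapBound (a : ℕ → ℝ) (N : ℕ) : ℝ :=
  4 * Log2 ((sSup {k : ℤ | ∃ m n : ℕ, 1 ≤ m ∧ m ≤ N ∧ 1 ≤ n ∧ n ≤ N ∧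
                m ≠ n ∧ k = ⌊|a m - a n|⌋} : ℤ) : ℝ) /
            ((Hcard a N : ℝ) * Log ((N : ℝ) / 9) * Log2 ((N : ℝ) / 9))

lemma gapBound_nonneg (a : ℕ → ℝ) (N : ℕ) : 0 ≤ gapBound a N := by
  have h1 := (Log2_pos ((sSup {k : ℤ | ∃ m n : ℕ, 1 ≤ m ∧ m ≤ N ∧ 1 ≤ n ∧ n ≤ N ∧
                m ≠ n ∧ k = ⌊|a m - a n|⌋} : ℤ) : ℝ)).le
  have h2 := Log_pos ((N : ℝ) / 9)
  have h3 := Log2_pos ((N : ℝ) / 9)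
  unfold gapBound
  positivity

/-- The first index at which `h` occurs as a floored difference. -/
noncomputable def firstIndex (a : ℕ → ℝ) (h : ℕ) : ℕ := sInf {N | h ∈ diffSet a N}

lemma mem_diffSet_firstIndex {a : ℕ → ℝ} {h : ℕ} (hpos : 0 < firstIndex a h) :
    h ∈ diffSet a (firstIndex a h) :=
  Nat.sInf_mem (s := {N | h ∈ diffSet a N}) (Nat.nonempty_of_pos_sInf hpos)

lemma firstIndex_eq {a : ℕ → ℝ} {h N : ℕ} (h1 : h ∈ diffSet a (N + 1)) (h2 : h ∉ diffSet a N) :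
    firstIndex a h = N + 1 := by
  refine le_antisymm (Nat.sInf_le h1) ?_
  by_contra hlt
  have hmem : h ∈ diffSet a (firstIndex a h) := Nat.sInf_mem (s := {N | h ∈ diffSet a N}) ⟨_, h1⟩
  exact h2 (diffSet_mono a (by omega) hmem)

/-- The approximation function recording `gapBound` at the first occurrence of each difference. -/
noncomputable def firstBound (a : ℕ → ℝ) (N₀ h : ℕ) : ℝ :=
  if N₀ < firstIndex a h then gapBound a (firstIndex a h) else 0

lemma firstBound_nonneg (a : ℕ → ℝ) (N₀ h : ℕ) : 0 ≤ firstBound a N₀ h := by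
  rw [firstBound]
  split_ifs
  exacts [gapBound_nonneg _ _, le_rfl]

lemma frequently_of_infinite {a : ℕ → ℝ} {α : ℝ} {N₀ : ℕ}
    (hinf : {q : ℕ | nint (α * q) < firstBound a N₀ q}.Infinite) :
    ∃ᶠ N in atTop, floorDeltaMin a α N ≤ gapBound a N := by
  rw [frequently_atTop]
  intro N₁
  obtain ⟨q, hq, hqN⟩ := hinf.exists_notMem_finset (diffSet a N₁)
  have hq' : nint (α * q) < firstBound a N₀ q := hq
  rw [firstBound] at hq'
  split_ifs at hq' with hlt
  · have hmem := mem_diffSet_firstIndex ((Nat.zero_le _).trans_lt hlt)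
    refine ⟨firstIndex a q, ?_, (floorDeltaMin_le hmem α).trans hq'.le⟩
    by_contra hN
    exact hqN (diffSet_mono a (by omega) hmem)
  · exact absurd hq' (nint_nonneg _).not_gt

lemma pos_of_mem_diffSet {a : ℕ → ℝ} (hsep : ∀ m n, 1 ≤ m → 1 ≤ n → m ≠ n → 1 ≤ |a m - a n|)
    {N h : ℕ} (hh : h ∈ diffSet a N) : 0 < h := by
  obtain ⟨m, n, h1, _, h3, _, h5, rfl⟩ := mem_diffSet.1 hh
  exact Nat.floor_pos.2 (hsep m n h1 h3 h5)

lemma tendsto_card_diffSet {a : ℕ → ℝ}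
    (hsep : ∀ m n, 1 ≤ m → 1 ≤ n → m ≠ n → 1 ≤ |a m - a n|) :
    Tendsto (fun N => ((diffSet a N).card : ℝ)) atTop atTop := by
  refine tendsto_natCast_atTop_atTop.comp (tendsto_atTop.2 fun b => ?_)
  filter_upwards [eventually_ge_atTop (b + 1)] with N hN
  have := le_card_diffSet_add_one hsep N
  omega

lemma le_firstBound_mul_phiDensity {a : ℕ → ℝ}
    (hsep : ∀ m n, 1 ≤ m → 1 ≤ n → m ≠ n → 1 ≤ |a m - a n|) {N₀ N h : ℕ} (hN : N₀ ≤ N)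
    (h1 : h ∈ diffSet a (N + 1)) (h2 : h ∉ diffSet a N)
    (hl : 1 ≤ Real.log ((diffSet a (N + 1)).card : ℝ))
    (hll : 1 ≤ Real.log (Real.log ((diffSet a (N + 1)).card : ℝ))) :
    4 * Real.exp (-8) / (((diffSet a (N + 1)).card : ℝ) * Real.log ((diffSet a (N + 1)).card : ℝ) *
      Real.log (Real.log ((diffSet a (N + 1)).card : ℝ))) ≤
      firstBound a N₀ h * phiDensity h := by
  have hf := firstIndex_eq h1 h2
  have hh := pos_of_mem_diffSet hsep h1
  rw [firstBound, hf, if_pos (by omega), gapBound, Hcard_eq]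
  set B := sSup {k : ℤ | ∃ m n : ℕ, 1 ≤ m ∧ m ≤ N + 1 ∧ 1 ≤ n ∧ n ≤ N + 1 ∧
                m ≠ n ∧ k = ⌊|a m - a n|⌋}
  have hB : (h : ℝ) ≤ (B : ℝ) := by exact_mod_cast le_sSup_intDiffs h1
  set y : ℝ := ((diffSet a (N + 1)).card : ℝ) with hy
  have hcard1 : 0 < (diffSet a (N + 1)).card := Finset.card_pos.2 ⟨h, h1⟩
  have hy0 : 0 < y := Nat.cast_pos.2 hcard1
  have hNy : ((N + 1 : ℕ) : ℝ) / 9 ≤ y := by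
    have e : N + 1 ≤ 9 * (diffSet a (N + 1)).card := by
      have := le_card_diffSet_add_one hsep (N + 1)
      omega
    have e' : ((N + 1 : ℕ) : ℝ) ≤ 9 * y := by rw [hy]; exact_mod_cast e
    linarith
  have hN9 : 0 < ((N + 1 : ℕ) : ℝ) / 9 := by positivity
  have eL : Log y = Real.log y := max_eq_right hl
  have eL2 : Log2 y = Real.log (Real.log y) := by rw [Log2, eL]; exact max_eq_right hll
  have k1 : Log (((N + 1 : ℕ) : ℝ) / 9) ≤ Real.log y := eL ▸ Log_le_Log hN9 hNy
  have k2 : Log2 (((N + 1 : ℕ) : ℝ) / 9) ≤ Real.log (Real.log y) := eL2 ▸ Log2_le_Log2 hN9 hNy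
  have k3 := le_phiDensity_mul_Log2 hh.ne'
  have k4 : Log2 (h : ℝ) ≤ Log2 (B : ℝ) := Log2_le_Log2 (by exact_mod_cast hh) hB
  have p1 := Log_pos (((N + 1 : ℕ) : ℝ) / 9)
  have p2 := Log2_pos (((N + 1 : ℕ) : ℝ) / 9)
  have p3 := phiDensity_nonneg h
  have p4 := Log2_pos (B : ℝ)
  calc _ ≤ 4 * Real.exp (-8) /
          (y * Log (((N + 1 : ℕ) : ℝ) / 9) * Log2 (((N + 1 : ℕ) : ℝ) / 9)) := by
        gcongr
    _ ≤ 4 * (phiDensity h * Log2 (B : ℝ)) /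
        (y * Log (((N + 1 : ℕ) : ℝ) / 9) * Log2 (((N + 1 : ℕ) : ℝ) / 9)) := by
        have : phiDensity h * Log2 (h : ℝ) ≤ phiDensity h * Log2 (B : ℝ) := by gcongr
        gcongr
        linarith
    _ = _ := by ring

lemma not_summable_firstBound {a : ℕ → ℝ}
    (hsep : ∀ m n, 1 ≤ m → 1 ≤ n → m ≠ n → 1 ≤ |a m - a n|) (N₀ : ℕ) :
    ¬Summable fun h => firstBound a N₀ h * phiDensity h := by
  intro hsum
  set lam : ℕ → ℝ := fun h => firstBound a N₀ h * phiDensity h with hlam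
  have hlam0 : ∀ h, 0 ≤ lam h := fun h =>
    mul_nonneg (firstBound_nonneg _ _ _) (phiDensity_nonneg _)
  have hH := tendsto_card_diffSet hsep
  have hlog := Real.tendsto_log_atTop.comp hH
  have hloglog := Real.tendsto_log_atTop.comp hlog
  have hG := Real.tendsto_log_atTop.comp hloglog
  obtain ⟨N₁, hN₁⟩ := eventually_atTop.1 ((hlog.eventually (eventually_ge_atTop 1)).and
    (hloglog.eventually (eventually_ge_atTop 1)))
  simp only [Function.comp_apply] at hN₁
  set N₂ := max (max N₀ N₁) 2 with hN₂
  set G : ℕ → ℝ := fun N => Real.log (Real.log (Real.log ((diffSet a N).card : ℝ))) with hGdef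
  have hstep : ∀ N, N₂ ≤ N →
      G (N + 1) - G N ≤
        27 * Real.exp 8 * (mass lam (diffSet a (N + 1)) - mass lam (diffSet a N)) := by
    intro N hN
    have hN0 : N₀ ≤ N := by omega
    have h2N : 2 ≤ N := by omega
    have hN1 : N₁ ≤ N := by omega
    obtain ⟨a1, a2⟩ := hN₁ N hN1
    obtain ⟨b1, b2⟩ := hN₁ (N + 1) (by omega)
    set y : ℝ := ((diffSet a (N + 1)).card : ℝ) with hy
    set x : ℝ := ((diffSet a N).card : ℝ) with hx
    have hcN := le_card_diffSet_add_one hsep N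
    have hcs := card_diffSet_succ_le a N
    have hx0 : 0 < x := by
      have : 0 < (diffSet a N).card := by omega
      exact Nat.cast_pos.2 this
    have hxy : x ≤ y := by
      exact Nat.cast_le.2 (Finset.card_le_card (diffSet_mono a (Nat.le_succ N)))
    have hyx : y ≤ 3 * x := by
      have : (diffSet a (N + 1)).card ≤ 3 * (diffSet a N).card := by omega
      rw [hx, hy]
      exact_mod_cast this
    have hd : mass lam (diffSet a (N + 1)) - mass lam (diffSet a N) =
        ∑ h ∈ diffSet a (N + 1) \ diffSet a N, lam h := by
      rw [mass, mass, ← Finset.sum_sdiff (diffSet_mono a (Nat.le_succ N)), add_sub_cancel_right]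
    have hcard : ((diffSet a (N + 1) \ diffSet a N).card : ℝ) = y - x := by
      rw [Finset.card_sdiff_of_subset (diffSet_mono a (Nat.le_succ N)),
        Nat.cast_sub (Finset.card_le_card (diffSet_mono a (Nat.le_succ N)))]
    have hlow : (y - x) * (4 * Real.exp (-8) / (y * Real.log y * Real.log (Real.log y))) ≤
        ∑ h ∈ diffSet a (N + 1) \ diffSet a N, lam h := by
      rw [← hcard, ← nsmul_eq_mul]
      refine Finset.card_nsmul_le_sum _ _ _ fun h hh => ?_
      rw [Finset.mem_sdiff] at hh
      exact le_firstBound_mul_phiDensity hsep hN0 hh.1 hh.2 b1 b2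
    have hana := logloglog_sub_le hx0 a1 a2 hxy hyx
    have hden : 0 < y * Real.log y * Real.log (Real.log y) := by
      have : 0 < y := by linarith
      positivity
    have e8 : Real.exp 8 * Real.exp (-8) = 1 := by rw [← Real.exp_add]; simp
    rw [hd]
    have hfrac : 0 ≤ (y - x) / (y * Real.log y * Real.log (Real.log y)) :=
      div_nonneg (by linarith) hden.le
    calc G (N + 1) - G N ≤ 27 * ((y - x) / (y * Real.log y * Real.log (Real.log y))) := hana
      _ ≤ 27 * (4 * ((y - x) / (y * Real.log y * Real.log (Real.log y)))) := by linarith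
      _ = 27 * Real.exp 8 *
          ((y - x) * (4 * Real.exp (-8) / (y * Real.log y * Real.log (Real.log y)))) := by
          linear_combination (-108 * ((y - x) / (y * Real.log y * Real.log (Real.log y)))) * e8
      _ ≤ _ := by gcongr
  have htel : ∀ k, G (N₂ + k) - G N₂ ≤
      27 * Real.exp 8 * (mass lam (diffSet a (N₂ + k)) - mass lam (diffSet a N₂)) := by
    intro k
    induction k with
    | zero => simp
    | succ k ih =>
      have := hstep (N₂ + k) (by omega)
      rw [← add_assoc]
      linarith
  have hbound : ∀ k, G (N₂ + k) ≤ G N₂ + 27 * Real.exp 8 * ∑' h, lam h := by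
    intro k
    have h1 : mass lam (diffSet a (N₂ + k)) ≤ ∑' h, lam h :=
      hsum.sum_le_tsum _ fun h _ => hlam0 h
    have h2 := mass_nonneg hlam0 (diffSet a N₂)
    have h3 : 27 * Real.exp 8 * (mass lam (diffSet a (N₂ + k)) - mass lam (diffSet a N₂)) ≤
        27 * Real.exp 8 * ∑' h, lam h := by
      gcongr
      linarith
    linarith [htel k]
  obtain ⟨N, hN, hN'⟩ := ((hG.eventually (eventually_gt_atTop
    (G N₂ + 27 * Real.exp 8 * ∑' h, lam h))).and (eventually_ge_atTop N₂)).exists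
  have := hbound (N - N₂)
  rw [Nat.add_sub_cancel' hN'] at this
  simp only [Function.comp_apply] at hN
  exact (not_lt.2 this) hN

theorem stmt4 (a : ℕ → ℝ)
    (hpos : ∀ n, 1 ≤ n → 0 < a n)
    (hdist : ∀ m n, 1 ≤ m → 1 ≤ n → m ≠ n → a m ≠ a n)
    (hsep : ∀ m n, 1 ≤ m → 1 ≤ n → m ≠ n → 1 ≤ |a m - a n|) :
    ∀ᵐ α ∂(volume.restrict (Set.Icc (0:ℝ) 1)),
      ∃ᶠ N in atTop,
        floorDeltaMin a α N ≤
          4 * Log2 ((sSup {k : ℤ | ∃ m n : ℕ, 1 ≤ m ∧ m ≤ N ∧ 1 ≤ n ∧ n ≤ N ∧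
                m ≠ n ∧ k = ⌊|a m - a n|⌋} : ℤ) : ℝ) /
            ((Hcard a N : ℝ) * Log ((N : ℝ) / 9) * Log2 ((N : ℝ) / 9)) := by
  change ∀ᵐ α ∂(volume.restrict (Set.Icc (0:ℝ) 1)), ∃ᶠ N in atTop,
    floorDeltaMin a α N ≤ gapBound a N
  by_cases hbig : ∃ᶠ N in atTop, 1 / 2 ≤ gapBound a N
  · refine Eventually.of_forall fun α => ?_
    refine (hbig.and_eventually (eventually_ge_atTop 2)).mono fun N hN => ?_
    have hne : ⌊|a 1 - a 2|⌋₊ ∈ diffSet a N :=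
      mem_diffSet.2 ⟨1, 2, le_rfl, by omega, by omega, hN.2, by omega, rfl⟩
    exact (floorDeltaMin_le hne α).trans ((nint_le_half _).trans hN.1)
  · obtain ⟨N₀, hN₀⟩ := eventually_atTop.1 (not_frequently.1 hbig)
    have hhalf : ∀ h, firstBound a N₀ h ≤ 1 / 2 := by
      intro h
      rw [firstBound]
      split_ifs with hlt
      · exact (not_le.1 (hN₀ _ hlt.le)).le
      · norm_num
    filter_upwards [ae_infinite_nint_lt (firstBound_nonneg a N₀) hhalf
      (not_summable_firstBound hsep N₀)] with α hα
    exact frequently_of_infinite hα
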